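/- Let d > 1 be an odd positive squarefree integer and n ≥ 1 an integer. Then the class number of L_{n,d}^+ is odd if and only if the class number of the real biquadratic field ℚ(√2, √d) is odd. -/

import Mathlib

open IntermediateField NumberField

/-- The quadratic field `ℚ(√m)` realized inside `ℂ` (for `m` of either sign). -/
noncomputable def quadField (m : ℤ) : IntermediateField ℚ ℂ :=
  IntermediateField.adjoin ℚ {z : ℂ | z ^ 2 = (m : ℂ)}

/-- The 2-class group of a number field `K ⊆ ℂ`: the 2-primary component
(= 2-Sylow subgroup) of the ideal class group of its ring of integers. -/
noncomputable def twoClassGroup (K : IntermediateField ℚ ℂ) :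
    Subgroup (ClassGroup (𝓞 K)) :=
  CommGroup.primaryComponent _ 2

/-- `h₂(m)`: the 2-class number of the quadratic field `ℚ(√m)`. -/
noncomputable def h2 (m : ℤ) : ℕ := Nat.card (twoClassGroup (quadField m))

/-- `L_{n,d} = ℚ(ζ_{2^{n+2}}, √d)`, the `n`-th layer of the cyclotomic
`ℤ₂`-extension of `ℚ(√d, √-1)`. -/
noncomputable def Lfield (n : ℕ) (d : ℤ) : IntermediateField ℚ ℂ :=
  IntermediateField.adjoin ℚ
    ({z : ℂ | z ^ 2 ^ (n + 2) = 1} ∪ {z : ℂ | z ^ 2 = (d : ℂ)})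

/-- `ℚ(ζ_{2^{n+2}} + ζ_{2^{n+2}}⁻¹, √d) = ℚ(2cos(2π/2^{n+2}), √d)`.
For `d > 0` this is the maximal real subfield `L_{n,d}⁺` of `L_{n,d}`;
for `d < 0` it is the `n`-th layer `K_{n,|d|}` of the cyclotomic
`ℤ₂`-extension of the imaginary quadratic field `ℚ(√d)`. -/
noncomputable def LplusField (n : ℕ) (d : ℤ) : IntermediateField ℚ ℂ :=
  IntermediateField.adjoin ℚ
    ({((2 * Real.cos (2 * Real.pi / 2 ^ (n + 2)) : ℝ) : ℂ)} ∪ {z : ℂ | z ^ 2 = (d : ℂ)})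

/-- Index comparison for an involution. -/
theorem invol_index {E : Type*} [CommGroup E] (s : E →* E) (hs : ∀ x, s (s x) = x)
    (P M Nm C : Subgroup E)
    (hP : ∀ x, x ∈ P ↔ s x = x) (hM : ∀ x, x ∈ M ↔ x * s x = 1)
    (hN : ∀ x, x ∈ Nm ↔ ∃ y, x = y * s y) (hC : ∀ x, x ∈ C ↔ ∃ y, x = y / s y)
    (r : ℕ) (hPi : (P.map (powMonoidHom 2)).relIndex P = 2 ^ r)
    (hMi : (M.map (powMonoidHom 2)).relIndex M = 2 ^ (r + 1)) :
    C.relIndex M = 2 * Nm.relIndex P ∧ Nm.relIndex P ≠ 0 := by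
  let fN : E →* E := MonoidHom.id E * s
  let fC : E →* E := MonoidHom.id E / s
  have hfN : ∀ x, fN x = x * s x := fun x => rfl
  have hfC : ∀ x, fC x = x / s x := fun x => rfl
  have rN : Nm = fN.range := by
    ext x; rw [hN]; simp only [MonoidHom.mem_range, hfN, eq_comm]
  have rC : C = fC.range := by
    ext x; rw [hC]; simp only [MonoidHom.mem_range, hfC, eq_comm]
  have key : (P.map (powMonoidHom 2)).comap fN = (M.map (powMonoidHom 2)).comap fC := by
    ext x
    simp only [Subgroup.mem_comap, Subgroup.mem_map, powMonoidHom_apply, hfN, hfC, hP, hM]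
    constructor
    · rintro ⟨y, hy, hxy⟩
      refine ⟨x / y, ?_, ?_⟩
      · rw [map_div, hy, div_mul_div_comm, ← hxy, sq, div_self']
      · rw [div_pow, hxy, sq]; rw [mul_div_mul_left_eq_div]
    · rintro ⟨w, hw, hxw⟩
      have hsw : s w = w⁻¹ := eq_inv_of_mul_eq_one_right hw
      refine ⟨x / w, ?_, ?_⟩
      · rw [map_div, hsw]
        have : s x = x / w ^ 2 := by rw [hxw]; simp
        rw [this, sq]; simp [div_eq_mul_inv]; group
      · have : s x = x / w ^ 2 := by rw [hxw]; simp
        rw [this, div_pow, sq]; simp [div_eq_mul_inv, sq]; group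
  have i1 := Subgroup.index_comap (P.map (powMonoidHom 2)) fN
  have i2 := Subgroup.index_comap (M.map (powMonoidHom 2)) fC
  rw [← rN] at i1
  rw [← rC, ← key] at i2
  have h1 : P.map (powMonoidHom 2) ≤ Nm := by
    rintro _ ⟨y, hy, rfl⟩
    rw [hN]; refine ⟨y, ?_⟩
    rw [(hP y).1 hy]; simp [sq]
  have h2 : Nm ≤ P := by
    intro x hx
    obtain ⟨y, rfl⟩ := (hN x).1 hx
    rw [hP, map_mul, hs, mul_comm]
  have h3 : M.map (powMonoidHom 2) ≤ C := by
    rintro _ ⟨y, hy, rfl⟩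
    rw [hC]; refine ⟨y, ?_⟩
    have : s y = y⁻¹ := eq_inv_of_mul_eq_one_right ((hM y).1 hy)
    rw [this]; simp [sq]
  have h4 : C ≤ M := by
    intro x hx
    obtain ⟨y, rfl⟩ := (hC x).1 hx
    rw [hM, map_div, hs]; simp
  have e1 := Subgroup.relIndex_mul_relIndex _ _ _ h1 h2
  have e2 := Subgroup.relIndex_mul_relIndex _ _ _ h3 h4
  rw [hPi, ← i1] at e1
  rw [hMi, ← i2] at e2
  have h0 : (Subgroup.comap fN (Subgroup.map (powMonoidHom 2) P)).index ≠ 0 := by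
    intro h; rw [h] at e1; simp at e1; exact absurd e1.symm (by positivity)
  refine ⟨?_, ?_⟩
  · apply Nat.eq_of_mul_eq_mul_left (Nat.pos_of_ne_zero h0)
    rw [e2, pow_succ, ← e1]; ring
  · intro h; rw [h] at e1; simp at e1; exact absurd e1.symm (by positivity)

theorem index_two_free (n : ℕ) :
    (nsmulAddMonoidHom 2 : (Fin n →₀ ℤ) →+ (Fin n →₀ ℤ)).range.index = 2 ^ n := by
  let f : (Fin n →₀ ℤ) →+ (Fin n → ZMod 2) :=
    { toFun := fun x i => (x i : ZMod 2)
      map_zero' := by ext i; simp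
      map_add' := fun x y => by ext i; simp }
  have hf : f.ker = (nsmulAddMonoidHom 2 : (Fin n →₀ ℤ) →+ (Fin n →₀ ℤ)).range := by
    ext x
    simp only [AddMonoidHom.mem_ker, AddMonoidHom.mem_range]
    constructor
    · intro h
      have h' : ∀ i, ∃ c, x i = 2 * c := fun i => by
        have := congrFun h i
        exact (ZMod.intCast_zmod_eq_zero_iff_dvd _ 2).1 this
      choose c hc using h'
      refine ⟨Finsupp.equivFunOnFinite.symm c, ?_⟩
      ext i
      simp [hc i]
    · rintro ⟨y, rfl⟩
      ext i
      show (((nsmulAddMonoidHom 2 y : Fin n →₀ ℤ) i : ℤ) : ZMod 2) = 0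
      rw [ZMod.intCast_zmod_eq_zero_iff_dvd]
      exact ⟨y i, by simp⟩
  have hs : Function.Surjective f := by
    intro y
    refine ⟨Finsupp.equivFunOnFinite.symm (fun i => ((y i).val : ℤ)), ?_⟩
    ext i
    show (((Finsupp.equivFunOnFinite.symm (fun i => ((y i).val : ℤ)) : Fin n →₀ ℤ) i : ℤ) : ZMod 2) = y i
    simp
  rw [← hf, AddSubgroup.index_ker, AddMonoidHom.range_eq_top.2 hs]
  simp

theorem index_two_finite (T : Type*) [AddCommGroup T] [Finite T] :
    (nsmulAddMonoidHom 2 : T →+ T).range.index = Nat.card {x : T // 2 • x = 0} := by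
  have h1 := AddSubgroup.card_mul_index (nsmulAddMonoidHom 2 : T →+ T).range
  have h2 := AddSubgroup.card_mul_index (nsmulAddMonoidHom 2 : T →+ T).ker
  rw [AddSubgroup.index_ker, ← h1, mul_comm] at h2
  exact (Nat.eq_of_mul_eq_mul_left Nat.card_pos h2).symm

theorem card_quot_two_aux (A T : Type*) [AddCommGroup A] [AddCommGroup T] [Finite T] (n : ℕ)
    (f : A ≃+ (Fin n →₀ ℤ) × T) (hA : Nat.card {x : A // 2 • x = 0} = 2) :
    (nsmulAddMonoidHom 2 : A →+ A).range.index = 2 ^ (Module.finrank ℤ A + 1) := by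
  have hrank : Module.finrank ℤ A = n := by
    rw [f.toIntLinearEquiv.finrank_eq]
    let g : ((Fin n →₀ ℤ) × T) →ₗ[ℤ] (Fin n →₀ ℤ) := LinearMap.fst ℤ _ _
    have hg : Function.Surjective g := LinearMap.fst_surjective
    have h1 := LinearMap.lift_rank_range_add_rank_ker g
    have h0 : Module.rank ℤ (LinearMap.ker g) = 0 := by
      rw [rank_eq_zero_iff]
      intro x
      have hx : x.1.1 = 0 := x.2
      refine ⟨Nat.card T, by simp [Nat.card_pos.ne'], ?_⟩
      ext1; ext1
      · simp [hx]
      · simp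
    rw [h0] at h1
    have h2 : Module.finrank ℤ ((Fin n →₀ ℤ) × T) = Module.finrank ℤ (LinearMap.range g) := by
      simp only [Module.finrank]
      have := congrArg Cardinal.toNat h1
      simpa using this.symm
    rw [h2, LinearMap.range_eq_top.2 hg]
    simp
  have htors : Nat.card {x : T // 2 • x = 0} = 2 := by
    refine Eq.trans (?_ : _ = Nat.card {x : A // 2 • x = 0}) hA
    refine Nat.card_congr ⟨fun x => ⟨f.symm (0, x.1), ?_⟩, fun y => ⟨(f y.1).2, ?_⟩, ?_, ?_⟩
    · rw [← map_nsmul]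
      simp [x.2]
    · have := congrArg f y.2
      rw [map_nsmul] at this
      simpa using congrArg Prod.snd this
    · intro x; simp
    · intro y
      have h := congrArg f y.2
      rw [map_nsmul] at h
      have h1 : 2 • (f y.1).1 = 0 := by simpa using congrArg Prod.fst h
      have h2 : (f y.1).1 = 0 := by simpa using h1
      ext1
      show f.symm (0, (f y.1).2) = y.1
      rw [← h2]; simp
  have hidx : (nsmulAddMonoidHom 2 : A →+ A).range.index =
      ((nsmulAddMonoidHom 2 : (Fin n →₀ ℤ) →+ (Fin n →₀ ℤ)).range.prod
        (nsmulAddMonoidHom 2 : T →+ T).range).index := by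
    rw [← AddSubgroup.index_map_equiv _ f]
    congr 1
    ext ⟨u, v⟩
    simp only [AddSubgroup.mem_map, AddMonoidHom.mem_range, AddSubgroup.mem_prod]
    constructor
    · rintro ⟨_, ⟨y, rfl⟩, h⟩
      have h' : 2 • f y = (u, v) := by rw [← h]; simp
      exact ⟨⟨(f y).1, by simpa using congrArg Prod.fst h'⟩,
        ⟨(f y).2, by simpa using congrArg Prod.snd h'⟩⟩
    · rintro ⟨⟨a, rfl⟩, ⟨b, rfl⟩⟩
      exact ⟨_, ⟨f.symm (a, b), rfl⟩, by simp⟩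
  rw [hidx, AddSubgroup.index_prod, index_two_free, index_two_finite, htors, hrank, pow_succ]

/-- For a finitely generated abelian group with exactly two elements killed by `2`. -/
theorem card_quot_two (A : Type*) [AddCommGroup A] [Module.Finite ℤ A]
    (hA : Nat.card {x : A // 2 • x = 0} = 2) :
    (nsmulAddMonoidHom 2 : A →+ A).range.index = 2 ^ (Module.finrank ℤ A + 1) := by
  have : AddGroup.FG A := Module.Finite.iff_addGroup_fg.mp inferInstance
  classical
  obtain ⟨n, ι, _, p, hp, e, ⟨f⟩⟩ := AddCommGroup.equiv_free_prod_directSum_zmod A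
  have : ∀ i, NeZero (p i ^ e i) := fun i => ⟨pow_ne_zero _ (hp i).ne_zero⟩
  have : Finite (DirectSum ι fun i => ZMod (p i ^ e i)) :=
    Finite.of_equiv _ (DirectSum.addEquivProd _).symm.toEquiv
  exact card_quot_two_aux A _ n f hA

theorem sq_relIndex {E : Type*} [CommGroup E] [Module.Finite ℤ (Additive E)] (e : E) (he : e ≠ 1)
    (htor : ∀ x : E, x ^ 2 = 1 ↔ x = 1 ∨ x = e) (H : Subgroup E) (heH : e ∈ H) :
    (H.map (powMonoidHom 2)).relIndex H = 2 ^ (Module.finrank ℤ (Additive H) + 1) := by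
  have hfin : Module.Finite ℤ (Additive H) := by
    let f : Additive H →ₗ[ℤ] Additive E := (MonoidHom.toAdditive H.subtype).toIntLinearMap
    have hf : Function.Injective f := fun a b h => Subtype.ext h
    exact Module.Finite.of_injective f hf
  have h1 := card_quot_two (Additive H) (by
    have : {x : Additive H | 2 • x = 0} = {Additive.ofMul (1 : H), Additive.ofMul (⟨e, heH⟩ : H)} := by
      ext x
      have := htor (x.toMul : E)
      simp only [Set.mem_ofPred_eq, Set.mem_insert_iff, Set.mem_singleton_iff]
      constructor
      · intro hx
        have h2 : (x.toMul : H) ^ 2 = 1 := hx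
        have h3 : ((x.toMul : H) : E) ^ 2 = 1 := by exact_mod_cast congrArg Subtype.val h2
        rcases this.1 h3 with h | h
        · left; exact Subtype.ext h
        · right; exact Subtype.ext h
      · intro hx
        have h3 : ((x.toMul : H) : E) ^ 2 = 1 := by
          apply this.2
          rcases hx with rfl | rfl
          · left; rfl
          · right; rfl
        exact Subtype.ext h3
    change Nat.card ({x : Additive H | 2 • x = 0} : Set (Additive H)) = 2
    rw [this, Nat.card_coe_set_eq, Set.ncard_pair]
    intro h
    exact he (congrArg Subtype.val (Additive.ofMul.injective h)).symm)
  rw [← h1]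
  have h2 : H.map (powMonoidHom 2) = (powMonoidHom 2 : H →* H).range.map H.subtype := by
    ext x
    simp only [Subgroup.mem_map, MonoidHom.mem_range]
    constructor
    · rintro ⟨y, hy, rfl⟩
      exact ⟨_, ⟨⟨y, hy⟩, rfl⟩, rfl⟩
    · rintro ⟨_, ⟨y, rfl⟩, rfl⟩
      exact ⟨y, y.2, rfl⟩
  have h3 : (⊤ : Subgroup H).map H.subtype = H := by
    rw [← MonoidHom.range_eq_map, Subgroup.range_subtype]
  have h4 := Subgroup.relIndex_map_map_of_injective (powMonoidHom 2 : H →* H).range ⊤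
    H.subtype_injective
  rw [h3, Subgroup.relIndex_top_right] at h4
  rw [h2, h4]
  rfl

theorem finrank_range_ker_int {A B : Type*} [AddCommGroup A] [AddCommGroup B] [Module.Finite ℤ A]
    (f : A →ₗ[ℤ] B) :
    Module.finrank ℤ (LinearMap.range f) + Module.finrank ℤ (LinearMap.ker f)
      = Module.finrank ℤ A := by
  rw [← Submodule.finrank_quotient_add_finrank (LinearMap.ker f),
    (f.quotKerEquivRange).finrank_eq]

theorem rank_minus {E : Type*} [CommGroup E] [Module.Finite ℤ (Additive E)]
    {F : Type*} [CommGroup F] [Module.Finite ℤ (Additive F)]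
    (s : E →* E) (hs : ∀ x, s (s x) = x) (j : F →* E) (hj : Function.Injective j)
    (M : Subgroup E) (hM : ∀ x, x ∈ M ↔ x * s x = 1) (hjf : ∀ x, s x = x ↔ ∃ y, j y = x) :
    Module.finrank ℤ (Additive M) + Module.finrank ℤ (Additive F) = Module.finrank ℤ (Additive E) := by
  let N : Additive E →ₗ[ℤ] Additive E := (MonoidHom.toAdditive (MonoidHom.id E * s)).toIntLinearMap
  let J : Additive F →ₗ[ℤ] Additive E := (MonoidHom.toAdditive j).toIntLinearMap
  have hJ : Function.Injective J := hj
  have hrk := finrank_range_ker_int N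
  have hker : Module.finrank ℤ (LinearMap.ker N) = Module.finrank ℤ (Additive M) := by
    apply LinearEquiv.finrank_eq
    refine AddEquiv.toIntLinearEquiv
      { toFun := fun x => Additive.ofMul ⟨x.1.toMul, (hM _).2 x.2⟩
        invFun := fun y => ⟨Additive.ofMul (y.toMul : E), (hM _).1 y.toMul.2⟩
        left_inv := fun x => rfl
        right_inv := fun y => rfl
        map_add' := fun x y => rfl }
  have hran : Module.finrank ℤ (LinearMap.range N) = Module.finrank ℤ (Additive F) := by
    apply le_antisymm
    · rw [← LinearMap.finrank_range_of_inj hJ]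
      apply Submodule.finrank_mono
      rintro _ ⟨x, rfl⟩
      obtain ⟨y, hy⟩ := (hjf (x.toMul * s x.toMul)).1 (by rw [map_mul, hs, mul_comm])
      exact ⟨Additive.ofMul y, hy⟩
    · have h1 := finrank_range_ker_int (N ∘ₗ J)
      have h0 : Module.finrank ℤ (LinearMap.ker (N ∘ₗ J)) = 0 := by
        rw [Module.finrank_eq_zero_iff]
        intro x
        refine ⟨2, by norm_num, ?_⟩
        ext1
        apply hJ
        have h2 : j x.1.toMul * s (j x.1.toMul) = 1 := x.2
        rw [(hjf _).2 ⟨_, rfl⟩] at h2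
        have h3 : J ((2 : ℤ) • x.1) = Additive.ofMul (j x.1.toMul * j x.1.toMul) := by
          rw [map_zsmul, two_zsmul]; rfl
        show J ((2 : ℤ) • x.1) = J 0
        rw [h3, h2, map_zero]; rfl
      rw [← h1, h0, add_zero]
      exact Submodule.finrank_mono (LinearMap.range_comp_le_range J N)
  omega

theorem units_tor (K : Type*) [Field K] [NumberField K] (x : (𝓞 K)ˣ) :
    x ^ 2 = 1 ↔ x = 1 ∨ x = -1 := by
  rw [sq, Units.ext_iff, Units.ext_iff, Units.ext_iff, Units.val_mul, Units.val_one, Units.val_neg,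
    Units.val_one]
  exact mul_self_eq_one_iff

theorem rank_totReal (K : Type*) [Field K] [NumberField K] [IsTotallyReal K] :
    Units.rank K + 1 = Module.finrank ℚ K := by
  have h1 := InfinitePlace.card_add_two_mul_card_eq_rank K
  have h2 := InfinitePlace.card_eq_nrRealPlaces_add_nrComplexPlaces K
  have h3 := IsTotallyReal.nrComplexPlaces_eq_zero K
  have h4 : 0 < Fintype.card (InfinitePlace K) := Fintype.card_pos
  unfold Units.rank
  omega

theorem units_H (K L : Type*) [Field K] [Field L] [NumberField K] [NumberField L] [Algebra K L]
    [IsTotallyReal K] [IsTotallyReal L] (h2 : Module.finrank K L = 2)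
    (σ : 𝓞 L ≃ₐ[𝓞 K] 𝓞 L) (hσ : ∀ x, σ (σ x) = x)
    (hfix : ∀ x, σ x = x → ∃ r : 𝓞 K, algebraMap (𝓞 K) (𝓞 L) r = x)
    (M C : Subgroup (𝓞 L)ˣ) (Nr : Subgroup (𝓞 K)ˣ)
    (hM : ∀ x : (𝓞 L)ˣ, x ∈ M ↔ (x : 𝓞 L) * σ x = 1)
    (hC : ∀ x : (𝓞 L)ˣ, x ∈ C ↔ ∃ w : (𝓞 L)ˣ, (w : 𝓞 L) = x * σ w)
    (hN : ∀ u : (𝓞 K)ˣ, u ∈ Nr ↔ ∃ w : (𝓞 L)ˣ, algebraMap (𝓞 K) (𝓞 L) u = w * σ w) :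
    C.relIndex M = 2 * Nr.index ∧ Nr.index ≠ 0 := by
  have finK : Module.Finite ℤ (Additive (𝓞 K)ˣ) := inferInstance
  have finL : Module.Finite ℤ (Additive (𝓞 L)ˣ) := inferInstance
  let s : (𝓞 L)ˣ →* (𝓞 L)ˣ := Units.map (σ : 𝓞 L →* 𝓞 L)
  let j : (𝓞 K)ˣ →* (𝓞 L)ˣ := Units.map (algebraMap (𝓞 K) (𝓞 L) : 𝓞 K →* 𝓞 L)
  have hs : ∀ x, s (s x) = x := fun x => Units.ext (hσ x)
  have hinj : Function.Injective (algebraMap (𝓞 K) (𝓞 L)) := FaithfulSMul.algebraMap_injective _ _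
  have hj : Function.Injective j := Units.map_injective hinj
  have hjf : ∀ x, s x = x ↔ ∃ y, j y = x := by
    intro x
    constructor
    · intro h
      obtain ⟨r, hr⟩ := hfix (x : 𝓞 L) (congrArg Units.val h)
      obtain ⟨r', hr'⟩ := hfix ((x⁻¹ : (𝓞 L)ˣ) : 𝓞 L) (by
        have : s x⁻¹ = x⁻¹ := by rw [map_inv, h]
        exact congrArg Units.val this)
      refine ⟨⟨r, r', ?_, ?_⟩, Units.ext hr⟩
      · apply hinj; rw [map_mul, hr, hr']; simp
      · apply hinj; rw [map_mul, hr, hr']; simp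
    · rintro ⟨y, rfl⟩
      exact Units.ext (σ.commutes _)
  have hm1 : (-1 : (𝓞 L)ˣ) ≠ 1 := by
    intro h
    have := congrArg Units.val h
    have h2 : (-1 : 𝓞 L) = 1 := this
    norm_num at h2
  have hMs : ∀ x, x ∈ M ↔ x * s x = 1 := by
    intro x; rw [hM, Units.ext_iff]; rfl
  have hjs : ∀ x, x ∈ j.range ↔ s x = x := fun x => by rw [hjf]; rfl
  have hneg : s (-1) = -1 := by
    apply Units.ext
    show σ (-1) = -1
    simp
  have rM := rank_minus s hs j hj M hMs hjf
  have iP := sq_relIndex (-1) hm1 (units_tor L) j.range ((hjs _).2 hneg)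
  have iM := sq_relIndex (-1) hm1 (units_tor L) M ((hMs _).2 (by rw [hneg]; simp))
  have rP : Module.finrank ℤ (Additive j.range) = Module.finrank ℤ (Additive (𝓞 K)ˣ) := by
    apply LinearEquiv.finrank_eq
    exact (MulEquiv.toAdditive (MonoidHom.ofInjective hj).symm).toIntLinearEquiv
  have tK := IsTotallyReal.finrank K
  have tL := IsTotallyReal.finrank L
  have nrK : Units.rank K + 1 = Module.finrank ℚ K := rank_totReal K
  have nrL : Units.rank L + 1 = Module.finrank ℚ L := rank_totReal L
  have tow := Module.finrank_mul_finrank ℚ K L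
  rw [Units.finrank_eq, Units.finrank_eq] at rM
  rw [rP, Units.finrank_eq] at iP
  have : Module.finrank ℤ (Additive M) = Units.rank K + 1 := by
    rw [h2] at tow; omega
  rw [this] at iM
  have key := invol_index s hs j.range M (Nr.map j) C hjs hMs (by
    intro x
    constructor
    · rintro ⟨u, hu, rfl⟩
      obtain ⟨w, hw⟩ := (hN u).1 hu
      exact ⟨w, Units.ext hw⟩
    · rintro ⟨w, rfl⟩
      obtain ⟨u, hu⟩ := (hjf (w * s w)).1 (by rw [map_mul, hs, mul_comm])
      exact ⟨u, (hN u).2 ⟨w, congrArg Units.val hu⟩, hu⟩) (by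
    intro x
    rw [hC]
    apply exists_congr
    intro w
    rw [eq_div_iff_mul_eq', Units.ext_iff, eq_comm]
    rfl) _ iP iM
  rw [MonoidHom.range_eq_map, Subgroup.relIndex_map_map_of_injective _ _ hj,
    Subgroup.relIndex_top_right] at key
  exact key

section dedekind
set_option linter.unusedSectionVars false
variable {S : Type*} [CommRing S] [IsDedekindDomain S]

theorem ideal_cancel {A B C : Ideal S} (hC : C ≠ ⊥) (h : C * A = C * B) : A = B :=
  mul_left_cancel₀ hC h

theorem ideal_cancel_le {A B C : Ideal S} (hC : C ≠ ⊥) (h : C * A ≤ C * B) : A ≤ B := by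
  rw [← Ideal.dvd_iff_le] at h ⊢
  exact (mul_dvd_mul_iff_left hC).1 h

theorem ideal_sq_inj {A B : Ideal S} (h : A ^ 2 = B ^ 2) : A = B := by
  apply le_antisymm
  · rw [← Ideal.dvd_iff_le]
    exact (UniqueFactorizationMonoid.pow_dvd_pow_iff_dvd two_ne_zero).1 (dvd_of_eq h.symm)
  · rw [← Ideal.dvd_iff_le]
    exact (UniqueFactorizationMonoid.pow_dvd_pow_iff_dvd two_ne_zero).1 (dvd_of_eq h)

open Classical in
/-- the parity-relevant valuation -/
noncomputable def vP (P B : Ideal S) : ℕ := (UniqueFactorizationMonoid.normalizedFactors B).count P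

theorem vP_mul {A B : Ideal S} (P : Ideal S) (hA : A ≠ ⊥) (hB : B ≠ ⊥) :
    vP P (A * B) = vP P A + vP P B := by
  unfold vP
  rw [UniqueFactorizationMonoid.normalizedFactors_mul hA hB, Multiset.count_add]

theorem vP_eq_zero {A : Ideal S} (P : Ideal S) (h : ¬ A ≤ P) : vP P A = 0 := by
  unfold vP
  rw [Multiset.count_eq_zero]
  intro h1
  exact h (Ideal.le_of_dvd (UniqueFactorizationMonoid.dvd_of_mem_normalizedFactors h1))

open Classical in
theorem exists_sq_of_vP {B : Ideal S} (hB : B ≠ ⊥)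
    (h : ∀ P : Ideal S, P.IsPrime → P ≠ ⊥ → Even (vP P B)) : ∃ C : Ideal S, B = C ^ 2 := by
  let s := UniqueFactorizationMonoid.normalizedFactors B
  refine ⟨∏ p ∈ s.toFinset, p ^ (s.count p / 2), ?_⟩
  rw [← Finset.prod_pow]
  have h1 : s.prod = B := associated_iff_eq.1 (UniqueFactorizationMonoid.prod_normalizedFactors hB)
  conv_lhs => rw [← h1, Finset.prod_multiset_count]
  apply Finset.prod_congr rfl
  intro p hp
  rw [← pow_mul]
  congr 1
  have hp' : p ∈ s := Multiset.mem_toFinset.1 hp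
  have hpp := UniqueFactorizationMonoid.prime_of_normalized_factor p hp'
  have := h p (Ideal.isPrime_of_prime hpp) hpp.ne_zero
  exact (Nat.div_mul_cancel this.two_dvd).symm

theorem odd_of_sq_principal [Finite (ClassGroup S)]
    (h : ∀ I : Ideal S, I ≠ ⊥ → (I ^ 2).IsPrincipal → I.IsPrincipal) :
    Odd (Nat.card (ClassGroup S)) := by
  by_contra hodd
  rw [Nat.not_odd_iff_even] at hodd
  have : Fact (Nat.Prime 2) := ⟨Nat.prime_two⟩
  obtain ⟨c, hc⟩ := exists_prime_orderOf_dvd_card' 2 hodd.two_dvd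
  obtain ⟨⟨I, hI⟩, rfl⟩ := ClassGroup.mk0_surjective c
  have h1 : (I ^ 2).IsPrincipal := by
    rw [← ClassGroup.mk0_eq_one_iff (pow_mem hI 2)]
    rw [← SubmonoidClass.mk_pow I hI 2, map_pow, ← hc, pow_orderOf_eq_one]
  have h2 := (ClassGroup.mk0_eq_one_iff hI).2 (h I (mem_nonZeroDivisors_iff_ne_zero.1 hI) h1)
  rw [h2, orderOf_one] at hc
  omega

theorem principal_of_sq [Finite (ClassGroup S)] (hodd : Odd (Nat.card (ClassGroup S)))
    {I : Ideal S} (hI : (I ^ 2).IsPrincipal) : I.IsPrincipal := by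
  have := Fintype.ofFinite (ClassGroup S)
  refine Ideal.IsPrincipal.of_isPrincipal_pow_of_coprime (n := 2) ?_ hI
  rw [← Nat.card_eq_fintype_card]
  exact Nat.coprime_two_left.2 hodd

theorem principal_pow_card [Finite (ClassGroup S)] (I : Ideal S) :
    (I ^ (Nat.card (ClassGroup S))).IsPrincipal := by
  by_cases hI0 : I = ⊥
  · rw [hI0, Ideal.bot_pow (Nat.card_pos.ne')]; exact bot_isPrincipal
  have hI := mem_nonZeroDivisors_of_ne_zero hI0
  rw [← ClassGroup.mk0_eq_one_iff (pow_mem hI _), ← SubmonoidClass.mk_pow I hI, map_pow,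
    pow_card_eq_one']

theorem principal_of_mul {I J : Ideal S} (hI0 : I ≠ ⊥) (hJ : J ≠ ⊥) (h : J.IsPrincipal)
    (hIJ : (I * J).IsPrincipal) : I.IsPrincipal := by
  have hI' := mem_nonZeroDivisors_of_ne_zero hI0
  have hJ' := mem_nonZeroDivisors_of_ne_zero hJ
  rw [← ClassGroup.mk0_eq_one_iff hI']
  have h1 := (ClassGroup.mk0_eq_one_iff hJ').2 h
  have h2 := (ClassGroup.mk0_eq_one_iff (mul_mem hI' hJ')).2 hIJ
  have h3 : ClassGroup.mk0 ⟨I, hI'⟩ * ClassGroup.mk0 ⟨J, hJ'⟩ = 1 := by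
    rw [← map_mul]; exact h2
  rwa [h1, mul_one] at h3

theorem principal_pow {I : Ideal S} (h : I.IsPrincipal) (n : ℕ) : (I ^ n).IsPrincipal := by
  obtain ⟨a, ha⟩ := h
  refine ⟨a ^ n, ?_⟩
  have : I = Ideal.span {a} := ha
  rw [this, Ideal.span_singleton_pow]
end dedekind

section invol
set_option linter.unusedSectionVars false
variable {R S : Type*} [CommRing R] [CommRing S] [IsDedekindDomain R] [IsDedekindDomain S]
  [Algebra R S] [FaithfulSMul R S] [Algebra.IsIntegral R S]

theorem ext_le {A B : Ideal R} (h : A.map (algebraMap R S) ≤ B.map (algebraMap R S)) : A ≤ B := by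
  rw [← Ideal.comap_map_eq_self_of_faithfullyFlat (B := S) B]
  exact Ideal.le_comap_of_map_le h

theorem ext_inj {A B : Ideal R} (h : A.map (algebraMap R S) = B.map (algebraMap R S)) : A = B :=
  le_antisymm (ext_le h.le) (ext_le h.ge)

theorem ext_ne_bot {A : Ideal R} (h : A.map (algebraMap R S) ≠ ⊥) : A ≠ ⊥ := by
  rintro rfl; exact h Ideal.map_bot

variable (σ : S ≃ₐ[R] S)

theorem smap_smap (hσ : ∀ x, σ (σ x) = x) (I : Ideal S) : (I.map σ).map σ = I := by
  have : (σ : S →+* S).comp (σ : S →+* S) = RingHom.id S := by ext x; exact hσ x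
  have h1 : ∀ J : Ideal S, J.map σ = J.map (σ : S →+* S) := fun J => rfl
  rw [h1, h1, Ideal.map_map, this, Ideal.map_id]

theorem smap_span (x : S) : (Ideal.span {x}).map σ = Ideal.span {σ x} := by
  rw [Ideal.map_span, Set.image_singleton]

/-- Every `I * σ I` is extended from below. -/
theorem mul_conj_ext (hfix : ∀ x, σ x = x → ∃ r : R, algebraMap R S r = x)
    (hσ : ∀ x, σ (σ x) = x) (I : Ideal S) :
    ∃ B : Ideal R, I * I.map σ = B.map (algebraMap R S) := by
  let B : Ideal R := Ideal.span ({r | ∃ x ∈ I, algebraMap R S r = x * σ x} ∪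
    {r | ∃ x ∈ I, ∃ y ∈ I, algebraMap R S r = x * σ y + y * σ x})
  refine ⟨B, ?_⟩
  have hmem : ∀ x ∈ I, σ x ∈ I.map σ := fun x hx => Ideal.mem_map_of_mem σ hx
  apply le_antisymm
  · have key : ∀ x ∈ I, ∀ y ∈ I, x * σ y ∈ B.map (algebraMap R S) := by
      intro x hx y hy
      set BS := B.map (algebraMap R S) with hBS
      obtain ⟨t, ht⟩ := hfix (x * σ y + y * σ x) (by rw [map_add, map_mul, map_mul, hσ, hσ]; ring)
      obtain ⟨n1, hn1⟩ := hfix (x * σ x) (by rw [map_mul, hσ]; ring)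
      obtain ⟨n2, hn2⟩ := hfix (y * σ y) (by rw [map_mul, hσ]; ring)
      have ht' : algebraMap R S t ∈ BS := Ideal.mem_map_of_mem _
        (Ideal.subset_span (Or.inr ⟨x, hx, y, hy, ht⟩))
      have hn1' : algebraMap R S n1 ∈ BS := Ideal.mem_map_of_mem _
        (Ideal.subset_span (Or.inl ⟨x, hx, hn1⟩))
      have hn2' : algebraMap R S n2 ∈ BS := Ideal.mem_map_of_mem _
        (Ideal.subset_span (Or.inl ⟨y, hy, hn2⟩))
      set z := x * σ y with hz
      have hzz : z * z = algebraMap R S t * z - algebraMap R S n1 * algebraMap R S n2 := by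
        rw [ht, hn1, hn2, hz]; ring
      let C : Ideal S := Ideal.span {z} ⊔ BS
      have hzC : z ∈ C := Ideal.mem_sup_left (Ideal.mem_span_singleton_self z)
      have hBC : BS ≤ C := le_sup_right
      have hCC : C * C ≤ C * BS := by
        show (Ideal.span {z} ⊔ BS) * C ≤ C * BS
        rw [Ideal.sup_mul, mul_comm BS C]
        apply sup_le _ le_rfl
        show Ideal.span {z} * (Ideal.span {z} ⊔ BS) ≤ C * BS
        rw [Ideal.mul_sup]
        apply sup_le
        · rw [Ideal.span_singleton_mul_span_singleton, Ideal.span_singleton_le_iff_mem, hzz, mul_comm _ z]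
          exact sub_mem (Ideal.mul_mem_mul hzC ht') (Ideal.mul_mem_mul (hBC hn1') hn2')
        · exact Ideal.mul_mono_left le_sup_left
      by_cases hC : C = ⊥
      · rw [hC] at hzC
        rw [Ideal.mem_bot.1 hzC]; exact zero_mem _
      · exact ideal_cancel_le hC hCC hzC
    have h2 : I.map σ = Ideal.span (σ '' I) := rfl
    rw [h2]
    conv_lhs => rw [← Ideal.span_eq I]
    rw [Ideal.span_mul_span', Ideal.span_le, Ideal.span_eq]
    rintro _ ⟨x, hx, _, ⟨y, hy, rfl⟩, rfl⟩
    exact key x hx y hy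
  · rw [Ideal.map_le_iff_le_comap, Ideal.span_le]
    rintro r (⟨x, hx, h⟩ | ⟨x, hx, y, hy, h⟩)
    · show algebraMap R S r ∈ I * I.map σ
      rw [h]; exact Ideal.mul_mem_mul hx (hmem x hx)
    · show algebraMap R S r ∈ I * I.map σ
      rw [h]; exact add_mem (Ideal.mul_mem_mul hx (hmem y hy)) (Ideal.mul_mem_mul hy (hmem x hx))

theorem hilb (hσ : ∀ x, σ (σ x) = x) (hne : ∃ x, σ x ≠ x) (g : S) (β : R)
    (h : g * σ g = algebraMap R S β ^ 2) : ∃ b, b ≠ 0 ∧ g * σ b = algebraMap R S β * b := by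
  by_cases h0 : algebraMap R S β + g = 0
  · obtain ⟨x, hx⟩ := hne
    refine ⟨x - σ x, fun h => hx (sub_eq_zero.1 h).symm, ?_⟩
    have : g = - algebraMap R S β := by linear_combination h0
    rw [this, map_sub, hσ]; ring
  · refine ⟨_, h0, ?_⟩
    rw [map_add, AlgEquiv.commutes]
    linear_combination h

theorem delta_mem (hfix : ∀ x, σ x = x → ∃ r : R, algebraMap R S r = x)
    (hσ : ∀ x, σ (σ x) = x) (J : Ideal S) (hJ : J.map σ = J) (θ : S) :
    Ideal.span {θ - σ θ} * J ≤ (J.comap (algebraMap R S)).map (algebraMap R S) := by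
  rw [Ideal.span_singleton_mul_le_iff]
  intro x hx
  have hsx : ∀ y ∈ J, σ y ∈ J := fun y hy => by
    have := Ideal.mem_map_of_mem σ hy
    rwa [hJ] at this
  have tr : ∀ y ∈ J, y + σ y ∈ (J.comap (algebraMap R S)).map (algebraMap R S) := by
    intro y hy
    obtain ⟨r, hr⟩ := hfix (y + σ y) (by rw [map_add, hσ]; ring)
    rw [← hr]
    apply Ideal.mem_map_of_mem
    rw [Ideal.mem_comap, hr]
    exact add_mem hy (hsx y hy)
  have : (θ - σ θ) * x = θ * (x + σ x) - (x * σ θ + σ (x * σ θ)) := by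
    rw [map_mul, hσ]; ring
  rw [this]
  exact sub_mem (Ideal.mul_mem_left _ _ (tr x hx)) (tr _ (Ideal.mul_mem_right _ _ hx))

/-- Unramified descent: class number of the base is even. -/
theorem not_odd_of_unram (hfix : ∀ x, σ x = x → ∃ r : R, algebraMap R S r = x)
    [Finite (ClassGroup R)] (hσ : ∀ x, σ (σ x) = x) (hne : ∃ x, σ x ≠ x)
    (hδ : Ideal.span {δ | ∃ θ, δ = θ - σ θ} = ⊤)
    (v : Sˣ) (hv : (v : S) * σ v = 1) (hvC : ¬ ∃ w : Sˣ, (w : S) = v * σ w) :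
    ¬ Odd (Nat.card (ClassGroup R)) := by
  intro hodd
  obtain ⟨a, ha0, ha⟩ := hilb σ hσ hne v 1 (by rw [hv]; simp)
  rw [map_one, one_mul] at ha
  have hinv : (Ideal.span {a}).map σ = Ideal.span {a} := by
    rw [smap_span]
    conv_rhs => rw [← ha, ← Ideal.span_singleton_mul_span_singleton]
    rw [Ideal.span_singleton_eq_top.2 v.isUnit, Ideal.top_mul]
  set J := Ideal.span {a} with hJ
  set B := J.comap (algebraMap R S) with hB
  have hJB : J = B.map (algebraMap R S) := by
    apply le_antisymm _ Ideal.map_comap_le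
    suffices h1 : Ideal.span {δ | ∃ θ, δ = θ - σ θ} * J ≤ B.map (algebraMap R S) by
      rwa [hδ, Ideal.top_mul] at h1
    rw [Ideal.mul_le]
    intro δ hδ x hx
    refine Submodule.span_induction ?_ ?_ ?_ ?_ hδ
    · rintro _ ⟨θ, rfl⟩
      exact delta_mem σ hfix hσ J hinv θ (Ideal.mul_mem_mul (Ideal.mem_span_singleton_self _) hx)
    · rw [zero_mul]; exact zero_mem _
    · intro y z _ _ hy hz; rw [add_mul]; exact add_mem hy hz
    · intro y z _ hz; rw [smul_eq_mul, mul_assoc]; exact Ideal.mul_mem_left _ _ hz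
  obtain ⟨n, hn⟩ := hfix (a * σ a) (by rw [map_mul, hσ]; ring)
  have hB2 : B ^ 2 = Ideal.span {n} := by
    apply ext_inj (S := S)
    rw [Ideal.map_pow, ← hJB, Ideal.map_span, Set.image_singleton, hn,
      ← Ideal.span_singleton_mul_span_singleton, ← smap_span, hinv, sq]
  obtain ⟨β, hβ⟩ := principal_of_sq hodd (I := B) ⟨n, hB2⟩
  have hβ' : J = Ideal.span {algebraMap R S β} := by
    rw [hJB, hβ]
    show Ideal.map _ (Ideal.span {β}) = _
    rw [Ideal.map_span, Set.image_singleton]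
  obtain ⟨w, hw⟩ := Ideal.span_singleton_eq_span_singleton.1 hβ'.symm
  refine hvC ⟨w, ?_⟩
  have hβ0 : algebraMap R S β ≠ 0 := by
    intro h; rw [h, zero_mul] at hw; exact ha0 hw.symm
  apply mul_left_cancel₀ hβ0
  rw [hw, ← ha, ← hw, map_mul, AlgEquiv.commutes]
  ring
end invol

section invol
set_option linter.unusedSectionVars false
variable {R S : Type*} [CommRing R] [CommRing S] [IsDedekindDomain R] [IsDedekindDomain S]
  [Algebra R S] [FaithfulSMul R S] [Algebra.IsIntegral R S]
variable (σ : S ≃ₐ[R] S)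

/-- parity outside the ramified set -/
theorem even_vP (hfix : ∀ x, σ x = x → ∃ r : R, algebraMap R S r = x) (hσ : ∀ x, σ (σ x) = x)
    {J : Ideal S} (hJ : J.map σ = J) (hJ0 : J ≠ ⊥) {B : Ideal R}
    (hB : J ^ 2 = B.map (algebraMap R S)) (P : Ideal R) (hP : P.IsPrime)
    (h : ∃ θ : S, ∃ D : R, (θ - σ θ) ^ 2 = algebraMap R S D ∧ D ∉ P) : Even (vP P B) := by
  obtain ⟨θ, D, hD, hDP⟩ := h
  set A := J.comap (algebraMap R S) with hA
  have hB0 : B ≠ ⊥ := ext_ne_bot (S := S) (by rw [← hB]; exact pow_ne_zero 2 hJ0)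
  have h1 : A ^ 2 ≤ B := by
    apply ext_le (S := S)
    rw [← hB, Ideal.map_pow]
    exact Ideal.pow_right_mono Ideal.map_comap_le 2
  have h2 : Ideal.span {D} * B ≤ A ^ 2 := by
    apply ext_le (S := S)
    rw [Ideal.map_mul, ← hB, Ideal.map_pow, Ideal.map_span, Set.image_singleton, ← hD,
      ← Ideal.span_singleton_pow, ← mul_pow]
    exact Ideal.pow_right_mono (delta_mem σ hfix hσ J hJ θ) 2
  have hD0 : Ideal.span {D} ≠ ⊥ := by
    intro h
    rw [Ideal.span_singleton_eq_bot] at h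
    rw [h] at hDP; exact hDP (zero_mem _)
  obtain ⟨E1, hE1⟩ := Ideal.dvd_iff_le.2 h1
  obtain ⟨E2, hE2⟩ := Ideal.dvd_iff_le.2 h2
  have h3 : Ideal.span {D} = E1 * E2 := by
    apply mul_left_cancel₀ hB0
    rw [mul_comm B, hE2, hE1, mul_assoc]
  have hE10 : E1 ≠ ⊥ := by
    rintro rfl; rw [Ideal.bot_mul] at h3; exact hD0 h3
  have hA0 : A ≠ ⊥ := by
    intro h
    rw [h, Ideal.bot_pow two_ne_zero] at hE1
    exact mul_ne_zero hB0 hE10 hE1.symm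
  have h4 : vP P E1 = 0 := by
    apply vP_eq_zero
    intro h
    apply hDP
    rw [← Ideal.span_singleton_le_iff_mem, h3]
    exact Ideal.mul_le_left.trans h
  have h5 : vP P (A ^ 2) = vP P A + vP P A := by rw [sq, vP_mul P hA0 hA0]
  rw [hE1, vP_mul P hB0 hE10, h4, add_zero] at h5
  rw [h5]
  exact ⟨_, rfl⟩

/-- equal parities imply the product is extended -/
theorem ext_of_par (hfix : ∀ x, σ x = x → ∃ r : R, algebraMap R S r = x) (hσ : ∀ x, σ (σ x) = x)
    (S0 : Finset (Ideal R))
    (hS0 : ∀ P : Ideal R, P.IsPrime → P ≠ ⊥ → P ∉ S0 →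
      ∃ θ : S, ∃ D : R, (θ - σ θ) ^ 2 = algebraMap R S D ∧ D ∉ P)
    {J J' : Ideal S} (hJ : J.map σ = J) (hJ0 : J ≠ ⊥) (hJ' : J'.map σ = J') (hJ0' : J' ≠ ⊥)
    {B B' : Ideal R} (hB : J ^ 2 = B.map (algebraMap R S)) (hB' : J' ^ 2 = B'.map (algebraMap R S))
    (hpar : ∀ P ∈ S0, (vP P B : ZMod 2) = vP P B') :
    ∃ C : Ideal R, B * B' = C ^ 2 ∧ J * J' = C.map (algebraMap R S) := by
  have hB0 : B ≠ ⊥ := ext_ne_bot (S := S) (by rw [← hB]; exact pow_ne_zero 2 hJ0)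
  have hB0' : B' ≠ ⊥ := ext_ne_bot (S := S) (by rw [← hB']; exact pow_ne_zero 2 hJ0')
  obtain ⟨C, hC⟩ := exists_sq_of_vP (mul_ne_zero hB0 hB0') (by
    intro P hP hP0
    rw [vP_mul P hB0 hB0']
    by_cases hPS : P ∈ S0
    · have := hpar P hPS
      rw [← ZMod.natCast_eq_zero_iff_even, Nat.cast_add, this]
      exact CharTwo.add_self_eq_zero _
    · exact (even_vP σ hfix hσ hJ hJ0 hB P hP (hS0 P hP hP0 hPS)).add
        (even_vP σ hfix hσ hJ' hJ0' hB' P hP (hS0 P hP hP0 hPS)))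
  refine ⟨C, hC, ideal_sq_inj ?_⟩
  rw [mul_pow, hB, hB', ← Ideal.map_mul, hC, Ideal.map_pow]

theorem odd_of_bound [Finite (ClassGroup R)] [Finite (ClassGroup S)]
    (hfix : ∀ x, σ x = x → ∃ r : R, algebraMap R S r = x) (hσ : ∀ x, σ (σ x) = x)
    (hne : ∃ x, σ x ≠ x) (hodd : Odd (Nat.card (ClassGroup R)))
    (S0 : Finset (Ideal R))
    (hS0 : ∀ P : Ideal R, P.IsPrime → P ≠ ⊥ → P ∉ S0 →
      ∃ θ : S, ∃ D : R, (θ - σ θ) ^ 2 = algebraMap R S D ∧ D ∉ P)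
    (M C : Subgroup Sˣ) (Nr : Subgroup Rˣ)
    (hM : ∀ x : Sˣ, x ∈ M ↔ (x : S) * σ x = 1)
    (hC : ∀ x : Sˣ, x ∈ C ↔ ∃ w : Sˣ, (w : S) = x * σ w)
    (hN : ∀ u : Rˣ, u ∈ Nr ↔ ∃ w : Sˣ, algebraMap R S u = w * σ w)
    (hH : C.relIndex M = 2 * Nr.index ∧ Nr.index ≠ 0)
    (T : Subgroup Rˣ) (hT : ∀ (u : Rˣ) (c : R) (z : S), c ≠ 0 →
      algebraMap R S (u * c ^ 2) = z * σ z → u ∈ T)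
    (hcard : 2 ^ S0.card ≤ 2 * T.index) : Odd (Nat.card (ClassGroup S)) := by
  have hinj : Function.Injective (algebraMap R S) := FaithfulSMul.algebraMap_injective _ _
  -- choose the Hilbert 90 elements
  have hch : ∀ v : M, ∃ a : S, a ≠ 0 ∧ (v.1 : S) * σ a = a := by
    intro v
    obtain ⟨a, ha0, ha⟩ := hilb σ hσ hne (v.1 : S) 1 (by rw [(hM v.1).1 v.2]; simp)
    rw [map_one, one_mul] at ha
    exact ⟨a, ha0, ha⟩
  choose a ha0 ha using hch
  have hnch : ∀ v : M, ∃ n : R, algebraMap R S n = a v * σ (a v) := fun v =>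
    hfix _ (by rw [map_mul, hσ]; ring)
  choose n hn using hnch
  have hinv : ∀ v : M, (Ideal.span {a v}).map σ = Ideal.span {a v} := by
    intro v
    rw [smap_span]
    conv_rhs => rw [← ha, ← Ideal.span_singleton_mul_span_singleton]
    rw [Ideal.span_singleton_eq_top.2 v.1.isUnit, Ideal.top_mul]
  have hanz : ∀ v : M, Ideal.span {a v} ≠ ⊥ := fun v h => ha0 v (Ideal.span_singleton_eq_bot.1 h)
  have hnB : ∀ v : M, (Ideal.span {a v}) ^ 2 = (Ideal.span {n v}).map (algebraMap R S) := by
    intro v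
    rw [Ideal.map_span, Set.image_singleton, hn,
      ← Ideal.span_singleton_mul_span_singleton, ← smap_span, hinv, sq]
  let par : M → (S0 → ZMod 2) := fun v P => (vP P.1 (Ideal.span {n v}) : ZMod 2)
  have hparinj : ∀ v v' : M, par v = par v' → v * v'⁻¹ ∈ C.subgroupOf M := by
    intro v v' hvv
    obtain ⟨Q, hQ1, hQ2⟩ := ext_of_par σ hfix hσ S0 hS0 (hinv v) (hanz v) (hinv v') (hanz v')
      (hnB v) (hnB v') (fun P hP => congrFun hvv ⟨P, hP⟩)
    obtain ⟨γ, hγ⟩ := principal_of_sq hodd (I := Q) ⟨n v * n v', by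
      rw [← hQ1, Ideal.span_singleton_mul_span_singleton]⟩
    have h1 : Ideal.span {algebraMap R S γ} = Ideal.span {a v * a v'} := by
      rw [← Ideal.span_singleton_mul_span_singleton, hQ2, hγ]
      show _ = Ideal.map _ (Ideal.span {γ})
      rw [Ideal.map_span, Set.image_singleton]
    obtain ⟨w, hw⟩ := Ideal.span_singleton_eq_span_singleton.1 h1
    have hγ0 : algebraMap R S γ ≠ 0 := by
      intro h; rw [h, zero_mul] at hw
      exact mul_ne_zero (ha0 v) (ha0 v') hw.symm
    have h2 : (w : S) = (v.1 * v'.1 : Sˣ) * σ w := by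
      apply mul_left_cancel₀ hγ0
      rw [hw, ← ha v, ← ha v']
      have := congrArg σ hw
      rw [map_mul, AlgEquiv.commutes, map_mul] at this
      rw [Units.val_mul]
      linear_combination (-(v.1 : S) * v'.1) * this
    have h3 : v'.1⁻¹ * v'.1⁻¹ ∈ C := by
      rw [hC]
      refine ⟨v'.1⁻¹, ?_⟩
      have h4 := (hM _).1 (v'⁻¹).2
      have h5 : ((v'⁻¹ : M).1 : Sˣ) = v'.1⁻¹ := rfl
      rw [h5] at h4
      rw [Units.val_mul, mul_assoc, h4, mul_one]
    rw [Subgroup.mem_subgroupOf]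
    have h6 : v.1 * v'.1 ∈ C := (hC _).2 ⟨w, h2⟩
    have := mul_mem h6 h3
    convert this using 1
    show v.1 * v'.1⁻¹ = _
    group
  -- counting
  let F : M ⧸ C.subgroupOf M → (S0 → ZMod 2) := fun q => par q.out
  have hF : Function.Injective F := by
    intro q q' h
    have := hparinj _ _ h
    rw [← q.out_eq', ← q'.out_eq']
    rw [eq_comm, QuotientGroup.eq, mul_comm]
    exact this
  have hVcard : Nat.card (M ⧸ C.subgroupOf M) = C.relIndex M := rfl
  have hPcard : Nat.card (S0 → ZMod 2) = 2 ^ S0.card := by simp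
  have hle : C.relIndex M ≤ 2 ^ S0.card := by
    rw [← hPcard, ← hVcard]
    exact Nat.card_le_card_of_injective F hF
  have hNT : Nr ≤ T := by
    intro u hu
    obtain ⟨w, hw⟩ := (hN u).1 hu
    exact hT u 1 w one_ne_zero (by rw [one_pow, mul_one, hw])
  have hTle : T.index ∣ Nr.index := Subgroup.index_dvd_of_le hNT
  have hTle' := Nat.le_of_dvd (Nat.pos_of_ne_zero hH.2) hTle
  have hTeq : T.index = Nr.index := by omega
  have hVeq : C.relIndex M = 2 ^ S0.card := by omega
  have hTN : T ≤ Nr := by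
    have h1 := Subgroup.relIndex_mul_index hNT
    rw [← Subgroup.relIndex_eq_one]
    rw [hTeq] at h1
    exact Nat.eq_of_mul_eq_mul_right (Nat.pos_of_ne_zero hH.2) (by rw [h1, one_mul])
  have hFs : Function.Surjective F := by
    refine ((Nat.bijective_iff_injective_and_card F).2 ⟨hF, ?_⟩).2
    rw [hPcard, hVcard, hVeq]
  -- main argument
  apply odd_of_sq_principal
  intro I0 hI00 hI0
  set h := Nat.card (ClassGroup R) with hh
  obtain ⟨k, hk⟩ := hodd
  set I := I0 ^ h with hI
  have hIne : I ≠ ⊥ := pow_ne_zero _ hI00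
  suffices hIp : I.IsPrincipal by
    refine principal_of_mul hI00 (J := (I0 ^ 2) ^ k) (pow_ne_zero _ (pow_ne_zero _ hI00))
      (principal_pow hI0 k) ?_
    rw [← pow_mul, ← pow_succ', ← hk]
    exact hIp
  have hI2 : (I ^ 2).IsPrincipal := by
    rw [hI, ← pow_mul, mul_comm, pow_mul]; exact principal_pow hI0 h
  obtain ⟨γ, hγ⟩ := hI2
  replace hγ : I ^ 2 = Ideal.span {γ} := hγ
  obtain ⟨B0, hB0⟩ := mul_conj_ext σ hfix hσ I0
  obtain ⟨β, hβ⟩ := principal_pow_card B0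
  replace hβ : B0 ^ h = Ideal.span {β} := hβ
  have hIσ : I * I.map σ = Ideal.span {algebraMap R S β} := by
    rw [hI, Ideal.map_pow, ← mul_pow, hB0, ← Ideal.map_pow, hβ, Ideal.map_span, Set.image_singleton]
  have hsI : I.map σ ≠ ⊥ := by
    intro h
    have := smap_smap σ hσ I
    rw [h, Ideal.map_bot] at this
    exact hIne this.symm
  have hβ0 : β ≠ 0 := by
    rintro rfl
    rw [map_zero, Ideal.span_singleton_eq_bot.2 rfl] at hIσ
    exact mul_ne_zero hIne hsI hIσ
  obtain ⟨nγ, hnγ⟩ := hfix (γ * σ γ) (by rw [map_mul, hσ]; ring)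
  have h1 : Ideal.span {β ^ 2} = Ideal.span {nγ} := by
    apply ext_inj (S := S)
    rw [Ideal.map_span, Set.image_singleton, Ideal.map_span, Set.image_singleton, hnγ, map_pow,
      ← Ideal.span_singleton_pow, ← hIσ, ← Ideal.span_singleton_mul_span_singleton, ← smap_span,
      ← hγ, mul_pow, Ideal.map_pow σ I 2]
  obtain ⟨u, hu⟩ := Ideal.span_singleton_eq_span_singleton.1 h1
  have huT : u ∈ T := hT u β γ hβ0 (by rw [mul_comm, hu, hnγ])
  obtain ⟨w, hw⟩ := (hN u).1 (hTN huT)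
  have hwinv : (w : S) * ((w⁻¹ : Sˣ) : S) = 1 := by simp
  have hwinv' : σ (w : S) * σ ((w⁻¹ : Sˣ) : S) = 1 := by rw [← map_mul, hwinv, map_one]
  obtain ⟨b, hb0, hb⟩ := hilb σ hσ hne (((w⁻¹ : Sˣ) : S) * γ) β (by
    have h2 : algebraMap R S β ^ 2 * algebraMap R S u = γ * σ γ := by
      rw [← hnγ, ← hu, map_mul, map_pow]
    rw [hw] at h2
    rw [map_mul]
    linear_combination (-((w⁻¹ : Sˣ) : S) * σ ((w⁻¹ : Sˣ) : S)) * h2 +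
      (algebraMap R S β ^ 2 * σ (w : S) * σ ((w⁻¹ : Sˣ) : S)) * hwinv +
      (algebraMap R S β ^ 2) * hwinv')
  have hγw : Ideal.span {((w⁻¹ : Sˣ) : S) * γ} = I ^ 2 := by
    rw [← Ideal.span_singleton_mul_span_singleton, Ideal.span_singleton_eq_top.2 (w⁻¹).isUnit,
      Ideal.top_mul, hγ]
  set J := I * Ideal.span {σ b} with hJ
  have hσb0 : σ b ≠ 0 := by simpa using hb0
  have hsb : Ideal.span {σ b} ≠ ⊥ := fun h => hσb0 (Ideal.span_singleton_eq_bot.1 h)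
  have hJ0 : J ≠ ⊥ := mul_ne_zero hIne hsb
  have hJinv : J.map σ = J := by
    rw [hJ, Ideal.map_mul, smap_span, hσ]
    apply mul_left_cancel₀ hIne
    rw [← mul_assoc, hIσ, Ideal.span_singleton_mul_span_singleton, ← hb,
      ← Ideal.span_singleton_mul_span_singleton, hγw, sq, mul_assoc]
  obtain ⟨BJ, hBJ⟩ := mul_conj_ext σ hfix hσ J
  rw [hJinv, ← sq] at hBJ
  obtain ⟨q, hq⟩ := hFs (fun P => (vP P.1 BJ : ZMod 2))
  obtain ⟨Q, -, hQ⟩ := ext_of_par σ hfix hσ S0 hS0 hJinv hJ0 (hinv q.out) (hanz q.out)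
      hBJ (hnB q.out) (fun P hP => (congrFun hq ⟨P, hP⟩).symm)
  have hJh : (J ^ h).IsPrincipal := by
    refine principal_of_mul (pow_ne_zero _ hJ0) (J := Ideal.span {a q.out} ^ h)
      (pow_ne_zero _ (hanz _)) (principal_pow ⟨_, rfl⟩ h) ?_
    rw [← mul_pow, hQ, ← Ideal.map_pow]
    obtain ⟨x, hx⟩ := principal_pow_card Q
    replace hx : Q ^ h = Ideal.span {x} := hx
    rw [hx, Ideal.map_span, Set.image_singleton]
    exact ⟨_, rfl⟩
  rw [hJ, mul_pow] at hJh
  have hIh := principal_of_mul (pow_ne_zero _ hIne) (pow_ne_zero _ hsb)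
    (principal_pow ⟨_, rfl⟩ h) hJh
  refine principal_of_mul hIne (J := (I ^ 2) ^ k) (pow_ne_zero _ (pow_ne_zero _ hIne))
      (principal_pow ⟨γ, hγ⟩ k) ?_
  rw [← pow_mul, ← pow_succ', ← hk]
  exact hIh
end invol

section nf
set_option linter.unusedSectionVars false
variable (K L : Type*) [Field K] [Field L] [NumberField K] [NumberField L] [Algebra K L]

theorem exists_invol (h2 : Module.finrank K L = 2) :
    ∃ σ : 𝓞 L ≃ₐ[𝓞 K] 𝓞 L, (∀ x, σ (σ x) = x) ∧ (∃ x, σ x ≠ x) ∧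
      (∀ x, σ x = x → ∃ r : 𝓞 K, algebraMap (𝓞 K) (𝓞 L) r = x) := by
  have hq : Algebra.IsQuadraticExtension K L := ⟨h2⟩
  have hg : IsGalois K L := inferInstance
  have hcard : Nat.card Gal(L/K) = 2 := by rw [IsGalois.card_aut_eq_finrank, h2]
  obtain ⟨x, y, hxy, hu⟩ := Nat.card_eq_two_iff.1 hcard
  obtain ⟨g, hg1, hgu⟩ : ∃ g : Gal(L/K), g ≠ 1 ∧ ∀ g' : Gal(L/K), g' = 1 ∨ g' = g := by
    have hm : ∀ g' : Gal(L/K), g' = x ∨ g' = y := by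
      intro g'
      have : g' ∈ ({x, y} : Set Gal(L/K)) := by rw [hu]; trivial
      simpa using this
    rcases hm 1 with h | h
    · exact ⟨y, by rw [h]; exact hxy.symm, by rw [h]; exact hm⟩
    · exact ⟨x, by rw [h]; exact hxy, by rw [h]; exact fun g' => (hm g').symm⟩
  have hgg : g * g = 1 := by
    rcases hgu (g * g) with h | h
    · exact h
    · exact absurd (mul_eq_left.1 h) hg1
  let σ := galRestrict (𝓞 K) K L (𝓞 L) g
  have hσ : ∀ x : 𝓞 L, algebraMap (𝓞 L) L (σ x) = g (algebraMap (𝓞 L) L x) := fun x =>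
    algebraMap_galRestrict_apply (𝓞 K) g x
  have hσσ : ∀ x, σ (σ x) = x := by
    intro x
    have : galRestrict (𝓞 K) K L (𝓞 L) (g * g) = 1 := by rw [hgg, map_one]
    rw [map_mul] at this
    exact congrArg (fun f : 𝓞 L ≃ₐ[𝓞 K] 𝓞 L => f x) this
  refine ⟨σ, hσσ, ?_, ?_⟩
  · by_contra h
    push Not at h
    apply hg1
    have : σ = 1 := AlgEquiv.ext h
    exact (galRestrict (𝓞 K) K L (𝓞 L)).injective (by rw [map_one]; exact this)
  · intro x hx
    have h1 : ∀ g' : Gal(L/K), g' (algebraMap (𝓞 L) L x) = algebraMap (𝓞 L) L x := by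
      intro g'
      rcases hgu g' with rfl | rfl
      · rfl
      · rw [← hσ, hx]
    obtain ⟨r, hr⟩ := (IsGalois.mem_range_algebraMap_iff_fixed (F := K) (algebraMap (𝓞 L) L x)).2 h1
    have hrint : IsIntegral ℤ r := by
      rw [← isIntegral_algebraMap_iff (FaithfulSMul.algebraMap_injective K L), hr]
      exact x.2
    refine ⟨⟨r, hrint⟩, ?_⟩
    apply RingOfIntegers.ext
    exact hr

variable {K L}

theorem invol_neg {σ : 𝓞 L ≃ₐ[𝓞 K] 𝓞 L}
    (hfix : ∀ x, σ x = x → ∃ r : 𝓞 K, algebraMap (𝓞 K) (𝓞 L) r = x)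
    {δ : 𝓞 L} {D : 𝓞 K} (hD : δ ^ 2 = algebraMap (𝓞 K) (𝓞 L) D)
    (hδ : ¬ ∃ r : 𝓞 K, algebraMap (𝓞 K) (𝓞 L) r = δ) : σ δ = - δ := by
  have h1 : (σ δ) ^ 2 = δ ^ 2 := by rw [← map_pow, hD, AlgEquiv.commutes]
  rcases sq_eq_sq_iff_eq_or_eq_neg.1 h1 with h | h
  · exact absurd (hfix _ h) hδ
  · exact h

theorem invol_theta {σ : 𝓞 L ≃ₐ[𝓞 K] 𝓞 L} {δ θ : 𝓞 L} {s : 𝓞 K} (hδ : σ δ = - δ)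
    (h : 2 * θ = algebraMap (𝓞 K) (𝓞 L) s + δ) : θ - σ θ = δ := by
  have h1 := congrArg σ h
  rw [map_mul, map_add, AlgEquiv.commutes, hδ] at h1
  have h2 : σ 2 = 2 := map_ofNat σ 2
  rw [h2] at h1
  have h3 : (2 : 𝓞 L) ≠ 0 := two_ne_zero
  apply mul_left_cancel₀ h3
  linear_combination h - h1

/-- the groups entering the unit index -/
theorem exists_groups (σ : 𝓞 L ≃ₐ[𝓞 K] 𝓞 L) :
    ∃ (M C : Subgroup (𝓞 L)ˣ) (Nr : Subgroup (𝓞 K)ˣ),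
    (∀ x : (𝓞 L)ˣ, x ∈ M ↔ (x : 𝓞 L) * σ x = 1) ∧
    (∀ x : (𝓞 L)ˣ, x ∈ C ↔ ∃ w : (𝓞 L)ˣ, (w : 𝓞 L) = x * σ w) ∧
    (∀ u : (𝓞 K)ˣ, u ∈ Nr ↔ ∃ w : (𝓞 L)ˣ, algebraMap (𝓞 K) (𝓞 L) u = w * σ w) := by
  let s : (𝓞 L)ˣ →* (𝓞 L)ˣ := Units.map (σ : 𝓞 L →* 𝓞 L)
  let j : (𝓞 K)ˣ →* (𝓞 L)ˣ := Units.map (algebraMap (𝓞 K) (𝓞 L) : 𝓞 K →* 𝓞 L)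
  refine ⟨(MonoidHom.id _ * s).ker, (MonoidHom.id _ / s).range, ((MonoidHom.id _ * s).range).comap j,
    ?_, ?_, ?_⟩
  · intro x
    rw [MonoidHom.mem_ker, Units.ext_iff]; rfl
  · intro x
    rw [MonoidHom.mem_range]
    apply exists_congr
    intro w
    show w / s w = x ↔ _
    rw [div_eq_iff_eq_mul, Units.ext_iff]
    rfl
  · intro u
    rw [Subgroup.mem_comap, MonoidHom.mem_range]
    apply exists_congr
    intro w
    rw [eq_comm, Units.ext_iff]
    rfl

theorem even_nf [IsTotallyReal K] [IsTotallyReal L] (h2 : Module.finrank K L = 2)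
    (θ₁ θ₂ δ₁ δ₂ : 𝓞 L) (s₁ s₂ α₁ α₂ : 𝓞 K)
    (hθ₁ : 2 * θ₁ = algebraMap (𝓞 K) (𝓞 L) s₁ + δ₁)
    (hθ₂ : 2 * θ₂ = algebraMap (𝓞 K) (𝓞 L) s₂ + δ₂)
    (hα₁ : δ₁ ^ 2 = algebraMap (𝓞 K) (𝓞 L) α₁) (hα₂ : δ₂ ^ 2 = algebraMap (𝓞 K) (𝓞 L) α₂)
    (hδ₁ : ¬ ∃ r : 𝓞 K, algebraMap (𝓞 K) (𝓞 L) r = δ₁)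
    (hδ₂ : ¬ ∃ r : 𝓞 K, algebraMap (𝓞 K) (𝓞 L) r = δ₂)
    (hco : IsCoprime δ₁ δ₂) : ¬ Odd (Nat.card (ClassGroup (𝓞 K))) := by
  obtain ⟨σ, hσ, hne, hfix⟩ := exists_invol K L h2
  obtain ⟨M, C, Nr, hM, hC, hN⟩ := exists_groups σ
  obtain ⟨hH1, hH2⟩ := units_H K L h2 σ hσ hfix M C Nr hM hC hN
  have hex : ∃ v ∈ M, v ∉ C := by
    by_contra hcon
    push Not at hcon
    have : C.relIndex M = 1 := Subgroup.relIndex_eq_one.2 hcon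
    omega
  obtain ⟨v, hvM, hvC⟩ := hex
  refine not_odd_of_unram σ hfix hσ hne ?_ v ((hM v).1 hvM) (fun h => hvC ((hC v).2 h))
  have m1 : δ₁ ∈ Ideal.span {δ | ∃ θ, δ = θ - σ θ} := Ideal.subset_span
    ⟨θ₁, (invol_theta (invol_neg hfix hα₁ hδ₁) hθ₁).symm⟩
  have m2 : δ₂ ∈ Ideal.span {δ | ∃ θ, δ = θ - σ θ} := Ideal.subset_span
    ⟨θ₂, (invol_theta (invol_neg hfix hα₂ hδ₂) hθ₂).symm⟩
  obtain ⟨a, b, hab⟩ := hco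
  rw [Ideal.eq_top_iff_one, ← hab]
  exact add_mem (Ideal.mul_mem_left _ _ m1) (Ideal.mul_mem_left _ _ m2)

theorem odd_nf [IsTotallyReal K] [IsTotallyReal L] (h2 : Module.finrank K L = 2)
    (hodd : Odd (Nat.card (ClassGroup (𝓞 K)))) (θ δ : 𝓞 L) (s D : 𝓞 K)
    (hθ : 2 * θ = algebraMap (𝓞 K) (𝓞 L) s + δ)
    (hD : δ ^ 2 = algebraMap (𝓞 K) (𝓞 L) D)
    (hδ : ¬ ∃ r : 𝓞 K, algebraMap (𝓞 K) (𝓞 L) r = δ)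
    (S0 : Finset (Ideal (𝓞 K))) (hS0 : ∀ P : Ideal (𝓞 K), P.IsPrime → D ∈ P → P ∈ S0)
    (T : Subgroup (𝓞 K)ˣ) (hT : ∀ (u : (𝓞 K)ˣ) (c x y : 𝓞 K), c ≠ 0 →
      (u : 𝓞 K) * c ^ 2 = x ^ 2 - D * y ^ 2 → u ∈ T)
    (hcard : 2 ^ S0.card ≤ 2 * T.index) : Odd (Nat.card (ClassGroup (𝓞 L))) := by
  obtain ⟨σ, hσ, hne, hfix⟩ := exists_invol K L h2
  obtain ⟨M, C, Nr, hM, hC, hN⟩ := exists_groups σ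
  have hH := units_H K L h2 σ hσ hfix M C Nr hM hC hN
  have hσδ := invol_neg hfix hD hδ
  have hinj : Function.Injective (algebraMap (𝓞 K) (𝓞 L)) := FaithfulSMul.algebraMap_injective _ _
  refine odd_of_bound σ hfix hσ hne hodd S0 ?_ M C Nr hM hC hN hH T ?_ hcard
  · intro P hP hP0 hPS
    refine ⟨θ, D, ?_, fun h => hPS (hS0 P hP h)⟩
    rw [invol_theta hσδ hθ, hD]
  · intro u c z hc hz
    have hD0 : D ≠ 0 := by
      rintro rfl
      rw [map_zero] at hD
      exact hδ ⟨0, by rw [map_zero]; exact (pow_eq_zero_iff two_ne_zero).1 hD |>.symm⟩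
    obtain ⟨x, hx⟩ := hfix (z + σ z) (by rw [map_add, hσ]; ring)
    obtain ⟨y, hy⟩ := hfix ((z - σ z) * δ) (by rw [map_mul, map_sub, hσ, hσδ]; ring)
    apply hT u (2 * D * c) (D * x) y (mul_ne_zero (mul_ne_zero two_ne_zero hD0) hc)
    apply hinj
    have h2 : algebraMap (𝓞 K) (𝓞 L) 2 = 2 := map_ofNat _ 2
    simp only [map_sub, map_mul, map_pow, hx, hy, h2, ← hD] at hz ⊢
    linear_combination (4 * δ ^ 4) * hz
end nf

section quad
variable (K : IntermediateField ℚ ℂ)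

theorem quad_int {s : ℂ} {α : K} (hα : s ^ 2 = α) : IsIntegral K s := by
  refine ⟨Polynomial.X ^ 2 - Polynomial.C α, Polynomial.monic_X_pow_sub_C _ two_ne_zero, ?_⟩
  simp only [Polynomial.eval₂_sub, Polynomial.eval₂_pow, Polynomial.eval₂_X, Polynomial.eval₂_C]
  rw [hα]
  exact sub_self _

theorem quad_mem {s : ℂ} {α : K} (hα : s ^ 2 = α) {z : ℂ} (hz : z ∈ K⟮s⟯) :
    ∃ a b : K, z = a + b * s := by
  have h1 : z ∈ Algebra.adjoin K {s} := by
    rw [← adjoin_simple_toSubalgebra_of_isAlgebraic (quad_int K hα).isAlgebraic]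
    exact hz
  induction h1 using Algebra.adjoin_induction with
  | mem x hx =>
    rw [Set.mem_singleton_iff] at hx
    exact ⟨0, 1, by rw [hx]; simp⟩
  | algebraMap r => exact ⟨r, 0, by simp⟩
  | add x y hx hy ihx ihy =>
    obtain ⟨a, b, rfl⟩ := ihx (by
      rw [← mem_toSubalgebra, adjoin_simple_toSubalgebra_of_isAlgebraic (quad_int K hα).isAlgebraic]
      exact hx)
    obtain ⟨a', b', rfl⟩ := ihy (by
      rw [← mem_toSubalgebra, adjoin_simple_toSubalgebra_of_isAlgebraic (quad_int K hα).isAlgebraic]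
      exact hy)
    exact ⟨a + a', b + b', by push_cast; ring⟩
  | mul x y hx hy ihx ihy =>
    obtain ⟨a, b, rfl⟩ := ihx (by
      rw [← mem_toSubalgebra, adjoin_simple_toSubalgebra_of_isAlgebraic (quad_int K hα).isAlgebraic]
      exact hx)
    obtain ⟨a', b', rfl⟩ := ihy (by
      rw [← mem_toSubalgebra, adjoin_simple_toSubalgebra_of_isAlgebraic (quad_int K hα).isAlgebraic]
      exact hy)
    refine ⟨a * a' + b * b' * α, a * b' + a' * b, ?_⟩
    push_cast
    linear_combination (b * b' : ℂ) * hα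

theorem quad_nf [NumberField K] {s : ℂ} {α : K} (hα : s ^ 2 = α) : NumberField K⟮s⟯ := by
  have h1 : Module.Finite K K⟮s⟯ := adjoin.finiteDimensional (quad_int K hα)
  have h2 : Module.Finite ℚ K⟮s⟯ := Module.Finite.trans K K⟮s⟯
  exact { to_charZero := inferInstance, to_finiteDimensional := h2 }

theorem quad_finrank {s : ℂ} {α : K} (hα : s ^ 2 = α) (hs : s ∉ K) :
    Module.finrank K K⟮s⟯ = 2 := by
  rw [adjoin.finrank (quad_int K hα)]
  apply le_antisymm
  · have := minpoly.min K s (p := Polynomial.X ^ 2 - Polynomial.C α)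
      (Polynomial.monic_X_pow_sub_C _ two_ne_zero) (by
        simp only [map_sub, map_pow, Polynomial.aeval_X, Polynomial.aeval_C]
        rw [hα]; exact sub_self _)
    rw [← Polynomial.natDegree_X_pow_sub_C (n := 2) (r := α)]
    exact Polynomial.natDegree_le_natDegree this
  · rw [minpoly.two_le_natDegree_iff (quad_int K hα)]
    rintro ⟨r, hr⟩
    apply hs
    rw [← hr]
    exact r.2

theorem quad_totReal [NumberField K] [hK : IsTotallyReal K] {s : ℂ} {α : K} (hα : s ^ 2 = α)
    (hpos : ∀ φ : K →+* ℂ, ∃ r : ℝ, 0 ≤ r ∧ φ α = r) : IsTotallyReal K⟮s⟯ := by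
  have key : ∀ φ : K⟮s⟯ →+* ℂ, ComplexEmbedding.IsReal φ := by
    intro φ
    rw [ComplexEmbedding.isReal_iff]
    ext ⟨z, hz⟩
    obtain ⟨a, b, hab⟩ := quad_mem K hα hz
    let ψ : K →+* ℂ := φ.comp (algebraMap K K⟮s⟯)
    have hψ : ∀ x : K, (starRingEnd ℂ) (ψ x) = ψ x := by
      intro x
      have := IsTotallyReal.complexEmbedding_isReal ψ
      rw [ComplexEmbedding.isReal_iff] at this
      exact RingHom.congr_fun this x
    let S : K⟮s⟯ := AdjoinSimple.gen K s
    have hS : (S : ℂ) = s := AdjoinSimple.coe_gen K s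
    have hS2 : S ^ 2 = algebraMap K K⟮s⟯ α := by
      apply Subtype.ext
      push_cast
      rw [hS, hα]; rfl
    have hφS : (starRingEnd ℂ) (φ S) = φ S := by
      obtain ⟨r, hr0, hr⟩ := hpos ψ
      have h1 : (φ S) ^ 2 = ((Real.sqrt r : ℝ) : ℂ) ^ 2 := by
        rw [← map_pow, hS2]
        show ψ α = _
        rw [hr, ← Complex.ofReal_pow, Real.sq_sqrt hr0]
      rcases sq_eq_sq_iff_eq_or_eq_neg.1 h1 with h | h
      · rw [h, Complex.conj_ofReal]
      · rw [h, map_neg, Complex.conj_ofReal]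
    have hz' : (⟨z, hz⟩ : K⟮s⟯) = algebraMap K K⟮s⟯ a + algebraMap K K⟮s⟯ b * S := by
      apply Subtype.ext
      push_cast
      rw [hS]; exact hab
    rw [ComplexEmbedding.conjugate_coe_eq, hz', map_add, map_mul, map_add, map_mul, hφS]
    congr 1
    · exact hψ a
    · congr 1; exact hψ b
  exact ⟨fun v => InfinitePlace.isReal_iff.2 (key _)⟩

theorem even_C [NumberField K] [IsTotallyReal K] {s : ℂ} {α : K} (hα : s ^ 2 = α) (hs : s ∉ K)
    (hpos : ∀ φ : K →+* ℂ, ∃ r : ℝ, 0 ≤ r ∧ φ α = r)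
    (θ₁ θ₂ δ₁ δ₂ : ℂ) (s₁ s₂ α₁ α₂ : 𝓞 K)
    (hm₁ : θ₁ ∈ K⟮s⟯) (hm₂ : θ₂ ∈ K⟮s⟯) (hi₁ : IsIntegral ℤ θ₁) (hi₂ : IsIntegral ℤ θ₂)
    (hθ₁ : 2 * θ₁ = ((s₁ : K) : ℂ) + δ₁)
    (hθ₂ : 2 * θ₂ = ((s₂ : K) : ℂ) + δ₂)
    (hα₁ : δ₁ ^ 2 = ((α₁ : K) : ℂ)) (hα₂ : δ₂ ^ 2 = ((α₂ : K) : ℂ))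
    (hδ₁ : δ₁ ∉ K) (hδ₂ : δ₂ ∉ K)
    (hco : IsCoprime α₁ α₂) : ¬ Odd (Nat.card (ClassGroup (𝓞 K))) := by
  have := quad_nf K hα
  have := quad_totReal K hα hpos
  have hintg : ∀ z : K⟮s⟯, IsIntegral ℤ (z : ℂ) → IsIntegral ℤ z := fun z hz =>
    (isIntegral_algebraMap_iff (A := K⟮s⟯) (B := ℂ) (FaithfulSMul.algebraMap_injective _ _)).1 hz
  let t₁ : 𝓞 K⟮s⟯ := ⟨⟨θ₁, hm₁⟩, hintg _ hi₁⟩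
  let t₂ : 𝓞 K⟮s⟯ := ⟨⟨θ₂, hm₂⟩, hintg _ hi₂⟩
  let f := algebraMap (𝓞 K) (𝓞 K⟮s⟯)
  have hf : ∀ x : 𝓞 K, ((f x : K⟮s⟯) : ℂ) = ((x : K) : ℂ) := fun x => rfl
  let e₁ : 𝓞 K⟮s⟯ := 2 * t₁ - f s₁
  let e₂ : 𝓞 K⟮s⟯ := 2 * t₂ - f s₂
  have he₁ : ((e₁ : K⟮s⟯) : ℂ) = δ₁ := by
    show 2 * θ₁ - ((s₁ : K) : ℂ) = δ₁
    linear_combination hθ₁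
  have he₂ : ((e₂ : K⟮s⟯) : ℂ) = δ₂ := by
    show 2 * θ₂ - ((s₂ : K) : ℂ) = δ₂
    linear_combination hθ₂
  have hext : ∀ x y : 𝓞 K⟮s⟯, ((x : K⟮s⟯) : ℂ) = ((y : K⟮s⟯) : ℂ) → x = y := fun x y h =>
    RingOfIntegers.ext (Subtype.ext h)
  have q₁ : e₁ ^ 2 = f α₁ := by
    apply hext
    rw [hf, ← hα₁, ← he₁]; simp
  have q₂ : e₂ ^ 2 = f α₂ := by
    apply hext
    rw [hf, ← hα₂, ← he₂]; simp
  refine even_nf (L := K⟮s⟯) (quad_finrank K hα hs) t₁ t₂ e₁ e₂ s₁ s₂ α₁ α₂ ?_ ?_ q₁ q₂ ?_ ?_ ?_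
  · show 2 * t₁ = f s₁ + (2 * t₁ - f s₁); ring
  · show 2 * t₂ = f s₂ + (2 * t₂ - f s₂); ring
  · rintro ⟨r, hr⟩
    apply hδ₁
    rw [← he₁, ← hr]
    exact (r : K).2
  · rintro ⟨r, hr⟩
    apply hδ₂
    rw [← he₂, ← hr]
    exact (r : K).2
  · have := hco.map f
    rw [← q₁, ← q₂] at this
    exact (IsCoprime.pow_iff two_pos two_pos).1 this

theorem odd_C [NumberField K] [IsTotallyReal K] {δ : ℂ} (D : 𝓞 K) (hD : δ ^ 2 = ((D : K) : ℂ))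
    (hδ : δ ∉ K) (hpos : ∀ φ : K →+* ℂ, ∃ r : ℝ, 0 ≤ r ∧ φ (D : K) = r)
    (hodd : Odd (Nat.card (ClassGroup (𝓞 K)))) (θ : ℂ) (hi : IsIntegral ℤ θ) (s : 𝓞 K)
    (hθ : 2 * θ = ((s : K) : ℂ) + δ)
    (S0 : Finset (Ideal (𝓞 K))) (hS0 : ∀ P : Ideal (𝓞 K), P.IsPrime → D ∈ P → P ∈ S0)
    (T : Subgroup (𝓞 K)ˣ) (hT : ∀ (u : (𝓞 K)ˣ) (c x y : 𝓞 K), c ≠ 0 →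
      (u : 𝓞 K) * c ^ 2 = x ^ 2 - D * y ^ 2 → u ∈ T)
    (hcard : 2 ^ S0.card ≤ 2 * T.index) :
    Odd (Nat.card (ClassGroup (𝓞 (K⟮δ⟯.restrictScalars ℚ)))) := by
  have := quad_nf K hD
  have := quad_totReal K hD hpos
  have hintg : ∀ z : K⟮δ⟯, IsIntegral ℤ (z : ℂ) → IsIntegral ℤ z := fun z hz =>
    (isIntegral_algebraMap_iff (A := K⟮δ⟯) (B := ℂ) (FaithfulSMul.algebraMap_injective _ _)).1 hz
  have hm : θ ∈ K⟮δ⟯ := by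
    have : θ = (algebraMap K ℂ (s : K) + δ) * (2 : ℂ)⁻¹ := by
      have : ((s : K) : ℂ) = algebraMap K ℂ (s : K) := rfl
      rw [← this, ← hθ]; ring
    rw [this]
    refine mul_mem (add_mem (_root_.algebraMap_mem _ _) (mem_adjoin_simple_self K δ)) (inv_mem ?_)
    exact ofNat_mem _ 2
  let t : 𝓞 K⟮δ⟯ := ⟨⟨θ, hm⟩, hintg _ hi⟩
  let f := algebraMap (𝓞 K) (𝓞 K⟮δ⟯)
  have hf : ∀ x : 𝓞 K, ((f x : K⟮δ⟯) : ℂ) = ((x : K) : ℂ) := fun x => rfl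
  let e : 𝓞 K⟮δ⟯ := 2 * t - f s
  have he : ((e : K⟮δ⟯) : ℂ) = δ := by
    show 2 * θ - ((s : K) : ℂ) = δ
    linear_combination hθ
  have q : e ^ 2 = f D := by
    apply RingOfIntegers.ext; apply Subtype.ext
    rw [hf, ← hD]
    have h1 : ((e ^ 2 : 𝓞 K⟮δ⟯) : K⟮δ⟯) = (e : K⟮δ⟯) ^ 2 := map_pow _ _ _
    have h2 : (((e : K⟮δ⟯) ^ 2 : K⟮δ⟯) : ℂ) = ((e : K⟮δ⟯) : ℂ) ^ 2 := by push_cast; rfl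
    rw [h1, h2, he]
  refine odd_nf (L := K⟮δ⟯) (quad_finrank K hD hδ) hodd t e s D ?_ q ?_ S0 hS0 T hT hcard
  · show 2 * t = f s + (2 * t - f s); ring
  · rintro ⟨r, hr⟩
    apply hδ
    rw [← he, ← hr]
    exact (r : K).2
end quad

/-- tower polynomials -/
noncomputable def towF : ℕ → Polynomial ℤ
  | 0 => Polynomial.X
  | n + 1 => (towF n).comp (Polynomial.X ^ 2 - Polynomial.C 2)

/-- generator of the n-th layer -/
noncomputable def towx (n : ℕ) : ℂ := ((2 * Real.cos (Real.pi / 2 ^ (n + 1)) : ℝ) : ℂ)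

theorem towx_zero : towx 0 = 0 := by simp [towx]

theorem towx_sq (n : ℕ) : towx (n + 1) ^ 2 = 2 + towx n := by
  unfold towx
  have h : Real.pi / 2 ^ (n + 1) = 2 * (Real.pi / 2 ^ (n + 1 + 1)) := by
    rw [pow_succ 2 (n + 1)]; field_simp
  rw [h, Real.cos_two_mul]
  push_cast; ring

theorem towF_natDegree (n : ℕ) : (towF n).Monic ∧ (towF n).natDegree = 2 ^ n := by
  induction n with
  | zero => exact ⟨Polynomial.monic_X, by simp [towF]⟩
  | succ n ih =>
    have h2 : (Polynomial.X ^ 2 - Polynomial.C 2 : Polynomial ℤ).natDegree = 2 :=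
      Polynomial.natDegree_X_pow_sub_C
    refine ⟨ih.1.comp (Polynomial.monic_X_pow_sub_C 2 (by norm_num)) (by rw [h2]; norm_num), ?_⟩
    rw [towF, Polynomial.natDegree_comp, ih.2, h2, pow_succ]

theorem towF_mod (n : ℕ) :
    (towF n).map (Int.castRingHom (ZMod 2)) = Polynomial.X ^ (2 ^ n) := by
  induction n with
  | zero => simp [towF]
  | succ n ih =>
    rw [towF, Polynomial.map_comp, ih]
    have h2 : (Int.castRingHom (ZMod 2)) 2 = 0 := by decide
    rw [Polynomial.map_sub, Polynomial.map_pow, Polynomial.map_X, Polynomial.map_C, h2,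
      Polynomial.C_0, sub_zero, Polynomial.X_pow_comp, ← pow_mul, pow_succ, mul_comm]

theorem towF_eval_two (n : ℕ) : (towF n).eval 2 = 2 := by
  induction n with
  | zero => simp [towF]
  | succ n ih => rw [towF]; simp [Polynomial.eval_comp]; exact ih

theorem towF_eval_zero (n : ℕ) : (towF (n + 1)).eval 0 = 2 ∨ (towF (n + 1)).eval 0 = -2 := by
  cases n with
  | zero => right; simp [towF]
  | succ n =>
    left
    rw [towF, towF]; simp [Polynomial.eval_comp]; exact towF_eval_two n

theorem towF_irr (n : ℕ) : Irreducible (towF n) := by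
  cases n with
  | zero => exact Polynomial.irreducible_X
  | succ n =>
    obtain ⟨hm, hdeg⟩ := towF_natDegree (n + 1)
    have hP : (Ideal.span {(2 : ℤ)}).IsPrime := by
      rw [Ideal.span_singleton_prime (by norm_num)]
      exact Int.prime_two
    have he : (towF (n + 1)).IsEisensteinAt (Ideal.span {(2 : ℤ)}) := by
      refine ⟨?_, ?_, ?_⟩
      · rw [hm.leadingCoeff, Ideal.mem_span_singleton]; norm_num
      · intro i hi
        rw [hdeg] at hi
        rw [Ideal.mem_span_singleton]
        have h := congrArg (fun p => Polynomial.coeff p i) (towF_mod (n + 1))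
        simp only [Polynomial.coeff_map, Polynomial.coeff_X_pow] at h
        rw [if_neg (by omega)] at h
        have := (ZMod.intCast_zmod_eq_zero_iff_dvd _ 2).1 h
        exact_mod_cast this
      · rw [Polynomial.coeff_zero_eq_eval_zero, Ideal.span_singleton_pow,
          Ideal.mem_span_singleton]
        rcases towF_eval_zero n with h | h <;> rw [h] <;> norm_num
    exact he.irreducible hP hm.isPrimitive (by rw [hdeg]; positivity)

theorem towF_root (n : ℕ) : Polynomial.aeval (towx n) (towF n) = 0 := by
  induction n with
  | zero => simp [towF, towx_zero]
  | succ n ih =>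
    rw [towF, Polynomial.aeval_comp]
    have h2 : Polynomial.aeval (towx (n + 1)) (Polynomial.X ^ 2 - Polynomial.C 2 : Polynomial ℤ)
        = towx n := by
      rw [map_sub, map_pow, Polynomial.aeval_X, Polynomial.aeval_C, towx_sq]; simp
    rw [h2, ih]

theorem towF_real (n : ℕ) : ∀ y : ℂ, Polynomial.aeval y (towF n) = 0 →
    ∃ r : ℝ, |r| ≤ 2 ∧ y = r := by
  induction n with
  | zero => intro y hy; exact ⟨0, by norm_num, by simpa [towF] using hy⟩
  | succ n ih =>
    intro y hy
    rw [towF, Polynomial.aeval_comp] at hy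
    obtain ⟨r, hr, h⟩ := ih _ hy
    rw [map_sub, map_pow, Polynomial.aeval_X, Polynomial.aeval_C, map_ofNat] at h
    rw [abs_le] at hr
    have h2 : y ^ 2 = ((Real.sqrt (2 + r) : ℝ) : ℂ) ^ 2 := by
      rw [← Complex.ofReal_pow, Real.sq_sqrt (by linarith)]; push_cast; linear_combination h
    have hs : Real.sqrt (2 + r) ≤ 2 := by
      rw [Real.sqrt_le_left (by norm_num)]; linarith
    have hs0 := Real.sqrt_nonneg (2 + r)
    rcases sq_eq_sq_iff_eq_or_eq_neg.1 h2 with h3 | h3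
    · exact ⟨_, by rw [abs_of_nonneg hs0]; exact hs, h3⟩
    · exact ⟨-Real.sqrt (2 + r), by rw [abs_neg, abs_of_nonneg hs0]; exact hs, by rw [h3]; simp⟩

theorem towx_minpoly (n : ℕ) : minpoly ℚ (towx n) = (towF n).map (algebraMap ℤ ℚ) := by
  symm
  apply minpoly.eq_of_irreducible_of_monic
  · exact ((towF_natDegree n).1.irreducible_iff_irreducible_map_fraction_map).1 (towF_irr n)
  · rw [Polynomial.aeval_map_algebraMap]; exact towF_root n
  · exact (towF_natDegree n).1.map _

theorem towx_int (n : ℕ) : IsIntegral ℤ (towx n) := 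
  ⟨towF n, (towF_natDegree n).1, by simpa [Polynomial.aeval_def] using towF_root n⟩

/-- n-th layer -/
noncomputable def towQ (n : ℕ) : IntermediateField ℚ ℂ := ℚ⟮towx n⟯

theorem towx_mem (n : ℕ) : towx n ∈ towQ n := mem_adjoin_simple_self ℚ _

theorem towQ_finrank (n : ℕ) : Module.finrank ℚ (towQ n) = 2 ^ n := by
  unfold towQ
  rw [adjoin.finrank ((towx_int n).tower_top), towx_minpoly,
    (towF_natDegree n).1.natDegree_map, (towF_natDegree n).2]

theorem towQ_succ (n : ℕ) : ((towQ n)⟮towx (n + 1)⟯).restrictScalars ℚ = towQ (n + 1) := by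
  have e : ((towQ n)⟮towx (n + 1)⟯).restrictScalars ℚ = adjoin ℚ ({towx n} ∪ {towx (n + 1)}) :=
    adjoin_adjoin_left ℚ _ _
  rw [e]
  unfold towQ
  apply le_antisymm
  · rw [adjoin_le_iff]
    rintro z (hz | hz)
    · rw [Set.mem_singleton_iff.1 hz]
      have h1 := pow_mem (mem_adjoin_simple_self ℚ (towx (n + 1))) 2
      rw [towx_sq] at h1
      have h2 := sub_mem h1 (ofNat_mem ℚ⟮towx (n + 1)⟯ 2)
      simpa using h2
    · rw [Set.mem_singleton_iff.1 hz]
      exact mem_adjoin_simple_self ℚ _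
  · exact adjoin.mono _ _ _ Set.subset_union_right

theorem towQ_le_succ (n : ℕ) : towQ n ≤ towQ (n + 1) := by
  rw [← towQ_succ]
  intro z hz
  exact IntermediateField.algebraMap_mem ((towQ n)⟮towx (n + 1)⟯) (⟨z, hz⟩ : towQ n)

theorem towQ_mono {m n : ℕ} (h : m ≤ n) : towQ m ≤ towQ n :=
  monotone_nat_of_le_succ towQ_le_succ h

instance towQ_nf (n : ℕ) : NumberField (towQ n) := by
  have : FiniteDimensional ℚ (towQ n) :=
    Module.finite_of_finrank_pos (by rw [towQ_finrank]; positivity)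
  exact ⟨⟩

theorem towx_not_mem (n : ℕ) : towx (n + 1) ∉ towQ n := by
  intro h
  have h1 : towQ (n + 1) ≤ towQ n := by
    unfold towQ at *; rw [adjoin_simple_le_iff]; exact h
  have h2 : towQ (n + 1) = towQ n := le_antisymm h1 (towQ_le_succ n)
  have h3 := towQ_finrank (n + 1)
  rw [h2, towQ_finrank, pow_succ] at h3
  have : 0 < 2 ^ n := by positivity
  omega

/-- generator as an element -/
noncomputable def towX (n : ℕ) : towQ n := ⟨towx n, towx_mem n⟩

theorem towx_pos (n : ℕ) (φ : towQ n →+* ℂ) : ∃ r : ℝ, |r| ≤ 2 ∧ φ (towX n) = r := by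
  apply towF_real n
  have h1 : Polynomial.aeval (towX n) (towF n) = 0 := by
    apply Subtype.coe_injective
    have := Polynomial.aeval_algHom_apply ((towQ n).val.restrictScalars ℤ) (towX n) (towF n)
    have h2 := towF_root n
    change Polynomial.aeval ((towQ n).val (towX n)) (towF n) = 0 at h2
    simpa using this.symm.trans h2
  have := Polynomial.aeval_algHom_apply (φ.toIntAlgHom) (towX n) (towF n)
  rw [h1] at this
  simpa using this

theorem towx_pos2 (n : ℕ) (φ : towQ n →+* ℂ) : ∃ r : ℝ, 0 ≤ r ∧ φ (2 + towX n) = r := by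
  obtain ⟨r, hr, h⟩ := towx_pos n φ
  rw [abs_le] at hr
  exact ⟨2 + r, by linarith, by rw [map_add, h, map_ofNat]; simp⟩

instance towQ_real (n : ℕ) : IsTotallyReal (towQ n) := by
  induction n with
  | zero =>
    have h : towQ 0 = ⊥ := by
      unfold towQ; rw [towx_zero]; simp
    rw [h]
    exact NumberField.IsTotallyReal.ofRingEquiv (IntermediateField.botEquiv ℚ ℂ).symm.toRingEquiv
  | succ n ih =>
    have h := quad_totReal (towQ n) (s := towx (n + 1)) (α := 2 + towX n)
      (by rw [towx_sq]; rfl) (towx_pos2 n)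
    rw [← towQ_succ]
    exact h

open Classical in
/-- the elements x_k in the n-th layer -/
noncomputable def tX (n k : ℕ) : towQ n :=
  if h : k ≤ n then ⟨towx k, towQ_mono h (towx_mem k)⟩ else 0

theorem tX_coe {n k : ℕ} (h : k ≤ n) : ((tX n k : towQ n) : ℂ) = towx k := by
  unfold tX; rw [dif_pos h]

theorem tX_zero (n : ℕ) : tX n 0 = 0 := by
  apply Subtype.ext
  rw [tX_coe (Nat.zero_le n), towx_zero]; rfl

theorem tX_sq {n k : ℕ} (h : k + 1 ≤ n) : tX n (k + 1) ^ 2 = 2 + tX n k := by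
  apply Subtype.ext
  have h1 := towx_sq k
  rw [← tX_coe h, ← tX_coe (show k ≤ n by omega)] at h1
  exact h1

theorem tX_self (n : ℕ) : tX n n = towX n := by
  apply Subtype.ext
  rw [tX_coe le_rfl]; rfl

theorem towx_ne (k : ℕ) : towx (k + 1) ≠ 0 := by
  intro h
  exact towx_not_mem k (h ▸ zero_mem _)

theorem tX_ne {n k : ℕ} (h : k + 1 ≤ n) : tX n (k + 1) ≠ 0 := by
  intro h1
  apply towx_ne k
  rw [← tX_coe h, h1]; rfl

theorem tX_two_add_ne {n k : ℕ} (h : k ≤ n) : 2 + tX n k ≠ 0 := by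
  intro h1
  have h2 : towx (k + 1) ^ 2 = 0 := by
    rw [towx_sq, ← tX_coe h]
    exact congrArg Subtype.val h1
  exact towx_ne k (pow_eq_zero_iff (two_ne_zero)|>.1 h2)

theorem towF_cheb {R : Type*} [CommRing R] (n : ℕ) : ∀ y : R,
    Polynomial.aeval (y ^ 3 - 3 * y) (towF n) =
      (Polynomial.aeval y (towF n)) ^ 3 - 3 * Polynomial.aeval y (towF n) := by
  induction n with
  | zero => intro y; simp [towF]
  | succ n ih =>
    intro y
    rw [towF, Polynomial.aeval_comp, Polynomial.aeval_comp, ← ih]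
    congr 2
    simp only [map_sub, map_pow, Polynomial.aeval_X, Polynomial.aeval_C, map_ofNat]
    ring

theorem towX_root (n : ℕ) : Polynomial.aeval (towX n) (towF n) = 0 := by
  apply Subtype.coe_injective
  have := Polynomial.aeval_algHom_apply ((towQ n).val.restrictScalars ℤ) (towX n) (towF n)
  have h2 := towF_root n
  change Polynomial.aeval ((towQ n).val (towX n)) (towF n) = 0 at h2
  simpa using this.symm.trans h2

theorem tow_ext {n : ℕ} {f g : towQ n →ₐ[ℚ] towQ n} (h : f (towX n) = g (towX n)) : f = g := by
  have : (IntermediateField.adjoin.powerBasis (K := ℚ) (x := towx n)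
    ((towx_int n).tower_top)).gen = towX n := rfl
  exact (IntermediateField.adjoin.powerBasis (K := ℚ) (x := towx n)
    ((towx_int n).tower_top)).algHom_ext h

theorem exists_tau (n : ℕ) : ∃ τ : towQ n ≃ₐ[ℚ] towQ n, τ (towX n) = towX n ^ 3 - 3 * towX n := by
  let pb := IntermediateField.adjoin.powerBasis (K := ℚ) (x := towx n) ((towx_int n).tower_top)
  have hgen : pb.gen = towX n := rfl
  have hroot : Polynomial.aeval (towX n ^ 3 - 3 * towX n) (minpoly ℚ pb.gen) = 0 := by
    have : minpoly ℚ pb.gen = minpoly ℚ (towx n) := by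
      rw [hgen]; exact minpoly_gen ℚ (towx n)
    rw [this, towx_minpoly, Polynomial.aeval_map_algebraMap, towF_cheb, towX_root]
    simp
  let f : towQ n →ₐ[ℚ] towQ n := pb.lift _ hroot
  have hf : f (towX n) = towX n ^ 3 - 3 * towX n := pb.lift_gen _ hroot
  have : FiniteDimensional ℚ (towQ n) := inferInstance
  exact ⟨AlgEquiv.ofBijective f (Algebra.IsAlgebraic.algHom_bijective f), hf⟩

theorem tau_tX {n : ℕ} {τ : towQ n ≃ₐ[ℚ] towQ n} (h : τ (towX n) = towX n ^ 3 - 3 * towX n)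
    (j : ℕ) : j ≤ n → τ (tX n (n - j)) = tX n (n - j) ^ 3 - 3 * tX n (n - j) := by
  induction j with
  | zero => intro _; rw [Nat.sub_zero, tX_self, h]
  | succ j ih =>
    intro hj
    have ih := ih (by omega)
    have e : n - j = (n - (j + 1)) + 1 := by omega
    have h1 := tX_sq (n := n) (k := n - (j + 1)) (by omega)
    rw [← e] at h1
    have h2 : tX n (n - (j + 1)) = tX n (n - j) ^ 2 - 2 := by rw [h1]; ring
    rw [h2, map_sub, map_pow, ih, map_ofNat]
    ring

/-- generator predicate -/
def TGen (n : ℕ) (τ : towQ n ≃ₐ[ℚ] towQ n) : Prop :=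
  ∀ k, k < n → (τ ^ (2 ^ k)) (tX n (k + 1)) = - tX n (k + 1)

theorem exists_TGen (n : ℕ) : ∃ τ, TGen n τ := by
  obtain ⟨τ, hτ⟩ := exists_tau n
  refine ⟨τ, ?_⟩
  have key : ∀ k, k < n → (τ ^ (2 ^ k)) (tX n (k + 1)) = - tX n (k + 1) ∧
      ∃ s : towQ n, s ≠ 0 ∧ s ^ 2 = 2 - tX n k ∧ (τ ^ (2 ^ k)) s = - s := by
    intro k
    induction k with
    | zero =>
      intro h
      have h1 := tau_tX hτ (n - 1) (by omega)
      rw [show n - (n - 1) = 0 + 1 by omega] at h1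
      have h2 := tX_sq (n := n) (k := 0) (by omega)
      rw [tX_zero] at h2
      have h3 : τ (tX n (0 + 1)) = - tX n (0 + 1) := by
        rw [h1, pow_succ, h2]; ring
      rw [pow_zero, pow_one]
      exact ⟨h3, _, tX_ne (by omega), by rw [h2, tX_zero]; ring, h3⟩
    | succ k ih =>
      intro h
      obtain ⟨h1, s, hs0, hs, hgs⟩ := ih (by omega)
      set g := τ ^ (2 ^ k) with hg
      have hgg : ∀ z, (τ ^ (2 ^ (k + 1))) z = g (g z) := by
        intro z; rw [pow_succ, mul_two, pow_add, AlgEquiv.mul_apply]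
      have hx := tX_sq (n := n) (k := k + 1) (by omega)
      have hx0 := tX_sq (n := n) (k := k) (by omega)
      have hxne := tX_ne (n := n) (k := k + 1) (by omega)
      have h2ne := tX_two_add_ne (n := n) (k := k + 1) (by omega)
      set y := tX n (k + 1 + 1) with hy
      set w := tX n (k + 1) with hw
      have hs' : (s / y) ^ 2 = 2 - w := by
        rw [div_pow, hs, hx, div_eq_iff h2ne]; linear_combination hx0
      have hgy : (g y) ^ 2 = (s / y) ^ 2 := by
        rw [← map_pow, hx, map_add, map_ofNat, h1, hs']; ring
      have hsy : s / y ≠ 0 := div_ne_zero hs0 hxne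
      rcases sq_eq_sq_iff_eq_or_eq_neg.1 hgy with e | e
      · have e2 : g (s / y) = - y := by
          rw [map_div₀, hgs, e]; field_simp
        exact ⟨by rw [hgg, e, e2], s / y, hsy, hs', by rw [hgg, e2, map_neg, e]⟩
      · have e2 : g (s / y) = y := by
          rw [map_div₀, hgs, e]; field_simp
        exact ⟨by rw [hgg, e, map_neg, e2], s / y, hsy, hs', by rw [hgg, e2, e]⟩
  exact fun k hk => (key k hk).1

theorem tow_aut_ext {n : ℕ} {f g : towQ n ≃ₐ[ℚ] towQ n} (h : f (towX n) = g (towX n)) : f = g := by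
  have := tow_ext (f := f.toAlgHom) (g := g.toAlgHom) h
  ext z
  exact congrArg (fun u : towQ n →ₐ[ℚ] towQ n => ((u z : towQ n) : ℂ)) this

theorem TGen.pow_fix {n : ℕ} {τ} (h : TGen n τ) {k : ℕ} (hk : k ≤ n) :
    (τ ^ (2 ^ k)) (tX n k) = tX n k := by
  cases k with
  | zero => rw [tX_zero, map_zero]
  | succ k => 
    rw [pow_succ, mul_two, pow_add, AlgEquiv.mul_apply, h k (by omega), map_neg, h k (by omega),
      neg_neg]

theorem TGen.orderOf {n : ℕ} {τ} (h : TGen n τ) : orderOf τ = 2 ^ n := by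
  have h1 : τ ^ 2 ^ n = 1 := by
    apply tow_aut_ext
    rw [← tX_self, h.pow_fix le_rfl]; rfl
  cases n with
  | zero => rw [pow_zero, orderOf_eq_one_iff]; simpa using h1
  | succ n =>
    refine orderOf_eq_prime_pow (fun h2 => ?_) h1
    have h3 := h n (by omega)
    rw [h2] at h3
    have h4 := tX_ne (n := n + 1) (k := n) le_rfl
    exact h4 (self_eq_neg.1 h3)

theorem tow_card (n : ℕ) : Nat.card (towQ n ≃ₐ[ℚ] towQ n) = 2 ^ n := by
  obtain ⟨τ, h⟩ := exists_TGen n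
  apply le_antisymm
  · rw [← towQ_finrank n, Nat.card_eq_fintype_card]
    exact AlgEquiv.card_le
  · rw [← h.orderOf]
    exact Nat.le_of_dvd Nat.card_pos (orderOf_dvd_natCard τ)

instance tow_galois (n : ℕ) : IsGalois ℚ (towQ n) := by
  apply IsGalois.of_card_aut_eq_finrank
  rw [tow_card, towQ_finrank]

theorem TGen.exists_pow {n : ℕ} {τ} (h : TGen n τ) (σ : towQ n ≃ₐ[ℚ] towQ n) :
    ∃ j, j < 2 ^ n ∧ τ ^ j = σ := by
  classical
  have h1 : Subgroup.zpowers τ = ⊤ := by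
    apply Subgroup.eq_top_of_card_eq
    rw [Nat.card_zpowers, h.orderOf, tow_card]
  have h2 : σ ∈ Subgroup.zpowers τ := h1 ▸ Subgroup.mem_top σ
  have := (isOfFinOrder_of_finite τ).mem_zpowers_iff_mem_range_orderOf (y := σ)
  rw [this, Finset.mem_image] at h2
  obtain ⟨j, hj, e⟩ := h2
  rw [h.orderOf, Finset.mem_range] at hj
  exact ⟨j, hj, e⟩

theorem TGen.odd_pow {n : ℕ} {τ} (h : TGen n τ) {r : ℕ} (hr : Odd r) : TGen n (τ ^ r) := by
  intro k hk
  rw [← pow_mul, mul_comm, pow_mul]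
  have : ∀ j, ((τ ^ 2 ^ k) ^ j) (tX n (k + 1)) = (-1) ^ j * tX n (k + 1) := by
    intro j
    induction j with
    | zero => simp
    | succ j ih =>
      rw [pow_succ', AlgEquiv.mul_apply, ih, map_mul, h k hk, map_pow, map_neg, map_one, pow_succ]
      ring
  rw [this, hr.neg_one_pow]; ring

/-- choose a generator adapted to a given element -/
theorem exists_adapted {n : ℕ} (g : towQ n ≃ₐ[ℚ] towQ n) :
    ∃ τ v, TGen n τ ∧ v ≤ n ∧ τ ^ 2 ^ v = g := by
  obtain ⟨τ, h⟩ := exists_TGen n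
  obtain ⟨j, hj, rfl⟩ := h.exists_pow g
  rcases Nat.eq_zero_or_pos j with rfl | hj0
  · refine ⟨τ, n, h, le_rfl, ?_⟩
    rw [← h.orderOf, pow_orderOf_eq_one, pow_zero]
  · obtain ⟨v, r, hr, e⟩ := Nat.exists_eq_two_pow_mul_odd hj0.ne'
    refine ⟨τ ^ r, v, h.odd_pow hr, ?_, by rw [← pow_mul, e, mul_comm]⟩
    have hr0 : 1 ≤ r := hr.pos
    have : 2 ^ v < 2 ^ n := by nlinarith [Nat.one_le_two_pow (n := v)]
    exact ((Nat.pow_lt_pow_iff_right (by norm_num)).1 this).le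

theorem prod_double {M : Type*} [CommMonoid M] (f : ℕ → M) (a : ℕ) :
    ∏ j ∈ Finset.range (a * 2), f j = ∏ j ∈ Finset.range a, (f j * f (j + a)) := by
  rw [mul_two, Finset.prod_range_add, Finset.prod_mul_distrib]
  congr 1
  exact Finset.prod_congr rfl fun j _ => by rw [add_comm]

theorem TGen.prod_full {n : ℕ} {τ} (h : TGen n τ) (k : ℕ) : k + 1 ≤ n →
    ∏ j ∈ Finset.range (2 ^ (k + 1)), (τ ^ j) (1 + tX n (k + 1)) = -1 := by
  have hstep : ∀ k j, k + 1 ≤ n → (τ ^ j) (1 + tX n (k + 1)) *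
      (τ ^ (j + 2 ^ k)) (1 + tX n (k + 1)) = - (τ ^ j) (1 + tX n k) := by
    intro k j hk
    rw [pow_add, AlgEquiv.mul_apply, ← map_mul, ← map_neg]
    congr 1
    rw [map_add, map_one, h k (by omega)]
    linear_combination - tX_sq hk
  induction k with
  | zero =>
    intro hk
    rw [pow_succ, prod_double]
    simp only [hstep 0 _ hk]
    simp [tX_zero]
  | succ k ih =>
    intro hk
    rw [pow_succ, prod_double]
    simp only [hstep _ _ hk]
    rw [Finset.prod_neg, ih (by omega), Finset.card_range, pow_succ, mul_comm _ 2, pow_mul]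
    simp

/-- half product -/
theorem TGen.prod_half {n : ℕ} {τ} (h : TGen n τ) (k : ℕ) : k + 1 ≤ n →
    ∏ j ∈ Finset.range (2 ^ k), (τ ^ (2 * j)) (1 + tX n (k + 1)) = 1 + tX n 1 ∨
    ∏ j ∈ Finset.range (2 ^ k), (τ ^ (2 * j)) (1 + tX n (k + 1)) = - (1 + tX n 1) := by
  have hstep : ∀ k j, k + 1 + 1 ≤ n → (τ ^ (2 * j)) (1 + tX n (k + 1 + 1)) *
      (τ ^ (2 * (j + 2 ^ k))) (1 + tX n (k + 1 + 1)) = - (τ ^ (2 * j)) (1 + tX n (k + 1)) := by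
    intro k j hk
    rw [mul_add, ← pow_succ', pow_add, AlgEquiv.mul_apply, ← map_mul, ← map_neg]
    congr 1
    rw [map_add, map_one, h (k + 1) (by omega)]
    linear_combination - tX_sq hk
  induction k with
  | zero =>
    intro hk
    left
    simp
  | succ k ih =>
    intro hk
    rw [pow_succ, prod_double]
    simp only [hstep _ _ hk]
    rw [Finset.prod_neg, Finset.card_range]
    rcases neg_one_pow_eq_or (towQ n) (2 ^ k) with e | e <;> rw [e] <;>
    rcases ih (by omega) with e2 | e2 <;> rw [e2] <;> simp [sub_eq_add_neg, add_comm]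

theorem tX_int (n k : ℕ) : IsIntegral ℤ (tX n k) := by
  by_cases h : k ≤ n
  · have h1 := towx_int k
    rw [← tX_coe h] at h1
    exact (isIntegral_algebraMap_iff (A := towQ n) (B := ℂ) Subtype.coe_injective).1 h1
  · unfold tX; rw [dif_neg h]; exact isIntegral_zero

/-- x_k as an integer of the n-th layer -/
noncomputable def tO (n k : ℕ) : 𝓞 (towQ n) := ⟨tX n k, tX_int n k⟩

theorem tO_coe (n k : ℕ) : ((tO n k : 𝓞 (towQ n)) : towQ n) = tX n k := rfl

theorem tO_zero (n : ℕ) : tO n 0 = 0 := RingOfIntegers.ext (tX_zero n)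

theorem tO_sq {n k : ℕ} (h : k + 1 ≤ n) : tO n (k + 1) ^ 2 = 2 + tO n k :=
  RingOfIntegers.ext (tX_sq h)

theorem tO_mem {n : ℕ} {P : Ideal (𝓞 (towQ n))} (hP : P.IsPrime) (h2 : (2 : 𝓞 (towQ n)) ∈ P)
    (k : ℕ) : k ≤ n → tO n k ∈ P := by
  induction k with
  | zero => intro _; rw [tO_zero]; exact zero_mem _
  | succ k ih =>
    intro h
    apply hP.mem_of_pow_mem 2
    rw [tO_sq h]
    exact add_mem h2 (ih (by omega))

theorem TGen.prod_two {n : ℕ} {τ} (h : TGen n τ) (k : ℕ) : k ≤ n →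
    ∏ j ∈ Finset.range (2 ^ k), (τ ^ j) (2 + tX n k) = 2 ∧
    ∏ j ∈ Finset.range (2 ^ k), (τ ^ j) (2 - tX n k) = 2 := by
  have hstep : ∀ k j, k + 1 ≤ n → (τ ^ j) (2 + tX n (k + 1)) *
      (τ ^ (j + 2 ^ k)) (2 + tX n (k + 1)) = (τ ^ j) (2 - tX n k) := by
    intro k j hk
    rw [pow_add, AlgEquiv.mul_apply, ← map_mul]
    congr 1
    rw [map_add, map_ofNat, h k (by omega)]
    linear_combination - tX_sq hk
  have hstep' : ∀ k j, k + 1 ≤ n → (τ ^ j) (2 - tX n (k + 1)) *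
      (τ ^ (j + 2 ^ k)) (2 - tX n (k + 1)) = (τ ^ j) (2 - tX n k) := by
    intro k j hk
    rw [pow_add, AlgEquiv.mul_apply, ← map_mul]
    congr 1
    rw [map_sub, map_ofNat, h k (by omega)]
    linear_combination - tX_sq hk
  induction k with
  | zero =>
    intro hk
    simp [tX_zero]
  | succ k ih =>
    intro hk
    rw [pow_succ, prod_double, prod_double]
    simp only [hstep _ _ hk, hstep' _ _ hk]
    exact ⟨(ih (by omega)).2, (ih (by omega)).2⟩

theorem TGen.prod_gal {n : ℕ} {τ} (h : TGen n τ) {M : Type*} [CommMonoid M]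
    (f : (towQ n ≃ₐ[ℚ] towQ n) → M) :
    ∏ σ, f σ = ∏ j ∈ Finset.range (2 ^ n), f (τ ^ j) := by
  symm
  apply Finset.prod_bij (fun j _ => τ ^ j)
  · intro _ _; exact Finset.mem_univ _
  · intro a ha b hb e
    rw [Finset.mem_range] at ha hb
    rw [← h.orderOf] at ha hb
    exact pow_injOn_Iio_orderOf ha hb e
  · intro σ _
    obtain ⟨j, hj, e⟩ := h.exists_pow σ
    exact ⟨j, Finset.mem_range.2 hj, e⟩
  · intro _ _; rfl

theorem norm_two_add (n : ℕ) : Algebra.norm ℚ (2 + tX n n) = 2 := by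
  obtain ⟨τ, h⟩ := exists_TGen n
  apply (algebraMap ℚ (towQ n)).injective
  rw [Algebra.norm_eq_prod_automorphisms, h.prod_gal (fun σ => σ (2 + tX n n)),
    (h.prod_two n le_rfl).1, map_ofNat]

theorem two_prime (n : ℕ) : (Ideal.span {2 + tO n n}).IsPrime ∧ 2 + tO n n ≠ 0 := by
  have h1 : Algebra.norm ℤ (2 + tO n n) = 2 := by
    have := Algebra.coe_norm_int (2 + tO n n)
    have h2 : ((2 + tO n n : 𝓞 (towQ n)) : towQ n) = 2 + tX n n := by
      rfl
    rw [h2, norm_two_add] at this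
    exact_mod_cast this
  constructor
  · apply Ideal.isPrime_of_irreducible_absNorm
    rw [Ideal.absNorm_span_singleton, h1]
    exact Nat.prime_two
  · intro h
    rw [h, Algebra.norm_zero] at h1
    norm_num at h1

theorem prime_two_unique {n : ℕ} {P : Ideal (𝓞 (towQ n))} (hP : P.IsPrime)
    (h2 : (2 : 𝓞 (towQ n)) ∈ P) : P = Ideal.span {2 + tO n n} := by
  have h3 : 2 + tO n n ∈ P := add_mem h2 (tO_mem hP h2 n le_rfl)
  have h4 := (two_prime n).1.isMaximal (by
    intro h; exact (two_prime n).2 (Ideal.span_singleton_eq_bot.1 h))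
  exact (h4.eq_of_le hP.ne_top ((Ideal.span_singleton_le_iff_mem _).2 h3)).symm

theorem adjoin_two_mul (K : IntermediateField ℚ ℂ) (x : ℂ) : K⟮2 * x⟯ = K⟮x⟯ := by
  apply le_antisymm
  · rw [adjoin_simple_le_iff]
    exact mul_mem (ofNat_mem _ 2) (mem_adjoin_simple_self _ _)
  · rw [adjoin_simple_le_iff]
    have := div_mem (mem_adjoin_simple_self K (2 * x)) (ofNat_mem _ 2)
    rwa [mul_div_cancel_left₀ _ (two_ne_zero)] at this

theorem towQ_odd (n : ℕ) : Odd (Nat.card (ClassGroup (𝓞 (towQ n)))) := by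
  classical
  induction n with
  | zero =>
    have h : towQ 0 = ⊥ := by
      unfold towQ; rw [towx_zero]; simp
    rw [h]
    let e : (⊥ : IntermediateField ℚ ℂ) ≃+* ℚ := (IntermediateField.botEquiv ℚ ℂ).toRingEquiv
    let e2 : 𝓞 (⊥ : IntermediateField ℚ ℂ) ≃+* ℤ :=
      (RingOfIntegers.mapRingEquiv e).trans Rat.ringOfIntegersEquiv
    have : IsPrincipalIdealRing (𝓞 (⊥ : IntermediateField ℚ ℂ)) :=
      IsPrincipalIdealRing.of_surjective e2.symm.toRingHom e2.symm.surjective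
    have h1 : Subsingleton (ClassGroup (𝓞 (⊥ : IntermediateField ℚ ℂ))) := by
      rw [← Fintype.card_le_one_iff_subsingleton]
      exact (card_classGroup_eq_one).le
    rw [Nat.card_of_subsingleton 1]
    exact odd_one
  | succ n ih =>
    rw [← towQ_succ, ← adjoin_two_mul]
    have hDc : ((4 * (2 + tO n n) : 𝓞 (towQ n)) : towQ n) = 4 * (2 + towX n) := by
      rw [← tX_self]; rfl
    refine odd_C (towQ n) (δ := 2 * towx (n + 1)) (4 * (2 + tO n n)) ?_ ?_ ?_ ih (towx (n + 1))
      (towx_int _) 0 ?_ {Ideal.span {2 + tO n n}} ?_ ⊤ ?_ ?_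
    · rw [hDc, mul_pow, towx_sq]
      have : ((4 * (2 + towX n) : towQ n) : ℂ) = 4 * (2 + towx n) := rfl
      rw [this]; norm_num
    · intro h
      apply towx_not_mem n
      have := div_mem h (ofNat_mem (towQ n) 2)
      rwa [mul_div_cancel_left₀ _ (two_ne_zero)] at this
    · intro φ
      obtain ⟨r, hr, h⟩ := towx_pos2 n φ
      exact ⟨4 * r, by linarith, by rw [hDc, map_mul, h, map_ofNat]; simp⟩
    · simp
    · intro P hP h
      rw [Finset.mem_singleton]
      rcases hP.mem_or_mem h with h | h
      · apply prime_two_unique hP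
        apply hP.mem_of_pow_mem 2
        convert h using 1; norm_num
      · have h4 := (two_prime n).1.isMaximal (by
          intro h; exact (two_prime n).2 (Ideal.span_singleton_eq_bot.1 h))
        exact (h4.eq_of_le hP.ne_top ((Ideal.span_singleton_le_iff_mem _).2 h)).symm
    · intros; trivial
    · simp

theorem TGen.fixed {n : ℕ} {τ} (h : TGen n τ) {y : towQ n} (hy : τ y = y) :
    ∃ t : ℚ, y = algebraMap ℚ (towQ n) t := by
  have h1 : y ∈ Set.range (algebraMap ℚ (towQ n)) := by
    rw [IsGalois.mem_range_algebraMap_iff_fixed]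
    intro σ
    obtain ⟨j, -, rfl⟩ := h.exists_pow σ
    clear h
    induction j with
    | zero => rfl
    | succ j ih => rw [pow_succ, AlgEquiv.mul_apply, hy, ih]
  obtain ⟨t, ht⟩ := h1
  exact ⟨t, ht.symm⟩

theorem TGen.one {n : ℕ} {τ} (h : TGen n τ) (hn : 1 ≤ n) : τ (tX n 1) = - tX n 1 := by
  simpa using h 0 (by omega)

theorem tX_one_sq {n : ℕ} (hn : 1 ≤ n) : tX n 1 ^ 2 = 2 := by
  rw [tX_sq (k := 0) (by omega), tX_zero, add_zero]

theorem rat_sq {n : ℕ} (hn : 1 ≤ n) {y : towQ n} {r : ℚ} (h : y ^ 2 = algebraMap ℚ (towQ n) r) :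
    IsSquare r ∨ IsSquare (2 * r) := by
  obtain ⟨τ, hτ⟩ := exists_TGen n
  have h1 : (τ y) ^ 2 = y ^ 2 := by rw [← map_pow, h, AlgEquiv.commutes]
  rcases sq_eq_sq_iff_eq_or_eq_neg.1 h1 with h1 | h1
  · left
    obtain ⟨t, rfl⟩ := hτ.fixed h1
    refine ⟨t, (algebraMap ℚ (towQ n)).injective ?_⟩
    rw [← h, map_mul, sq]
  · right
    have h2 : τ (y * tX n 1) = y * tX n 1 := by
      rw [map_mul, h1, hτ.one hn]; ring
    obtain ⟨t, ht⟩ := hτ.fixed h2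
    refine ⟨t, (algebraMap ℚ (towQ n)).injective ?_⟩
    rw [map_mul, map_mul, ← h, ← ht, map_ofNat, ← tX_one_sq hn]; ring

/-- complex square root -/
noncomputable def csq (d : ℕ) : ℂ := ((Real.sqrt d : ℝ) : ℂ)

theorem csq_sq (d : ℕ) : csq d ^ 2 = d := by
  unfold csq
  rw [← Complex.ofReal_pow, Real.sq_sqrt (Nat.cast_nonneg d)]; simp

theorem csq_mul (a b : ℕ) : csq (a * b) = csq a * csq b := by
  unfold csq
  rw [Nat.cast_mul, Real.sqrt_mul (Nat.cast_nonneg a)]; simp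

theorem csq_ne {d : ℕ} (hd : 0 < d) : csq d ≠ 0 := by
  intro h
  have := csq_sq d
  rw [h] at this
  have h2 : (d : ℂ) = 0 := by rw [← this]; norm_num
  have : d = 0 := by exact_mod_cast h2
  omega

theorem not_sq_mem {n : ℕ} (hn : 1 ≤ n) {d : ℕ} (hodd : Odd d) (hsq : ¬ IsSquare d) {z : ℂ}
    (hz : z ^ 2 = d) : z ∉ towQ n := by
  intro h
  have h1 : (⟨z, h⟩ : towQ n) ^ 2 = algebraMap ℚ (towQ n) (d : ℚ) := by
    rw [map_natCast]
    apply Subtype.ext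
    exact hz
  rcases rat_sq hn h1 with h2 | h2
  · exact hsq (Rat.isSquare_natCast_iff.1 h2)
  · have h3 : IsSquare (2 * d) := by
      rw [← Rat.isSquare_natCast_iff]; exact_mod_cast h2
    obtain ⟨k, hk⟩ := h3
    obtain ⟨e, rfl⟩ := hodd
    have h4 : Even (k * k) := hk ▸ even_two_mul _
    rw [Nat.even_mul, or_self] at h4
    obtain ⟨f, rfl⟩ := h4
    have : 2 * e + 1 = 2 * (f * f) := by linarith
    omega

theorem adjoin_sq_mem (K : IntermediateField ℚ ℂ) {s : ℂ} {α : K} (hα : s ^ 2 = α) (hs : s ∉ K)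
    {z : ℂ} (hz : z ∈ K⟮s⟯) (hzz : z ^ 2 ∈ K) : z ∈ K ∨ ∃ b : K, z = b * s := by
  obtain ⟨a, b, rfl⟩ := quad_mem K hα hz
  by_cases hb : b = 0
  · left; rw [hb]; simp
  by_cases ha : a = 0
  · right; exact ⟨b, by rw [ha]; simp⟩
  exfalso
  apply hs
  have h1 : ((a : ℂ) + b * s) ^ 2 - a ^ 2 - b ^ 2 * α ∈ K :=
    sub_mem (sub_mem hzz (pow_mem a.2 2)) (mul_mem (pow_mem b.2 2) α.2)
  have ha' : (a : ℂ) ≠ 0 := fun h => ha (Subtype.ext h)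
  have hb' : (b : ℂ) ≠ 0 := fun h => hb (Subtype.ext h)
  have h2 := div_mem h1 (mul_mem (ofNat_mem K 2) (mul_mem a.2 b.2))
  have h3 : (((a : ℂ) + b * s) ^ 2 - a ^ 2 - b ^ 2 * α) / (2 * (a * b)) = s := by
    rw [div_eq_iff (mul_ne_zero two_ne_zero (mul_ne_zero ha' hb')), ← hα]; ring
  have h4 : (OfNat.ofNat 2 : ℂ) = 2 := rfl
  rw [← h3]; exact h2

/-- The field L_n -/
noncomputable def towL (n d : ℕ) : IntermediateField ℚ ℂ :=
  ((towQ n)⟮csq d⟯).restrictScalars ℚ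

theorem csq_coe (n d : ℕ) : csq d ^ 2 = ((d : towQ n) : ℂ) := by
  rw [csq_sq]; rfl

instance towL_nf (n d : ℕ) : NumberField (towL n d) := by
  exact quad_nf (towQ n) (csq_coe n d)

theorem nat_pos_emb {F : Type*} [Field F] (d : ℕ) (φ : F →+* ℂ) :
    ∃ r : ℝ, 0 ≤ r ∧ φ (d : F) = r := 
  ⟨d, Nat.cast_nonneg d, by simp⟩

instance towL_real (n d : ℕ) : IsTotallyReal (towL n d) := by
  exact quad_totReal (towQ n) (csq_coe n d) (nat_pos_emb d)

theorem towQ_le_towL (n d : ℕ) : towQ n ≤ towL n d := fun z hz =>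
  IntermediateField.algebraMap_mem ((towQ n)⟮csq d⟯) (⟨z, hz⟩ : towQ n)

theorem csq_mem (n d : ℕ) : csq d ∈ towL n d := mem_adjoin_simple_self (towQ n) (csq d)

theorem towL_sq_mem {n d : ℕ} (hn : 1 ≤ n) (hodd : Odd d) (hsq : ¬ IsSquare d) {z : ℂ}
    (hz : z ∈ towL n d) (hzz : z ^ 2 ∈ towQ n) : z ∈ towQ n ∨ ∃ b : towQ n, z = b * csq d :=
  adjoin_sq_mem (towQ n) (csq_coe n d) (not_sq_mem hn hodd hsq (csq_sq d)) hz hzz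

theorem towL_eq (n d : ℕ) : towL n d = adjoin ℚ ({towx n} ∪ {z : ℂ | z ^ 2 = ((d : ℤ) : ℂ)}) := by
  have e : towL n d = adjoin ℚ ({towx n} ∪ {csq d}) := adjoin_adjoin_left ℚ _ _
  rw [e]
  apply le_antisymm
  · apply adjoin.mono
    apply Set.union_subset_union_right
    rintro z hz
    rw [Set.mem_singleton_iff.1 hz]
    simp [csq_sq]
  · rw [adjoin_le_iff]
    rintro z (hz | hz)
    · exact subset_adjoin ℚ _ (Or.inl hz)
    · have h1 : z ^ 2 = csq d ^ 2 := by rw [csq_sq]; simpa using hz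
      have h2 : csq d ∈ adjoin ℚ ({towx n} ∪ {csq d}) := subset_adjoin ℚ _ (Or.inr rfl)
      rcases sq_eq_sq_iff_eq_or_eq_neg.1 h1 with h | h
      · rw [h]; exact h2
      · rw [h]; exact neg_mem h2

theorem towL_eq_two (d : ℕ) : towL 1 d =
    adjoin ℚ ({z : ℂ | z ^ 2 = 2} ∪ {z : ℂ | z ^ 2 = ((d : ℤ) : ℂ)}) := by
  rw [towL_eq]
  have h0 : towx 1 ^ 2 = 2 := by rw [towx_sq, towx_zero, add_zero]
  apply le_antisymm
  · apply adjoin.mono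
    apply Set.union_subset_union_left
    rintro z hz
    rw [Set.mem_singleton_iff.1 hz]
    exact h0
  · rw [adjoin_le_iff]
    rintro z (hz | hz)
    · have h1 : z ^ 2 = towx 1 ^ 2 := by rw [h0]; exact hz
      have h2 : towx 1 ∈ adjoin ℚ ({towx 1} ∪ {z : ℂ | z ^ 2 = ((d : ℤ) : ℂ)}) :=
        subset_adjoin ℚ _ (Or.inl rfl)
      rcases sq_eq_sq_iff_eq_or_eq_neg.1 h1 with h | h
      · rw [h]; exact h2
      · rw [h]; exact neg_mem h2
    · exact subset_adjoin ℚ _ (Or.inr hz)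

theorem int_quad {a b θ : ℂ} (ha : IsIntegral ℤ a) (hb : IsIntegral ℤ b)
    (h : θ ^ 2 = a * θ + b) : IsIntegral ℤ θ := by
  let A := integralClosure ℤ ℂ
  let a' : A := ⟨a, ha⟩
  let b' : A := ⟨b, hb⟩
  have h1 : IsIntegral A θ := by
    refine ⟨Polynomial.X ^ 2 - (Polynomial.C a' * Polynomial.X + Polynomial.C b'),
      Polynomial.monic_X_pow_sub (n := 2) (lt_of_le_of_lt Polynomial.degree_linear_le
        (by norm_num)), ?_⟩
    have ea : algebraMap A ℂ a' = a := rfl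
    have eb : algebraMap A ℂ b' = b := rfl
    simp only [Polynomial.eval₂_sub, Polynomial.eval₂_add, Polynomial.eval₂_mul,
      Polynomial.eval₂_pow, Polynomial.eval₂_X, Polynomial.eval₂_C, ea, eb, h, sub_self]
  exact isIntegral_trans (A := A) θ h1

theorem csq_int (d : ℕ) : IsIntegral ℤ (csq d) :=
  int_quad (a := 0) (b := (d : ℂ)) isIntegral_zero (by
    have := isIntegral_algebraMap (R := ℤ) (A := ℂ) (x := (d : ℤ)); simpa using this)
    (by rw [csq_sq]; ring)

theorem isInt_int (a : ℤ) : IsIntegral ℤ (a : ℂ) := by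
  have := isIntegral_algebraMap (R := ℤ) (A := ℂ) (x := a); simpa using this

theorem towL_csq_not {n : ℕ} (hn : 1 ≤ n) {m k : ℕ} (hm : Odd m) (hk : Odd k)
    (hms : ¬ IsSquare m) (hks : ¬ IsSquare k) (hs : ¬ IsSquare (m * k)) :
    csq m ∉ towL n (m * k) := by
  intro h
  rcases towL_sq_mem hn (hm.mul hk) hs h (by rw [csq_sq]; exact _root_.natCast_mem _ m) with h | ⟨b, h⟩
  · exact not_sq_mem hn hm hms (csq_sq m) h
  · apply not_sq_mem hn hk hks (csq_sq k)
    have hm0 : csq m ≠ 0 := csq_ne hm.pos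
    have hmm : (m : ℂ) ≠ 0 := by rw [← csq_sq]; exact pow_ne_zero 2 hm0
    have hk0 : (k : ℂ) ≠ 0 := by exact_mod_cast hk.pos.ne'
    have h1 : csq k = b * k := by
      rw [csq_mul] at h
      have : csq m * 1 = csq m * (b * csq k) := by linear_combination h
      have h2 := mul_left_cancel₀ hm0 this
      have h3 := csq_sq k
      linear_combination csq k * h2 + b * h3
    rw [h1]
    exact mul_mem b.2 (_root_.natCast_mem _ k)

theorem even1 {n : ℕ} (hn : 1 ≤ n) {m k : ℕ} (hm : m % 4 = 1) (hk : Odd k)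
    (hco : Nat.Coprime m k)
    (hms : ¬ IsSquare m) (hks : ¬ IsSquare k) (hs : ¬ IsSquare (m * k)) :
    ¬ Odd (Nat.card (ClassGroup (𝓞 (towL n (m * k))))) := by
  have hmo : Odd m := Nat.odd_iff.2 (by omega)
  have h1 := towL_csq_not hn hmo hk hms hks hs
  have h2 := towL_csq_not hn hk hmo hks hms (by rwa [mul_comm])
  rw [mul_comm k m] at h2
  have hm0 : csq m ≠ 0 := csq_ne hmo.pos
  set K := towL n (m * k) with hK
  have hmem : csq m ∈ K⟮csq m⟯ := mem_adjoin_simple_self _ _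
  refine even_C K (s := csq m) (α := (m : K)) (by rw [csq_sq]; rfl) h1 (nat_pos_emb m)
    ((1 + csq m) / 2) (csq k) (csq m) (2 * csq k) 1 0 (m : 𝓞 K) (4 * k : 𝓞 K)
    (div_mem (add_mem (one_mem _) hmem) (ofNat_mem _ 2)) ?_ ?_ (csq_int k) ?_ ?_ ?_ ?_ h1 ?_ ?_
  · have : csq k = csq (m * k) / csq m := by rw [csq_mul]; field_simp
    rw [this]
    exact div_mem (IntermediateField.algebraMap_mem K⟮csq m⟯ (⟨_, csq_mem n (m * k)⟩ : K)) hmem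
  · obtain ⟨j, hj⟩ : ∃ j, m = 4 * j + 1 := ⟨m / 4, by omega⟩
    refine int_quad (a := 1) (b := ((j : ℤ) : ℂ)) isIntegral_one (isInt_int j) ?_
    have := csq_sq m
    rw [hj] at this ⊢
    push_cast at this ⊢
    linear_combination this / 4
  · have : (((1 : 𝓞 K) : K) : ℂ) = 1 := rfl
    rw [this]; ring
  · have : (((0 : 𝓞 K) : K) : ℂ) = 0 := rfl
    rw [this]; ring
  · rw [csq_sq]
    simp
  · rw [mul_pow, csq_sq]
    have : (((4 * k : 𝓞 K) : K) : ℂ) = 4 * k := rfl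
    rw [this]; norm_num
  · intro h
    apply h2
    have := div_mem h (ofNat_mem K 2)
    rwa [mul_div_cancel_left₀ _ (two_ne_zero)] at this
  · have h3 : Nat.Coprime m (4 * k) := by
      apply Nat.Coprime.mul_right _ hco
      exact (Nat.Coprime.pow_right 2 (Nat.coprime_two_right.2 hmo) : Nat.Coprime m (2 ^ 2))
    have h4 : IsCoprime (m : ℤ) ((4 * k : ℕ) : ℤ) := Nat.isCoprime_iff_coprime.2 h3
    have h5 := h4.map (Int.castRingHom (𝓞 K))
    simpa using h5

theorem towx_one_sq : towx 1 ^ 2 = 2 := by rw [towx_sq, towx_zero, add_zero]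

theorem towx_one_int : IsIntegral ℤ (towx 1) := towx_int 1

theorem ztwo_int (a b : ℤ) : IsIntegral ℤ ((a : ℂ) + b * towx 1) :=
  (isInt_int a).add ((isInt_int b).mul towx_one_int)

theorem not_sq_elt {n : ℕ} (hn : 1 ≤ n) {d : ℕ} (hd : Odd d) (hs : ¬ IsSquare d) (w : towQ n)
    (h : w ^ 2 = (d : towQ n)) : False :=
  not_sq_mem hn hd hs (z := (w : ℂ)) (congrArg Subtype.val h) w.2

theorem alpha_not {n : ℕ} (hn : 1 ≤ n) {d : ℕ} (hd : Odd d) (hs : ¬ IsSquare d) {A B : ℤ}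
    (h : A ^ 2 - 2 * B ^ 2 = d) {z : ℂ} (hz : z ^ 2 = A + B * towx 1) : z ∉ towL n d := by
  intro hmem
  have hQ : towx 1 ∈ towQ n := towQ_mono hn (towx_mem 1)
  have hzz : z ^ 2 ∈ towQ n := by
    rw [hz]; exact add_mem (intCast_mem _ A) (mul_mem (intCast_mem _ B) hQ)
  have hC : (A : ℂ) ^ 2 - 2 * B ^ 2 = d := by exact_mod_cast h
  have hd0 : (d : ℂ) ≠ 0 := by exact_mod_cast hd.pos.ne'
  obtain ⟨τ, hτ⟩ := exists_TGen n
  -- common argument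
  have key : ∀ (y : towQ n), y ^ 2 = A + B * tX n 1 → (y * τ y) ^ 2 = (d : towQ n) := by
    intro y hy
    have h1 : (τ y) ^ 2 = A - B * tX n 1 := by
      rw [← map_pow, hy, map_add, map_mul, map_intCast, map_intCast, hτ.one hn]; ring
    have h2 : ((A : towQ n)) ^ 2 - 2 * B ^ 2 = d := by exact_mod_cast h
    rw [mul_pow, hy, h1]
    linear_combination h2 - (B : towQ n) ^ 2 * tX_one_sq hn
  have c1 : ((tX n 1 : towQ n) : ℂ) = towx 1 := tX_coe hn
  rcases towL_sq_mem hn hd hs hmem hzz with h1 | ⟨b, h1⟩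
  · have h2 := key ⟨z, h1⟩ (Subtype.ext (by
      change z ^ 2 = (A : ℂ) + B * ((tX n 1 : towQ n) : ℂ)
      rw [c1, hz]))
    exact not_sq_elt hn hd hs _ h2
  · have hb : (d : towQ n) * b ^ 2 = A + B * tX n 1 := Subtype.ext (by
      change (d : ℂ) * (b : ℂ) ^ 2 = (A : ℂ) + B * ((tX n 1 : towQ n) : ℂ)
      rw [c1, ← hz, h1, mul_pow, csq_sq]; ring)
    have hb2 : (d : towQ n) * (τ b) ^ 2 = A - B * tX n 1 := by
      have := congrArg τ hb
      rw [map_mul, map_natCast, map_pow, map_add, map_mul, map_intCast, map_intCast,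
        hτ.one hn] at this
      rw [this]; ring
    have h2 : ((A : towQ n)) ^ 2 - 2 * B ^ 2 = d := by exact_mod_cast h
    have h3 : ((d : towQ n) * (b * τ b)) ^ 2 = d := by
      have : ((d : towQ n) * b ^ 2) * ((d : towQ n) * (τ b) ^ 2) = d := by
        rw [hb, hb2]; linear_combination h2 - (B : towQ n) ^ 2 * tX_one_sq hn
      linear_combination this
    exact not_sq_elt hn hd hs _ h3

theorem even2 {n : ℕ} (hn : 1 ≤ n) {d : ℕ} (hd : Odd d) (hs : ¬ IsSquare d) {A B : ℤ}
    (hA : 0 < A) (h : A ^ 2 - 2 * B ^ 2 = d) (hco : IsCoprime (2 * A) (d : ℤ))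
    (a b t u : ℤ) (hAt : A = a ^ 2 + 2 * b ^ 2 + 4 * t) (hBu : B = 2 * a * b + 4 * u) :
    ¬ Odd (Nat.card (ClassGroup (𝓞 (towL n d)))) := by
  set K := towL n d with hK
  have hQ : towx 1 ∈ K := towQ_le_towL n d (towQ_mono hn (towx_mem 1))
  have hC : (A : ℂ) ^ 2 - 2 * B ^ 2 = d := by exact_mod_cast h
  have hd0 : (d : ℂ) ≠ 0 := by exact_mod_cast hd.pos.ne'
  obtain ⟨z, hz⟩ : ∃ z : ℂ, z ^ 2 = A + B * towx 1 := by
    obtain ⟨z, hz⟩ := IsAlgClosed.exists_pow_nat_eq ((A : ℂ) + B * towx 1) (n := 2) (by norm_num)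
    exact ⟨z, hz⟩
  have hprod : ((A : ℂ) + B * towx 1) * (A - B * towx 1) = d := by
    linear_combination hC - (B : ℂ) ^ 2 * towx_one_sq
  have hα0 : (A : ℂ) + B * towx 1 ≠ 0 := by
    intro h0; rw [h0, zero_mul] at hprod; exact hd0 hprod.symm
  have hz0 : z ≠ 0 := by
    rintro rfl; apply hα0; rw [← hz]; norm_num
  have hz2 : (csq d / z) ^ 2 = A - B * towx 1 := by
    rw [div_pow, csq_sq, hz, div_eq_iff hα0, ← hprod]; ring
  have hn1 := alpha_not hn hd hs h hz
  have hn2 := alpha_not hn hd hs (A := A) (B := -B) (z := csq d / z) (by rw [← h]; ring)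
    (by rw [hz2]; push_cast; ring)
  have hmem : z ∈ K⟮z⟯ := mem_adjoin_simple_self _ _
  let x : K := ⟨towx 1, hQ⟩
  have hx2 : x ^ 2 = 2 := Subtype.ext towx_one_sq
  have hxi : IsIntegral ℤ x :=
    (isIntegral_algebraMap_iff (A := K) (B := ℂ) Subtype.coe_injective).1 towx_one_int
  let X : 𝓞 K := ⟨x, hxi⟩
  have hX2 : X ^ 2 = 2 := RingOfIntegers.ext hx2
  have hXm : towx 1 ∈ K⟮z⟯ := IntermediateField.algebraMap_mem K⟮z⟯ x
  refine even_C K (s := z) (α := ((A : K) + B * x)) (by rw [hz]; rfl) hn1 ?_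
    ((a + b * towx 1 + z) / 2) ((a - b * towx 1 + csq d / z) / 2) z (csq d / z)
    (a + b * X) (a - b * X) (A + B * X) (A - B * X) ?_ ?_ ?_ ?_ ?_ ?_ ?_ ?_ hn1 hn2 ?_
  · intro φ
    have h1 : (φ x) ^ 2 = ((Real.sqrt 2 : ℝ) : ℂ) ^ 2 := by
      rw [← map_pow, hx2, map_ofNat, ← Complex.ofReal_pow, Real.sq_sqrt (by norm_num)]
      simp
    have hlt : (2 : ℝ) * B ^ 2 < A ^ 2 := by
      have : 2 * B ^ 2 < A ^ 2 := by
        have : (0 : ℤ) < d := by exact_mod_cast hd.pos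
        linarith
      exact_mod_cast this
    have hA' : (0 : ℝ) < A := by exact_mod_cast hA
    have h3 : |(B : ℝ) * Real.sqrt 2| ≤ A := by
      apply abs_le_of_sq_le_sq _ hA'.le
      rw [mul_pow, Real.sq_sqrt (by norm_num)]; linarith
    rw [abs_le] at h3
    rcases sq_eq_sq_iff_eq_or_eq_neg.1 h1 with e | e
    · refine ⟨A + B * Real.sqrt 2, by linarith, ?_⟩
      rw [map_add, map_mul, map_intCast, map_intCast, e]; push_cast; ring
    · refine ⟨A - B * Real.sqrt 2, by linarith, ?_⟩
      rw [map_add, map_mul, map_intCast, map_intCast, e]; push_cast; ring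
  · exact div_mem (add_mem (add_mem (intCast_mem _ a) (mul_mem (intCast_mem _ b) hXm)) hmem)
      (ofNat_mem _ 2)
  · have : csq d / z ∈ K⟮z⟯ :=
      div_mem (IntermediateField.algebraMap_mem K⟮z⟯ (⟨_, csq_mem n d⟩ : K)) hmem
    exact div_mem (add_mem (sub_mem (intCast_mem _ a) (mul_mem (intCast_mem _ b) hXm)) this)
      (ofNat_mem _ 2)
  · refine int_quad (ztwo_int a b) (ztwo_int t u) ?_
    rw [hAt, hBu] at hz
    push_cast at hz
    linear_combination hz / 4 - (b : ℂ) ^ 2 / 4 * towx_one_sq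
  · refine int_quad (ztwo_int a (-b)) (ztwo_int t (-u)) ?_
    rw [hAt, hBu] at hz2
    push_cast at hz2 ⊢
    linear_combination hz2 / 4 - (b : ℂ) ^ 2 / 4 * towx_one_sq
  · have : (((a + b * X : 𝓞 K) : K) : ℂ) = a + b * towx 1 := rfl
    rw [this]; ring
  · have : (((a - b * X : 𝓞 K) : K) : ℂ) = a - b * towx 1 := rfl
    rw [this]; ring
  · rw [hz]; rfl
  · rw [hz2]; rfl
  · obtain ⟨p, q, hpq⟩ := hco
    have h1 : (p : 𝓞 K) * (2 * A) + q * d = 1 := by exact_mod_cast congrArg (Int.cast) hpq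
    have h2 : (A : 𝓞 K) ^ 2 - 2 * B ^ 2 = d := by exact_mod_cast congrArg (Int.cast) h
    refine ⟨p + q * (A - B * X), p, ?_⟩
    linear_combination h1 + (q : 𝓞 K) * h2 - (q : 𝓞 K) * B ^ 2 * hX2

theorem gal_coe {K : Type*} [Field K] [NumberField K] (σ : K ≃ₐ[ℚ] K) (x : 𝓞 K) :
    ((σ • x : 𝓞 K) : K) = σ x := rfl

theorem under_eq {K : Type*} [Field K] [NumberField K] {P : Ideal (𝓞 K)} (hP : P.IsPrime) {q : ℕ}
    (hq : q.Prime) (h : (q : 𝓞 K) ∈ P) : P.under ℤ = Ideal.span {(q : ℤ)} := by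
  have h1 : (Ideal.span {(q : ℤ)}).IsMaximal :=
    PrincipalIdealRing.isMaximal_of_irreducible (Nat.prime_iff_prime_int.1 hq).irreducible
  symm
  apply h1.eq_of_le
  · exact (Ideal.IsPrime.under ℤ P).ne_top
  · rw [Ideal.span_singleton_le_iff_mem, Ideal.mem_comap]
    simpa using h

theorem frob_exists {K : Type*} [Field K] [NumberField K] [IsGalois ℚ K] {P : Ideal (𝓞 K)}
    (hP : P.IsPrime) {q : ℕ} (hq : q.Prime) (h : (q : 𝓞 K) ∈ P) :
    ∃ g : K ≃ₐ[ℚ] K, ∀ x : 𝓞 K, g • x - x ^ q ∈ P := by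
  have hP0 : P ≠ ⊥ := by
    rintro rfl
    have : (q : 𝓞 K) = 0 := by simpa using h
    exact hq.ne_zero (by exact_mod_cast this)
  have : Finite (𝓞 K ⧸ P) := Ideal.finiteQuotientOfFreeOfNeBot P hP0
  obtain ⟨g, hg⟩ := IsArithFrobAt.exists_of_isInvariant ℤ (K ≃ₐ[ℚ] K) P
  refine ⟨g, fun x => ?_⟩
  have h1 := hg x
  rw [under_eq hP hq h] at h1
  have h2 : Nat.card (ℤ ⧸ Ideal.span {(q : ℤ)}) = q := by
    rw [Nat.card_congr (Int.quotientSpanNatEquivZMod q).toEquiv, Nat.card_zmod]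
  rw [h2] at h1
  exact h1

theorem prime_trans {K : Type*} [Field K] [NumberField K] [IsGalois ℚ K] {P P' : Ideal (𝓞 K)}
    (hP : P.IsPrime) (hP' : P'.IsPrime) {q : ℕ} (hq : q.Prime) (h : (q : 𝓞 K) ∈ P)
    (h' : (q : 𝓞 K) ∈ P') :
    ∃ σ : K ≃ₐ[ℚ] K, ∀ x : 𝓞 K, σ • x ∈ P' ↔ x ∈ P := by
  obtain ⟨σ, hσ⟩ := Algebra.IsInvariant.exists_smul_of_under_eq ℤ (𝓞 K) (K ≃ₐ[ℚ] K) P P'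
    (by rw [under_eq hP hq h, under_eq hP' hq h'])
  refine ⟨σ, fun x => ?_⟩
  rw [hσ]
  exact Ideal.smul_mem_pointwise_smul_iff

theorem two_mem_of {n : ℕ} (P : Ideal (𝓞 (towQ n))) (k : ℕ) : k ≤ n →
    (tO n k - 2 ∈ P ∨ tO n k + 2 ∈ P) → (2 : 𝓞 (towQ n)) ∈ P := by
  induction k with
  | zero =>
    intro _ h
    rw [tO_zero] at h
    rcases h with h | h
    · have := neg_mem h; simpa using this
    · simpa using h
  | succ k ih =>
    intro hk h
    apply ih (by omega)
    left
    have e : tO n k - 2 = (tO n (k + 1) - 2) * (tO n (k + 1) + 2) := by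
      linear_combination - tO_sq hk
    rw [e]
    rcases h with h | h
    · exact Ideal.mul_mem_right _ _ h
    · exact Ideal.mul_mem_left _ _ h

theorem two_mem_of_tO {n k : ℕ} (hk : k + 1 ≤ n) (P : Ideal (𝓞 (towQ n)))
    (h : tO n (k + 1) ∈ P) : (2 : 𝓞 (towQ n)) ∈ P := by
  apply two_mem_of P k (by omega)
  right
  rw [add_comm, ← tO_sq hk]
  exact Ideal.pow_mem_of_mem _ h 2 (by norm_num)

theorem two_not_mem {K : Type*} [Field K] [NumberField K] {P : Ideal (𝓞 K)} (hP : P.IsPrime)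
    {q : ℕ} (hq : Odd q) (h : (q : 𝓞 K) ∈ P) : (2 : 𝓞 K) ∉ P := by
  intro h2
  obtain ⟨k, rfl⟩ := hq
  apply hP.ne_top
  rw [Ideal.eq_top_iff_one]
  have := sub_mem h (Ideal.mul_mem_right (k : 𝓞 K) _ h2)
  push_cast at this
  simpa using this

theorem tow_inertia {n : ℕ} {P : Ideal (𝓞 (towQ n))} (hP : P.IsPrime) 
    (h2 : (2 : 𝓞 (towQ n)) ∉ P) (σ : towQ n ≃ₐ[ℚ] towQ n) (h : ∀ x : 𝓞 (towQ n), σ • x - x ∈ P) :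
    σ = 1 := by
  obtain ⟨τ, v, hτ, hv, rfl⟩ := exists_adapted σ
  rcases hv.eq_or_lt with rfl | hv
  · rw [← hτ.orderOf, pow_orderOf_eq_one]
  · exfalso
    have h1 := h (tO n (v + 1))
    have h3 : τ ^ 2 ^ v • tO n (v + 1) = - tO n (v + 1) := RingOfIntegers.ext (hτ v hv)
    rw [h3] at h1
    have h4 : 2 * tO n (v + 1) ∈ P := by
      have := neg_mem h1
      convert this using 1; ring
    rcases hP.mem_or_mem h4 with h5 | h5
    · exact h2 h5
    · exact h2 (two_mem_of_tO hv P h5)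

theorem unram {n : ℕ} {P : Ideal (𝓞 (towQ n))} (hP : P.IsPrime) {q : ℕ} (hq : q.Prime)
    (hq2 : Odd q) (h : (q : 𝓞 (towQ n)) ∈ P) : (q : 𝓞 (towQ n)) ∉ P ^ 2 := by
  have hu := under_eq hP hq h
  have h1 : (Ideal.span {(q : ℤ)}).IsMaximal :=
    PrincipalIdealRing.isMaximal_of_irreducible (Nat.prime_iff_prime_int.1 hq).irreducible
  have : P.LiesOver (Ideal.span {(q : ℤ)}) := ⟨hu.symm⟩
  have hin : P.inertia (towQ n ≃ₐ[ℚ] towQ n) = ⊥ := by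
    rw [eq_bot_iff]
    intro σ hσ
    exact tow_inertia hP (two_not_mem hP hq2 h) σ hσ
  have hb : Ideal.span {(q : ℤ)} ≠ ⊥ := by
    rw [Ne, Ideal.span_singleton_eq_bot]
    exact_mod_cast hq.ne_zero
  have : Finite (ℤ ⧸ (Ideal.span {(q : ℤ)})) := Ideal.finiteQuotientOfFreeOfNeBot _ hb
  have h3 := Ideal.card_inertia_eq_ramificationIdxIn (G := (towQ n ≃ₐ[ℚ] towQ n))
    (Ideal.span {(q : ℤ)}) P
  rw [hin, Ideal.ramificationIdxIn_eq_ramificationIdx (Ideal.span {(q : ℤ)}) P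
    (towQ n ≃ₐ[ℚ] towQ n), ← Ideal.ramificationIdx'_eq_ramificationIdx (Ideal.span {(q : ℤ)}) P hb] at h3
  intro h4
  have h5 : (Ideal.span {(q : ℤ)}).map (algebraMap ℤ (𝓞 (towQ n))) = Ideal.span {(q : 𝓞 (towQ n))} := by
    rw [Ideal.map_span]; simp
  have h6 := (Ideal.ramificationIdx'_ne_one_iff (p := Ideal.span {(q : ℤ)}) (P := P)
    (by rw [h5, Ideal.span_singleton_le_iff_mem]; exact h)).2
    (by rw [h5, Ideal.span_singleton_le_iff_mem]; exact h4)
  apply h6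
  rw [← h3]
  simp

theorem nilp_card (r : ℕ) : ∀ {W : Type} [CommGroup W] [Finite W] (N : W →* W) (w : W),
    N^[r] w ≠ 1 → N^[r + 1] w = 1 → 2 ^ (r + 1) ≤ Nat.card W := by
  induction r with
  | zero =>
    intro W _ _ N w h _
    rw [zero_add, pow_one]
    have : Nontrivial W := ⟨_, _, h⟩
    exact Finite.one_lt_card
  | succ r ih =>
    intro W _ _ N w h1 h2
    let N' : N.range →* N.range := (N.comp N.range.subtype).codRestrict N.range
      (fun x => ⟨x, rfl⟩)
    let w' : N.range := ⟨N w, w, rfl⟩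
    have hit : ∀ j, ((N'^[j] w' : N.range) : W) = N^[j + 1] w := by
      intro j
      induction j with
      | zero => rfl
      | succ j ihj =>
        rw [Function.iterate_succ_apply', Function.iterate_succ_apply', ← ihj]; rfl
    have h3 := ih N' w' (fun h => h1 (by rw [← hit, h]; rfl))
      (Subtype.ext (by rw [hit, h2]; rfl))
    have h4 : Nat.card N.ker * Nat.card N.range = Nat.card W := by
      rw [← Subgroup.card_mul_index N.ker, Subgroup.index_ker]
    have h5 : 2 ≤ Nat.card N.ker := by
      have : Nontrivial N.ker := ⟨⟨N^[r + 1] w, by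
        have h6 := h2
        rw [Function.iterate_succ_apply'] at h6
        exact h6⟩, 1,
        fun h => h1 (congrArg Subtype.val h)⟩
      exact Finite.one_lt_card
    rw [← h4, pow_succ, mul_comm]
    exact Nat.mul_le_mul h5 h3

/-- shift minus one -/
def shN {A : Type} [CommGroup A] : (ℕ → A) →* (ℕ → A) where
  toFun f := fun i => f (i + 1) / f i
  map_one' := by funext i; simp
  map_mul' f g := by funext i; simp [mul_div_mul_comm]

theorem shN_apply {A : Type} [CommGroup A] (f : ℕ → A) (i : ℕ) : shN f i = f (i + 1) / f i := rfl

theorem shN_iter_sq {A : Type} [CommGroup A] (f : ℕ → A) (hf : ∀ i, f i * f i = 1) (j : ℕ) :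
    ∀ i, (shN^[j] f) i * (shN^[j] f) i = 1 := by
  induction j with
  | zero => exact hf
  | succ j ih =>
    intro i
    rw [Function.iterate_succ_apply', shN_apply, div_mul_div_comm, ih, ih, div_one]

theorem shN_two_pow {A : Type} [CommGroup A] (v : ℕ) : ∀ (f : ℕ → A), (∀ i, f i * f i = 1) → ∀ i,
    (shN^[2 ^ v] f) i = f (i + 2 ^ v) * f i := by
  have hdiv : ∀ a b : A, b * b = 1 → a / b = a * b := by
    intro a b h; rw [div_eq_iff_eq_mul, mul_assoc, h, mul_one]
  induction v with
  | zero =>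
    intro f hf i
    rw [pow_zero, Function.iterate_one, shN_apply, hdiv _ _ (hf i)]
  | succ v ih =>
    intro f hf i
    rw [pow_succ, mul_two, Function.iterate_add_apply, ih _ (shN_iter_sq f hf _), ih f hf, ih f hf,
      ← add_assoc]
    rw [mul_assoc, ← mul_assoc (f (i + 2 ^ v)), hf, one_mul]

theorem shN_full {A : Type} [CommGroup A] (v : ℕ) : ∀ (f : ℕ → A), (∀ i, f i * f i = 1) → ∀ i,
    (shN^[2 ^ v - 1] f) i = ∏ j ∈ Finset.range (2 ^ v), f (i + j) := by
  induction v with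
  | zero => intro f _ i; simp
  | succ v ih =>
    intro f hf i
    have e : 2 ^ (v + 1) - 1 = (2 ^ v - 1) + 2 ^ v := by
      have := Nat.one_le_two_pow (n := v); rw [pow_succ]; omega
    rw [e, Function.iterate_add_apply, ih _ (shN_iter_sq f hf _), pow_succ, prod_double]
    apply Finset.prod_congr rfl
    intro j _
    rw [shN_two_pow v f hf, mul_comm, add_assoc]

theorem shN_half {A : Type} [CommGroup A] (v : ℕ) : ∀ (f : ℕ → A), (∀ i, f i * f i = 1) → ∀ i,
    (shN^[2 ^ (v + 1) - 2] f) i = ∏ j ∈ Finset.range (2 ^ v), f (i + 2 * j) := by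
  induction v with
  | zero => intro f _ i; simp
  | succ v ih =>
    intro f hf i
    have e : 2 ^ (v + 1 + 1) - 2 = (2 ^ (v + 1) - 2) + 2 ^ (v + 1) := by
      have := Nat.one_le_two_pow (n := v); rw [pow_succ, pow_succ]; omega
    rw [e, Function.iterate_add_apply, ih _ (shN_iter_sq f hf _)]
    conv_rhs => rw [pow_succ, prod_double]
    apply Finset.prod_congr rfl
    intro j _
    rw [shN_two_pow (v + 1) f hf, mul_comm, add_assoc]
    congr 3
    rw [pow_succ]; ring

/-- index bound -/
theorem index_bound {E A : Type} [CommGroup E] [CommGroup A] (Φ : E →* (ℕ → A)) (t : E →* E)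
    (ht : ∀ u i, Φ (t u) i = Φ u (i + 1)) (hfin : Finite (Φ.range)) (η : E) (r : ℕ)
    (h1 : shN^[r] (Φ η) ≠ 1) (h2 : shN^[r + 1] (Φ η) = 1) : 2 ^ (r + 1) ≤ Φ.ker.index := by
  rw [Subgroup.index_ker]
  have hmem : ∀ x : Φ.range, shN (x : ℕ → A) ∈ Φ.range := by
    rintro ⟨_, u, rfl⟩
    refine ⟨t u / u, ?_⟩
    funext i
    rw [map_div, Pi.div_apply, ht]; rfl
  let N : Φ.range →* Φ.range := (shN.comp Φ.range.subtype).codRestrict Φ.range hmem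
  have hit : ∀ j, ((N^[j] ⟨Φ η, η, rfl⟩ : Φ.range) : ℕ → A) = shN^[j] (Φ η) := by
    intro j
    induction j with
    | zero => rfl
    | succ j ih =>
      rw [Function.iterate_succ_apply', Function.iterate_succ_apply', ← ih]; rfl
  exact nilp_card r N ⟨Φ η, η, rfl⟩ (fun h => h1 (by rw [← hit, h]; rfl))
    (Subtype.ext (by rw [hit, h2]; rfl))

theorem descent {R : Type*} [CommRing R] [IsDedekindDomain R] {Q : Ideal R} (hQ : Q.IsPrime)
    {D : R} (hD : D ∈ Q) (hD2 : D ∉ Q ^ 2) (u : Rˣ) : ∀ (k : ℕ) (c x y : R), c ∉ Q ^ k →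
    (u : R) * c ^ 2 = x ^ 2 - D * y ^ 2 → ∃ c' x' : R, c' ∉ Q ∧ (u : R) * c' ^ 2 - x' ^ 2 ∈ Q := by
  have hD0 : D ≠ 0 := by rintro rfl; exact hD2 (zero_mem _)
  obtain ⟨A, hA⟩ : Q ∣ Ideal.span {D} :=
    Ideal.dvd_span_singleton.2 hD
  have hAQ : ¬ A ≤ Q := by
    intro h
    apply hD2
    rw [← Ideal.span_singleton_le_iff_mem, hA, sq]
    exact Ideal.mul_mono le_rfl h
  obtain ⟨s, hsA, hsQ⟩ := Set.not_subset.1 hAQ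
  have hdiv : ∀ z ∈ Q, ∃ z', s * z = D * z' := by
    intro z hz
    have : s * z ∈ Ideal.span {D} := by
      rw [hA, mul_comm s]; exact Ideal.mul_mem_mul hz hsA
    exact Ideal.mem_span_singleton.1 this
  intro k
  induction k with
  | zero => intro c x y hc; simp at hc
  | succ k ih =>
    intro c x y hc h
    by_cases hcQ : c ∈ Q
    · have hx : x ∈ Q := by
        apply hQ.mem_of_pow_mem 2
        have : x ^ 2 = u * c ^ 2 + D * y ^ 2 := by linear_combination - h
        rw [this]
        exact add_mem (Ideal.mul_mem_left _ _ (Ideal.pow_mem_of_mem _ hcQ 2 (by norm_num)))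
          (Ideal.mul_mem_right _ _ hD)
      obtain ⟨c1, hc1⟩ := hdiv c hcQ
      obtain ⟨x1, hx1⟩ := hdiv x hx
      have e1 : s ^ 2 * y ^ 2 = D * (x1 ^ 2 - u * c1 ^ 2) := by
        apply mul_left_cancel₀ hD0
        linear_combination (s ^ 2) * h - (u : R) * (s * c + D * c1) * hc1 + (s * x + D * x1) * hx1
      have hy : y ∈ Q := by
        have : s ^ 2 * y ^ 2 ∈ Q := by rw [e1]; exact Ideal.mul_mem_right _ _ hD
        rcases hQ.mem_or_mem this with h | h
        · exact absurd (hQ.mem_of_pow_mem 2 h) hsQ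
        · exact hQ.mem_of_pow_mem 2 h
      obtain ⟨y1, hy1⟩ := hdiv y hy
      refine ih c1 x1 y1 ?_ ?_
      · intro hc1k
        have h3 : s * c ∈ Q ^ (k + 1) := by
          rw [hc1, pow_succ']; exact Ideal.mul_mem_mul hD hc1k
        exact hc ((Ideal.IsPrime.mul_mem_pow Q h3).resolve_left hsQ)
      · apply mul_left_cancel₀ hD0
        linear_combination e1 - (s * y + D * y1) * hy1
    · refine ⟨c, x, hcQ, ?_⟩
      have : (u : R) * c ^ 2 - x ^ 2 = D * (- y ^ 2) := by linear_combination h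
      rw [this]
      exact Ideal.mul_mem_right _ _ hD

theorem exists_not_mem_pow {R : Type*} [CommRing R] [IsDedekindDomain R] {Q : Ideal R}
    (hQ : Q.IsPrime) {c : R} (hc : c ≠ 0) : ∃ k, c ∉ Q ^ k := by
  by_contra h
  push Not at h
  apply hc
  have : c ∈ (⨅ k, Q ^ k : Ideal R) := by
    rw [Ideal.mem_iInf]; exact h
  rw [Ideal.iInf_pow_eq_bot_of_isDomain Q hQ.ne_top] at this
  simpa using this

/-- Galois action on units -/
def gU {R G : Type} [CommRing R] [Group G] [MulSemiringAction G R] (σ : G) : Rˣ →* Rˣ :=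
  Units.map (MulSemiringAction.toRingHom G R σ : R →* R)

theorem gU_coe {R G : Type} [CommRing R] [Group G] [MulSemiringAction G R] (σ : G) (u : Rˣ) :
    ((gU σ u : Rˣ) : R) = σ • (u : R) := rfl

/-- residue symbols -/
def symPhi {R G : Type} [CommRing R] [Group G] [MulSemiringAction G R] (P : Ideal R) (τ : G)
    (m f e : ℕ) : Rˣ →* (ℕ → (R ⧸ P)ˣ) where
  toFun u := fun i => Units.map (Ideal.Quotient.mk P : R →* R ⧸ P)
    (∏ j ∈ Finset.range f, gU (τ ^ (i + m * j)) u) ^ e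
  map_one' := by funext i; simp
  map_mul' u v := by funext i; simp [Finset.prod_mul_distrib, mul_pow]

section sym
variable {R G : Type} [CommRing R] [Group G] [MulSemiringAction G R] {P : Ideal R} {τ : G}
    {m f e q : ℕ}

theorem symPhi_coe (u : Rˣ) (i : ℕ) : ((symPhi P τ m f e u i : (R ⧸ P)ˣ) : R ⧸ P) =
    Ideal.Quotient.mk P ((∏ j ∈ Finset.range f, τ ^ (i + m * j) • (u : R)) ^ e) := by
  change ((Units.map (Ideal.Quotient.mk P : R →* R ⧸ P)
    (∏ j ∈ Finset.range f, gU (τ ^ (i + m * j)) u) ^ e : (R ⧸ P)ˣ) : R ⧸ P) = _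
  rw [Units.val_pow_eq_pow_val, Units.coe_map, map_pow, Units.coe_prod]
  rfl

theorem cyc_shift {M : Type*} [CommMonoid M] (a : ℕ → M) (f : ℕ) (h : a f = a 0) :
    ∏ j ∈ Finset.range f, a (j + 1) = ∏ j ∈ Finset.range f, a j := by
  cases f with
  | zero => rfl
  | succ k => rw [Finset.prod_range_succ, h, Finset.prod_range_succ']

theorem prod_mul_range {M : Type*} [CommMonoid M] (a : ℕ → M) (m f : ℕ) :
    ∏ l ∈ Finset.range m, ∏ j ∈ Finset.range f, a (l + m * j) =
      ∏ k ∈ Finset.range (m * f), a k := by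
  induction f with
  | zero => simp
  | succ f ih =>
    rw [mul_add, mul_one, Finset.prod_range_add, ← ih, ← Finset.prod_mul_distrib]
    apply Finset.prod_congr rfl
    intro l _
    rw [Finset.prod_range_succ, add_comm l (m * f)]

theorem frob_stab (hP : P.IsPrime) (hq : q ≠ 0) (hF : ∀ x : R, τ ^ m • x - x ^ q ∈ P) (j : ℕ) (x : R) :
    τ ^ (m * j) • x ∈ P ↔ x ∈ P := by
  have h1 : ∀ x : R, τ ^ m • x ∈ P ↔ x ∈ P := by
    intro x
    have h2 := hF x
    constructor
    · intro h
      exact hP.mem_of_pow_mem q ((Submodule.sub_mem_iff_right P h).1 h2)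
    · intro h
      exact (Submodule.sub_mem_iff_left P (Ideal.pow_mem_of_mem _ h q (Nat.pos_of_ne_zero hq))).1 h2
  induction j generalizing x with
  | zero => simp
  | succ j ih => rw [mul_add, mul_one, pow_add, mul_smul]; exact (ih _).trans (h1 x)

theorem frobNorm_pow (hP : P.IsPrime) (hq : q = 2 * e + 1) (hF : ∀ x : R, τ ^ m • x - x ^ q ∈ P)
    (hτ : τ ^ (m * f) = 1) {y : R} (hy : y ∉ P) :
    (∏ j ∈ Finset.range f, τ ^ (m * j) • y) ^ (2 * e) - 1 ∈ P := by
  set N := ∏ j ∈ Finset.range f, τ ^ (m * j) • y with hN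
  have h1 : τ ^ m • N = N := by
    rw [hN, Finset.smul_prod', ← cyc_shift (fun j => τ ^ (m * j) • y) f
      (by simp [hτ])]
    apply Finset.prod_congr rfl
    intro j _
    rw [smul_smul, ← pow_add, mul_add, mul_one, add_comm]
  have h2 : N ∉ P := by
    intro h
    rw [hN, hP.prod_mem_iff] at h
    obtain ⟨j, _, h⟩ := h
    exact hy ((frob_stab hP (by omega) hF j y).1 h)
  have h3 := hF N
  rw [h1, hq] at h3
  have h4 : N * (N ^ (2 * e) - 1) ∈ P := by
    rw [← neg_mem_iff]; convert h3 using 1; ring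
  exact (hP.mem_or_mem h4).resolve_left h2

theorem symPhi_sq (hP : P.IsPrime) (hq : q = 2 * e + 1) (hF : ∀ x : R, τ ^ m • x - x ^ q ∈ P)
    (hτ : τ ^ (m * f) = 1) (u : Rˣ) (i : ℕ) :
    symPhi P τ m f e u i * symPhi P τ m f e u i = 1 := by
  apply Units.ext
  rw [Units.val_mul, symPhi_coe, ← map_mul, ← sq, ← pow_mul, Units.val_one,
    ← map_one (Ideal.Quotient.mk P), Ideal.Quotient.eq, mul_comm e 2]
  have h := frobNorm_pow hP hq hF hτ (y := τ ^ i • (u : R))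
    (fun h => hP.ne_top (Ideal.eq_top_of_isUnit_mem _ h (gU (τ ^ i) u).isUnit))
  convert h using 4
  rw [smul_smul, ← pow_add, add_comm]

theorem symPhi_per (hτ : τ ^ (m * f) = 1) (u : Rˣ) (i : ℕ) :
    symPhi P τ m f e u (i + m) = symPhi P τ m f e u i := by
  apply Units.ext
  rw [symPhi_coe, symPhi_coe, ← cyc_shift (fun j => τ ^ (i + m * j) • (u : R)) f
      (by simp [pow_add, hτ])]
  congr 2
  apply Finset.prod_congr rfl
  intro j _
  rw [mul_add, mul_one, add_assoc, add_comm m]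

theorem symPhi_shift (u : Rˣ) (i : ℕ) :
    symPhi P τ m f e (gU τ u) i = symPhi P τ m f e u (i + 1) := by
  apply Units.ext
  rw [symPhi_coe, symPhi_coe, gU_coe]
  congr 2
  apply Finset.prod_congr rfl
  intro j _
  rw [smul_smul, ← pow_succ]
  congr 2; ring

theorem symPhi_finite [Finite (R ⧸ P)] (hm : 0 < m) (hτ : τ ^ (m * f) = 1) :
    Finite (symPhi P τ m f e).range := by
  have hper : ∀ (u : Rˣ) (i k : ℕ), symPhi P τ m f e u (i + m * k) = symPhi P τ m f e u i := by
    intro u i k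
    induction k with
    | zero => rfl
    | succ k ih => rw [mul_add, mul_one, ← add_assoc, symPhi_per hτ, ih]
  apply Finite.of_injective
    (fun x : (symPhi P τ m f e).range => fun i : Fin m => (x : ℕ → (R ⧸ P)ˣ) i)
  rintro ⟨_, u, rfl⟩ ⟨_, w, rfl⟩ h
  apply Subtype.ext
  funext i
  have := congrFun h ⟨i % m, Nat.mod_lt _ hm⟩
  change symPhi P τ m f e u i = symPhi P τ m f e w i
  rw [← Nat.mod_add_div i m, hper, hper]
  exact this

theorem symPhi_norm [IsDedekindDomain R] (hP : P.IsPrime) (hq : q = 2 * e + 1)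
    (hF : ∀ x : R, τ ^ m • x - x ^ q ∈ P)
    (hτ : τ ^ (m * f) = 1) {D : R} (hD : D ∈ P) (hD2 : D ∉ P ^ 2) (hDτ : τ • D = D)
    (u : Rˣ) (c x y : R) (hc : c ≠ 0) (h : (u : R) * c ^ 2 = x ^ 2 - D * y ^ 2) :
    u ∈ (symPhi P τ m f e).ker := by
  rw [MonoidHom.mem_ker]
  funext i
  have hDi : τ ^ i • D = D := by
    induction i with
    | zero => simp
    | succ i ih => rw [pow_succ, mul_smul, hDτ, ih]
  have h1 : ((gU (τ ^ i) u : Rˣ) : R) * (τ ^ i • c) ^ 2 =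
      (τ ^ i • x) ^ 2 - D * (τ ^ i • y) ^ 2 := by
    have := congrArg (fun z => τ ^ i • z) h
    simp only [smul_mul', smul_sub, smul_pow', hDi] at this
    exact this
  have hc' : τ ^ i • c ≠ 0 := by
    intro h0; exact hc ((smul_eq_zero_iff_eq _).1 h0)
  obtain ⟨k, hk⟩ := exists_not_mem_pow hP hc'
  obtain ⟨c', x', hc'P, h2⟩ := descent hP hD hD2 _ k _ _ _ hk h1
  have huP : ((gU (τ ^ i) u : Rˣ) : R) ∉ P := fun h =>
    hP.ne_top (Ideal.eq_top_of_isUnit_mem _ h (Units.isUnit _))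
  have hx'P : x' ∉ P := by
    intro hx
    have h3 : ((gU (τ ^ i) u : Rˣ) : R) * c' ^ 2 ∈ P :=
      (Submodule.sub_mem_iff_left P (Ideal.pow_mem_of_mem _ hx 2 (by norm_num))).1 h2
    rcases hP.mem_or_mem h3 with h3 | h3
    · exact huP h3
    · exact hc'P (hP.mem_of_pow_mem 2 h3)
  have hNc := frobNorm_pow hP hq hF hτ hc'P
  have hNx := frobNorm_pow hP hq hF hτ hx'P
  rw [← Ideal.Quotient.eq, map_pow, map_one] at hNc hNx
  apply Units.ext
  rw [symPhi_coe, map_pow]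
  have h4 : (Ideal.Quotient.mk P (∏ j ∈ Finset.range f, τ ^ (i + m * j) • (u : R))) *
      (Ideal.Quotient.mk P (∏ j ∈ Finset.range f, τ ^ (m * j) • c')) ^ 2 =
      (Ideal.Quotient.mk P (∏ j ∈ Finset.range f, τ ^ (m * j) • x')) ^ 2 := by
    rw [← map_pow, ← map_mul, ← map_pow, ← Finset.prod_pow, ← Finset.prod_pow,
      ← Finset.prod_mul_distrib, map_prod, map_prod]
    apply Finset.prod_congr rfl
    intro j _
    rw [Ideal.Quotient.eq]
    have h5 := (frob_stab hP (by omega) hF j _).2 h2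
    rw [smul_sub, smul_mul', smul_pow', smul_pow', gU_coe, smul_smul, ← pow_add, add_comm (m * j)] at h5
    exact h5
  have h6 := congrArg (fun z => z ^ e) h4
  simp only [mul_pow, ← pow_mul, hNc, hNx, mul_one] at h6
  exact h6

theorem sym_per_one (hP : P.IsPrime) (hq : q = 2 * e + 1) (hF : ∀ x : R, τ ^ m • x - x ^ q ∈ P)
    (hτ : τ ^ (m * f) = 1) {v : ℕ} (hm : m = 2 ^ v) (η : Rˣ) :
    shN^[2 ^ v] (symPhi P τ m f e η) = 1 := by
  funext i
  rw [shN_two_pow v _ (symPhi_sq hP hq hF hτ η), ← hm, symPhi_per hτ, symPhi_sq hP hq hF hτ η]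
  rfl

theorem sym_full (hP : P.IsPrime) (hq : q = 2 * e + 1) (hF : ∀ x : R, τ ^ m • x - x ^ q ∈ P)
    (hτ : τ ^ (m * f) = 1) {v : ℕ} (hm : m = 2 ^ v) (η : Rˣ)
    (hη : ∏ k ∈ Finset.range (m * f), τ ^ k • (η : R) = -1) (i : ℕ) :
    ((shN^[2 ^ v - 1] (symPhi P τ m f e η) i : (R ⧸ P)ˣ) : R ⧸ P) = (-1) ^ e := by
  rw [shN_full v _ (symPhi_sq hP hq hF hτ η), Units.coe_prod]
  simp_rw [symPhi_coe, ← map_prod, Finset.prod_pow]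
  have : ∏ l ∈ Finset.range (2 ^ v), ∏ j ∈ Finset.range f, τ ^ (i + l + m * j) • (η : R) = -1 := by
    have h2 := prod_mul_range (fun k => τ ^ i • (τ ^ k • (η : R))) m f
    rw [← Finset.smul_prod' (r := τ ^ i) (s := Finset.range (m * f)), hη, smul_neg, smul_one] at h2
    rw [← h2, hm]
    apply Finset.prod_congr rfl
    intro l _
    apply Finset.prod_congr rfl
    intro j _
    rw [smul_smul, ← pow_add, add_assoc]
  rw [this, map_pow, map_neg, map_one]

theorem sym_index3 [Finite (R ⧸ P)] (hP : P.IsPrime) (hq : q = 2 * e + 1)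
    (hF : ∀ x : R, τ ^ m • x - x ^ q ∈ P)
    (hτ : τ ^ (m * f) = 1) {v : ℕ} (hm : m = 2 ^ v) (η : Rˣ)
    (hη : ∏ k ∈ Finset.range (m * f), τ ^ k • (η : R) = -1) (he : Odd e) (h2 : (2 : R) ∉ P) :
    2 ^ m ≤ (symPhi P τ m f e).ker.index := by
  have hm0 : 0 < m := hm ▸ pow_pos (by norm_num) v
  have e1 : 2 ^ v - 1 + 1 = m := by omega
  have := index_bound (symPhi P τ m f e) (gU τ) symPhi_shift (symPhi_finite hm0 hτ) η (2 ^ v - 1) ?_ ?_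
  · rwa [e1] at this
  · intro h
    have h3 := sym_full hP hq hF hτ hm η hη 0
    rw [h, he.neg_one_pow] at h3
    apply h2
    rw [← Ideal.Quotient.eq_zero_iff_mem, map_ofNat]
    have h4 : (1 : R ⧸ P) = -1 := h3
    linear_combination h4
  · rw [e1, hm]; exact hm ▸ sym_per_one hP hq hF hτ hm η

theorem sym_index1 [Finite (R ⧸ P)] (hP : P.IsPrime) (hq : q = 2 * e + 1)
    (hF : ∀ x : R, τ ^ m • x - x ^ q ∈ P)
    (hτ : τ ^ (m * f) = 1) {v : ℕ} (hm : m = 2 ^ (v + 1)) (η : Rˣ)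
    (hη : ∏ k ∈ Finset.range (m * f), τ ^ k • (η : R) = -1) (he : Even e) (ε : R)
    (hε : ∏ k ∈ Finset.range (2 ^ v * f), τ ^ (2 * k) • (η : R) = ε)
    (hε1 : ε ^ e - 1 ∉ P) :
    2 ^ (m - 1) ≤ (symPhi P τ m f e).ker.index := by
  have hm0 : 0 < m := hm ▸ pow_pos (by norm_num) (v + 1)
  have h2v : 0 < 2 ^ v := pow_pos (by norm_num) v
  have e2 : 2 ^ (v + 1) - 2 + 1 = 2 ^ (v + 1) - 1 := by rw [pow_succ]; omega
  have e1 : 2 ^ (v + 1) - 1 = m - 1 := by omega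
  have := index_bound (symPhi P τ m f e) (gU τ) symPhi_shift (symPhi_finite hm0 hτ) η
    (2 ^ (v + 1) - 2) ?_ ?_
  · rwa [e2, e1] at this
  · intro h
    have h3 : ((shN^[2 ^ (v + 1) - 2] (symPhi P τ m f e η) 0 : (R ⧸ P)ˣ) : R ⧸ P) =
        Ideal.Quotient.mk P (ε ^ e) := by
      rw [shN_half v _ (symPhi_sq hP hq hF hτ η), Units.coe_prod]
      simp_rw [symPhi_coe, ← map_prod, Finset.prod_pow]
      have : ∏ l ∈ Finset.range (2 ^ v), ∏ j ∈ Finset.range f,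
          τ ^ (0 + 2 * l + m * j) • (η : R) = ε := by
        rw [← hε, ← prod_mul_range (fun k => τ ^ (2 * k) • (η : R)) (2 ^ v) f]
        apply Finset.prod_congr rfl
        intro l _
        apply Finset.prod_congr rfl
        intro j _
        congr 2
        rw [hm]; ring
      rw [this]
    apply hε1
    rw [h] at h3
    rw [← Ideal.Quotient.eq, map_one]
    exact h3.symm
  · rw [e2]
    funext i
    apply Units.ext
    rw [sym_full hP hq hF hτ hm η hη i, he.neg_one_pow]; rfl
end sym

theorem dvd_mem {R : Type*} [CommRing R] {P : Ideal R} {q : ℕ} (h : (q : R) ∈ P) {z : ℤ}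
    (hz : (q : ℤ) ∣ z) : (z : R) ∈ P := by
  obtain ⟨k, rfl⟩ := hz
  push_cast
  exact Ideal.mul_mem_right _ _ h

theorem leg_mem {R : Type*} [CommRing R] {P : Ideal R} {q : ℕ} [Fact q.Prime] (h : (q : R) ∈ P)
    (a : ℤ) : (a : R) ^ (q / 2) - ((legendreSym q a : ℤ) : R) ∈ P := by
  have h1 : (q : ℤ) ∣ a ^ (q / 2) - legendreSym q a := by
    rw [← ZMod.intCast_zmod_eq_zero_iff_dvd]
    push_cast
    rw [legendreSym.eq_pow, sub_self]
  have := dvd_mem h h1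
  push_cast at this
  exact this

theorem exists_prime_over {K : Type*} [Field K] [NumberField K] {q : ℕ} (hq : q.Prime) :
    ∃ P : Ideal (𝓞 K), P.IsPrime ∧ (q : 𝓞 K) ∈ P := by
  have h1 : (Ideal.span {(q : ℤ)}).IsMaximal :=
    PrincipalIdealRing.isMaximal_of_irreducible (Nat.prime_iff_prime_int.1 hq).irreducible
  obtain ⟨P, hP, hP2⟩ := Ideal.exists_maximal_ideal_liesOver_of_isIntegral
    (Ideal.span {(q : ℤ)}) (S := 𝓞 K)
  refine ⟨P, hP.isPrime, ?_⟩
  have : (q : ℤ) ∈ P.under ℤ := by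
    rw [← hP2.over]; exact Ideal.mem_span_singleton_self _
  rw [Ideal.under_def, Ideal.mem_comap] at this
  simpa using this

theorem ram_one {n : ℕ} {P : Ideal (𝓞 (towQ n))} (hP : P.IsPrime) {q : ℕ} (hq : q.Prime)
    (hq2 : Odd q) (h : (q : 𝓞 (towQ n)) ∈ P) {N : ℕ} (hN : q ∣ N) (hN2 : ¬ q ^ 2 ∣ N) :
    (N : 𝓞 (towQ n)) ∈ P ∧ (N : 𝓞 (towQ n)) ∉ P ^ 2 := by
  obtain ⟨k, rfl⟩ := hN
  have hk : ¬ q ∣ k := by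
    intro h; apply hN2; rw [sq]; exact mul_dvd_mul_left q h
  refine ⟨by push_cast; exact Ideal.mul_mem_right _ _ h, ?_⟩
  intro h3
  apply unram hP hq hq2 h
  have hco : IsCoprime (q : ℤ) (k : ℤ) := by
    rw [Nat.isCoprime_iff_coprime]; exact (Nat.Prime.coprime_iff_not_dvd hq).2 hk
  obtain ⟨a, b, hab⟩ := hco
  have h4 : (a : 𝓞 (towQ n)) * q + b * k = 1 := by exact_mod_cast congrArg (Int.cast : ℤ → 𝓞 (towQ n)) hab
  have : (q : 𝓞 (towQ n)) = a * (q ^ 2) + b * ((q * k : ℕ) : 𝓞 (towQ n)) := by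
    push_cast
    linear_combination (- (q : 𝓞 (towQ n))) * h4
  rw [this]
  exact add_mem (Ideal.mul_mem_left _ _ (Ideal.pow_mem_pow h 2)) (Ideal.mul_mem_left _ _ h3)

theorem smul_nat {n : ℕ} (σ : towQ n ≃ₐ[ℚ] towQ n) (N : ℕ) :
    σ • (N : 𝓞 (towQ n)) = N := by
  apply RingOfIntegers.ext
  rw [gal_coe]
  simp

theorem pack {n : ℕ} (hn : 1 ≤ n) {q : ℕ} (hq : q.Prime) (hq2 : Odd q) :
    ∃ (v : ℕ) (S : Finset (Ideal (𝓞 (towQ n)))), S.card ≤ 2 ^ v ∧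
      (∀ P : Ideal (𝓞 (towQ n)), P.IsPrime → (q : 𝓞 (towQ n)) ∈ P → P ∈ S) ∧
      (q % 8 = 3 ∨ q % 8 = 5 → v = 0) ∧
      (q % 4 = 3 → ∃ T : Subgroup (𝓞 (towQ n))ˣ, (∀ N : ℕ, q ∣ N → ¬ q ^ 2 ∣ N →
        ∀ (u : (𝓞 (towQ n))ˣ) (c x y : 𝓞 (towQ n)), c ≠ 0 →
        (u : 𝓞 (towQ n)) * c ^ 2 = x ^ 2 - (N : 𝓞 (towQ n)) * y ^ 2 → u ∈ T) ∧
        2 ^ 2 ^ v ≤ T.index) ∧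
      (q % 8 = 1 → (∀ P : Ideal (𝓞 (towQ n)), P.IsPrime → (q : 𝓞 (towQ n)) ∈ P →
          (1 + tO n 1) ^ (q / 2) - 1 ∉ P) →
        ∃ T : Subgroup (𝓞 (towQ n))ˣ, (∀ N : ℕ, q ∣ N → ¬ q ^ 2 ∣ N →
        ∀ (u : (𝓞 (towQ n))ˣ) (c x y : 𝓞 (towQ n)), c ≠ 0 →
        (u : 𝓞 (towQ n)) * c ^ 2 = x ^ 2 - (N : 𝓞 (towQ n)) * y ^ 2 → u ∈ T) ∧
        2 ^ (2 ^ v - 1) ≤ T.index) := by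
  classical
  have : Fact q.Prime := ⟨hq⟩
  obtain ⟨P, hP, hqP⟩ := exists_prime_over (K := towQ n) hq
  obtain ⟨g, hg⟩ := frob_exists hP hq hqP
  obtain ⟨τ, v, hτ, hv, rfl⟩ := exists_adapted g
  have h2P := two_not_mem hP hq2 hqP
  have hq8 : q ≠ 2 := by rintro rfl; revert hq2; decide
  have hqe : q = 2 * (q / 2) + 1 := by obtain ⟨k, rfl⟩ := hq2; omega
  have hP0 : P ≠ ⊥ := by
    rintro rfl
    rw [Ideal.mem_bot] at hqP
    exact hq.ne_zero (by exact_mod_cast hqP)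
  have hfinq : Finite (𝓞 (towQ n) ⧸ P) := Ring.HasFiniteQuotients.finiteQuotient hP0
  have hmf : 2 ^ v * 2 ^ (n - v) = 2 ^ n := by rw [← pow_add]; congr 1; omega
  have hτ1 : τ ^ (2 ^ v * 2 ^ (n - v)) = 1 := by rw [hmf, ← hτ.orderOf, pow_orderOf_eq_one]
  -- value of the Frobenius on the square root of two
  have hx1P : tO n 1 ∉ P := fun h => h2P (two_mem_of_tO (k := 0) hn P h)
  have htwo : tO n 1 ^ 2 = 2 := by rw [tO_sq (k := 0) hn, tO_zero, add_zero]
  have hleg : tO n 1 ^ q - ((legendreSym q 2 : ℤ) : 𝓞 (towQ n)) * tO n 1 ∈ P := by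
    have h1 := leg_mem hqP 2
    have h2 : tO n 1 ^ q = (2 : 𝓞 (towQ n)) ^ (q / 2) * tO n 1 := by
      conv_lhs => rw [hqe]
      rw [pow_succ, pow_mul, htwo]
    rw [h2, ← sub_mul]
    exact Ideal.mul_mem_right _ _ (by simpa using h1)
  have hgx : (τ ^ 2 ^ v) • tO n 1 - ((legendreSym q 2 : ℤ) : 𝓞 (towQ n)) * tO n 1 ∈ P := by
    have := add_mem (hg (tO n 1)) hleg
    simpa using this
  have hτx : τ • tO n 1 = - tO n 1 := RingOfIntegers.ext (by
    rw [gal_coe]; exact hτ.one hn)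
  have hv0 : q % 8 = 3 ∨ q % 8 = 5 → v = 0 := by
    intro h8
    have h1 : legendreSym q 2 = -1 := by
      rw [legendreSym.at_two hq8, ZMod.χ₈_nat_eq_if_mod_eight]
      rw [if_neg (by omega), if_neg (by omega)]
    by_contra h0
    obtain ⟨w, rfl⟩ := Nat.exists_eq_succ_of_ne_zero h0
    have h2 : (τ ^ 2 ^ (w + 1)) • tO n 1 = tO n 1 := by
      have h3 : τ ^ 2 • tO n 1 = tO n 1 := by rw [sq, mul_smul, hτx, smul_neg, hτx, neg_neg]
      rw [pow_succ', pow_mul]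
      generalize 2 ^ w = j
      induction j with
      | zero => simp
      | succ j ih => rw [pow_succ, mul_smul, h3, ih]
    rw [Nat.succ_eq_add_one, h2, h1] at hgx
    have : (2 : 𝓞 (towQ n)) * tO n 1 ∈ P := by
      convert hgx using 1; push_cast; ring
    exact (hP.mem_or_mem this).elim h2P hx1P
  have hv1 : q % 8 = 1 → v ≠ 0 := by
    rintro h8 rfl
    have h1 : legendreSym q 2 = 1 := by
      rw [legendreSym.at_two hq8, ZMod.χ₈_nat_eq_if_mod_eight]
      rw [if_neg (by omega), if_pos (by omega)]
    rw [pow_zero, pow_one, hτx, h1] at hgx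
    have : (2 : 𝓞 (towQ n)) * tO n 1 ∈ P := by
      rw [← neg_mem_iff]
      convert hgx using 1; push_cast; ring
    exact (hP.mem_or_mem this).elim h2P hx1P
  -- the unit
  have hprod : ∏ k ∈ Finset.range (2 ^ v * 2 ^ (n - v)), τ ^ k • (1 + tO n n) = -1 := by
    apply RingOfIntegers.ext
    rw [hmf]
    have := hτ.prod_full (n - 1) (by omega)
    rw [Nat.sub_add_cancel hn] at this
    exact (map_prod (algebraMap (𝓞 (towQ n)) (towQ n)) _ _).trans this
  have hunit : IsUnit (1 + tO n n) := by
    have h1 : (1 + tO n n) ∣ -1 := by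
      rw [← hprod]
      have := Finset.dvd_prod_of_mem (fun k => τ ^ k • (1 + tO n n))
        (Finset.mem_range.2 (show 0 < 2 ^ v * 2 ^ (n - v) by positivity))
      simpa using this
    exact isUnit_of_dvd_unit h1 isUnit_one.neg
  obtain ⟨η, hη⟩ := hunit
  rw [← hη] at hprod
  have hT : ∀ N : ℕ, q ∣ N → ¬ q ^ 2 ∣ N →
        ∀ (u : (𝓞 (towQ n))ˣ) (c x y : 𝓞 (towQ n)), c ≠ 0 →
        (u : 𝓞 (towQ n)) * c ^ 2 = x ^ 2 - (N : 𝓞 (towQ n)) * y ^ 2 →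
        u ∈ (symPhi P τ (2 ^ v) (2 ^ (n - v)) (q / 2)).ker := by
    intro N hN hN2 u c x y hc h
    obtain ⟨hD, hD2⟩ := ram_one hP hq hq2 hqP hN hN2
    exact symPhi_norm hP hqe hg hτ1 hD hD2 (smul_nat τ N) u c x y hc h
  refine ⟨v, (Finset.range (2 ^ v)).image
    (fun i => P.comap (MulSemiringAction.toRingHom (towQ n ≃ₐ[ℚ] towQ n) (𝓞 (towQ n)) (τ ^ i))),
    ?_, ?_, hv0, ?_, ?_⟩
  · exact Finset.card_image_le.trans (by rw [Finset.card_range])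
  · intro P' hP' hqP'
    obtain ⟨σ, hσ⟩ := prime_trans hP hP' hq hqP hqP'
    obtain ⟨j, _, hj⟩ := hτ.exists_pow σ⁻¹
    rw [Finset.mem_image]
    refine ⟨j % 2 ^ v, Finset.mem_range.2 (Nat.mod_lt _ (by positivity)), ?_⟩
    ext x
    rw [Ideal.mem_comap, MulSemiringAction.toRingHom_apply]
    have h1 := hσ (σ⁻¹ • x)
    rw [smul_inv_smul, ← hj] at h1
    rw [h1]
    conv_rhs => rw [← Nat.div_add_mod j (2 ^ v), pow_add, mul_smul]
    exact (frob_stab hP hq.ne_zero hg _ _).symm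
  · intro h4
    refine ⟨_, hT, ?_⟩
    exact sym_index3 hP hqe hg hτ1 rfl η hprod (by rw [Nat.odd_iff]; omega) h2P
  · intro h8 hcond
    refine ⟨_, hT, ?_⟩
    obtain ⟨w, rfl⟩ := Nat.exists_eq_succ_of_ne_zero (hv1 h8)
    have he : Even (q / 2) := by rw [Nat.even_iff]; omega
    refine sym_index1 hP hqe hg hτ1 rfl η hprod he _ rfl ?_
    have e1 : 2 ^ w * 2 ^ (n - (w + 1)) = 2 ^ (n - 1) := by rw [← pow_add]; congr 1; omega
    have h3 : ∏ k ∈ Finset.range (2 ^ w * 2 ^ (n - (w + 1))), τ ^ (2 * k) • (η : 𝓞 (towQ n)) =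
        1 + tO n 1 ∨ ∏ k ∈ Finset.range (2 ^ w * 2 ^ (n - (w + 1))),
          τ ^ (2 * k) • (η : 𝓞 (towQ n)) = - (1 + tO n 1) := by
      rw [e1, hη]
      have := hτ.prod_half (n - 1) (by omega)
      rw [Nat.sub_add_cancel hn] at this
      refine this.imp (fun h => RingOfIntegers.ext ?_) (fun h => RingOfIntegers.ext ?_)
      · exact (map_prod (algebraMap (𝓞 (towQ n)) (towQ n)) _ _).trans h
      · exact (map_prod (algebraMap (𝓞 (towQ n)) (towQ n)) _ _).trans h
    rcases h3 with h3 | h3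
    · rw [Nat.succ_eq_add_one, h3]; exact hcond P hP hqP
    · rw [Nat.succ_eq_add_one, h3, he.neg_pow]; exact hcond P hP hqP

theorem odd_gen1 {n : ℕ} (hn : 1 ≤ n) {d : ℕ} (hd : d % 4 = 1) (hs : ¬ IsSquare d)
    (S0 : Finset (Ideal (𝓞 (towQ n))))
    (hS0 : ∀ P : Ideal (𝓞 (towQ n)), P.IsPrime → (d : 𝓞 (towQ n)) ∈ P → P ∈ S0)
    (T : Subgroup (𝓞 (towQ n))ˣ) (hT : ∀ (u : (𝓞 (towQ n))ˣ) (c x y : 𝓞 (towQ n)), c ≠ 0 →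
      (u : 𝓞 (towQ n)) * c ^ 2 = x ^ 2 - (d : 𝓞 (towQ n)) * y ^ 2 → u ∈ T)
    (hcard : 2 ^ S0.card ≤ 2 * T.index) :
    Odd (Nat.card (ClassGroup (𝓞 (towL n d)))) := by
  have hodd : Odd d := by rw [Nat.odd_iff]; omega
  have hD : csq d ^ 2 = ((((d : 𝓞 (towQ n)) : towQ n)) : ℂ) := by
    rw [csq_sq]; simp
  refine odd_C (towQ n) (δ := csq d) (d : 𝓞 (towQ n)) hD (not_sq_mem hn hodd hs (csq_sq d))
    (fun φ => by simpa using nat_pos_emb d φ) (towQ_odd n) ((1 + csq d) / 2) ?_ 1 ?_ S0 hS0 T hT hcard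
  · obtain ⟨k, hk⟩ : ∃ k, d = 4 * k + 1 := ⟨d / 4, by omega⟩
    refine int_quad (a := 1) (b := (k : ℤ)) isIntegral_one (isInt_int k) ?_
    have h1 := csq_sq d
    have h2 : (d : ℂ) = 4 * k + 1 := by rw [hk]; push_cast; ring
    push_cast
    linear_combination (1 / 4 : ℂ) * h1 + (1 / 4 : ℂ) * h2
  · rw [show (((1 : 𝓞 (towQ n)) : towQ n) : ℂ) = 1 by simp]; ring

theorem odd_gen3 {n : ℕ} (hn : 1 ≤ n) {d : ℕ} (hodd : Odd d) (hs : ¬ IsSquare d)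
    (S0 : Finset (Ideal (𝓞 (towQ n))))
    (hS0 : ∀ P : Ideal (𝓞 (towQ n)), P.IsPrime → ((4 * d : ℕ) : 𝓞 (towQ n)) ∈ P → P ∈ S0)
    (T : Subgroup (𝓞 (towQ n))ˣ) (hT : ∀ (u : (𝓞 (towQ n))ˣ) (c x y : 𝓞 (towQ n)), c ≠ 0 →
      (u : 𝓞 (towQ n)) * c ^ 2 = x ^ 2 - ((4 * d : ℕ) : 𝓞 (towQ n)) * y ^ 2 → u ∈ T)
    (hcard : 2 ^ S0.card ≤ 2 * T.index) :
    Odd (Nat.card (ClassGroup (𝓞 (towL n d)))) := by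
  have hD : (2 * csq d) ^ 2 = ((((((4 * d : ℕ) : 𝓞 (towQ n))) : towQ n)) : ℂ) := by
    rw [show ((((4 * d : ℕ) : 𝓞 (towQ n))) : towQ n) = ((4 * d : ℕ) : towQ n) from map_natCast _ _,
      mul_pow, csq_sq, show (((4 * d : ℕ) : towQ n) : ℂ) = ((4 * d : ℕ) : ℂ) from rfl]
    push_cast
    norm_num
  have hmem : 2 * csq d ∉ towQ n := by
    intro h
    apply not_sq_mem hn hodd hs (csq_sq d)
    have := div_mem h (ofNat_mem (towQ n) 2)
    simpa using this
  have := odd_C (towQ n) (δ := 2 * csq d) ((4 * d : ℕ) : 𝓞 (towQ n)) hD hmem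
    (fun φ => by
      rw [show ((((4 * d : ℕ) : 𝓞 (towQ n))) : towQ n) = ((4 * d : ℕ) : towQ n) from map_natCast _ _]
      exact nat_pos_emb (4 * d) φ) (towQ_odd n) (csq d) (csq_int d) 0
    (by simp) S0 hS0 T hT hcard
  rw [adjoin_two_mul] at this
  exact this

theorem prime_nsq {p : ℕ} (hp : p.Prime) : ¬ IsSquare p := hp.prime.not_isSquare

theorem oddA1 {n : ℕ} (hn : 1 ≤ n) {q : ℕ} (hq : q.Prime) (h4 : q % 4 = 3) :
    Odd (Nat.card (ClassGroup (𝓞 (towL n q)))) := by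
  classical
  have hodd : Odd q := by rw [Nat.odd_iff]; omega
  obtain ⟨v, S, hS, hSm, -, h3, -⟩ := pack hn hq hodd
  obtain ⟨T, hT, hTi⟩ := h3 h4
  refine odd_gen3 hn hodd (prime_nsq hq) (insert (Ideal.span {2 + tO n n}) S) ?_ T
    (hT (4 * q) (dvd_mul_left q 4) ?_) ?_
  · intro P hP h
    rw [Finset.mem_insert]
    rw [show ((4 * q : ℕ) : 𝓞 (towQ n)) = 2 * (2 * q) by push_cast; ring] at h
    rcases hP.mem_or_mem h with h | h
    · exact Or.inl (prime_two_unique hP h)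
    · rcases hP.mem_or_mem h with h | h
      · exact Or.inl (prime_two_unique hP h)
      · exact Or.inr (hSm P hP h)
  · rw [sq, Nat.mul_dvd_mul_iff_right hq.pos]
    intro h
    have := Nat.le_of_dvd (by norm_num) h
    have : q = 3 := by omega
    subst this
    revert h; decide
  · calc 2 ^ (insert (Ideal.span {2 + tO n n}) S).card ≤ 2 ^ (2 ^ v + 1) :=
        Nat.pow_le_pow_right (by norm_num) ((Finset.card_insert_le _ _).trans (by omega))
      _ = 2 * 2 ^ 2 ^ v := by rw [pow_succ]; ring
      _ ≤ _ := Nat.mul_le_mul le_rfl hTi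

theorem oddA2 {n : ℕ} (hn : 1 ≤ n) {q p : ℕ} (hq : q.Prime) (hp : p.Prime) (h4 : q % 4 = 3)
    (h8 : p % 8 = 3) (hqp : q ≠ p) :
    Odd (Nat.card (ClassGroup (𝓞 (towL n (q * p))))) := by
  classical
  have hodd : Odd q := by rw [Nat.odd_iff]; omega
  have hoddp : Odd p := by rw [Nat.odd_iff]; omega
  obtain ⟨v, S, hS, hSm, -, h3, -⟩ := pack hn hq hodd
  obtain ⟨v', S', hS', hSm', hv', -⟩ := pack hn hp hoddp
  rw [hv' (Or.inl h8), pow_zero] at hS'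
  obtain ⟨T, hT, hTi⟩ := h3 h4
  have hdiv : ¬ q ^ 2 ∣ q * p := by
    rw [sq, Nat.mul_dvd_mul_iff_left hq.pos, Nat.prime_dvd_prime_iff_eq hq hp]
    exact hqp
  refine odd_gen1 hn ?_ ?_ (S ∪ S') ?_ T (hT (q * p) (dvd_mul_right q p) hdiv) ?_
  · rw [Nat.mul_mod, h4, show p % 4 = 3 by omega]
  · rintro ⟨r, hr⟩
    have h1 : q ∣ r * r := ⟨p, hr.symm⟩
    have h2 : q ∣ r := ((Nat.Prime.dvd_mul hq).1 h1).elim id id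
    apply hdiv
    rw [hr, ← sq]
    exact pow_dvd_pow_of_dvd h2 2
  · intro P hP h
    rw [Finset.mem_union]
    push_cast at h
    exact (hP.mem_or_mem h).imp (hSm P hP) (hSm' P hP)
  · calc 2 ^ (S ∪ S').card ≤ 2 ^ (2 ^ v + 1) :=
        Nat.pow_le_pow_right (by norm_num) ((Finset.card_union_le _ _).trans (by omega))
      _ = 2 * 2 ^ 2 ^ v := by rw [pow_succ]; ring
      _ ≤ _ := Nat.mul_le_mul le_rfl hTi

theorem oddB1 {n : ℕ} (hn : 1 ≤ n) {p : ℕ} (hp : p.Prime) (h8 : p % 8 = 5) :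
    Odd (Nat.card (ClassGroup (𝓞 (towL n p)))) := by
  have hoddp : Odd p := by rw [Nat.odd_iff]; omega
  obtain ⟨v', S', hS', hSm', hv', -⟩ := pack hn hp hoddp
  rw [hv' (Or.inr h8), pow_zero] at hS'
  refine odd_gen1 hn (by omega) (prime_nsq hp) S' hSm' ⊤ (fun _ _ _ _ _ _ => trivial) ?_
  rw [Subgroup.index_top]
  calc 2 ^ S'.card ≤ 2 ^ 1 := Nat.pow_le_pow_right (by norm_num) hS'
    _ = _ := by norm_num

theorem oddB2 {n : ℕ} (hn : 1 ≤ n) {p : ℕ} (hp : p.Prime) (h8 : p % 8 = 1)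
    (hc : ∀ P : Ideal (𝓞 (towQ n)), P.IsPrime → (p : 𝓞 (towQ n)) ∈ P →
          (1 + tO n 1) ^ (p / 2) - 1 ∉ P) :
    Odd (Nat.card (ClassGroup (𝓞 (towL n p)))) := by
  have hoddp : Odd p := by rw [Nat.odd_iff]; omega
  obtain ⟨v, S, hS, hSm, -, -, h1⟩ := pack hn hp hoddp
  obtain ⟨T, hT, hTi⟩ := h1 h8 hc
  refine odd_gen1 hn (by omega) (prime_nsq hp) S hSm T (hT p dvd_rfl ?_) ?_
  · intro h
    have h1 := Nat.le_of_dvd hp.pos h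
    have := hp.two_le
    nlinarith
  · have h2 : 0 < 2 ^ v := by positivity
    calc 2 ^ S.card ≤ 2 ^ (2 ^ v - 1 + 1) :=
        Nat.pow_le_pow_right (by norm_num) (by omega)
      _ = 2 * 2 ^ (2 ^ v - 1) := by rw [pow_succ]; ring
      _ ≤ _ := Nat.mul_le_mul le_rfl hTi

/-- quadratic symbol of `1 + √2` -/
theorem oddB3 {n : ℕ} (hn : 1 ≤ n) {p : ℕ} (hp : p.Prime) (h8 : p % 8 = 1) {a b : ℤ}
    (h : a ^ 2 - 2 * b ^ 2 = p)
    (h1 : ∀ [Fact p.Prime], legendreSym p b = 1)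
    (h2 : ∀ [Fact p.Prime], legendreSym p (a + b) = -1)
    (h3 : ∀ [Fact p.Prime], legendreSym p (b - a) = -1) :
    Odd (Nat.card (ClassGroup (𝓞 (towL n p)))) := by
  have hF : Fact p.Prime := ⟨hp⟩
  have hoddp : Odd p := by rw [Nat.odd_iff]; omega
  apply oddB2 hn hp h8
  intro P hP hpP hc
  have h2P := two_not_mem hP hoddp hpP
  have htwo : tO n 1 ^ 2 = 2 := by rw [tO_sq (k := 0) hn, tO_zero, add_zero]
  set x := tO n 1 with hx
  have hfac : (x * b - a) * (x * b + a) ∈ P := by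
    have h4 : (a : 𝓞 (towQ n)) ^ 2 - 2 * b ^ 2 = p := by exact_mod_cast congrArg (Int.cast : ℤ → 𝓞 (towQ n)) h
    have h5 : (x * b - a) * (x * b + a) = - (p : 𝓞 (towQ n)) := by
      linear_combination (b : 𝓞 (towQ n)) ^ 2 * htwo - h4
    rw [h5]; exact neg_mem hpP
  have fin : ∀ c : ℤ, x * b - c ∈ P → legendreSym p (b + c) = -1 → False := by
    intro c hc1 hl
    have e1 : (b : 𝓞 (towQ n)) * (1 + x) - ((b + c : ℤ) : 𝓞 (towQ n)) ∈ P := by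
      convert hc1 using 1; push_cast; ring
    have l1 := leg_mem hpP b
    have l2 := leg_mem hpP (b + c)
    rw [h1] at l1
    rw [hl] at l2
    rw [← Ideal.Quotient.eq] at e1 l1 l2 hc
    rw [map_mul] at e1
    rw [map_pow] at l1 l2 hc
    have e2 := congrArg (fun z => z ^ (p / 2)) e1
    simp only [mul_pow] at e2
    rw [l1, hc, l2] at e2
    apply h2P
    rw [← Ideal.Quotient.eq_zero_iff_mem, map_ofNat]
    simp only [Int.cast_one, map_one, Int.cast_neg, map_neg, mul_one] at e2
    linear_combination e2
  rcases hP.mem_or_mem hfac with h5 | h5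
  · exact fin a h5 (by rw [add_comm]; exact h2)
  · refine fin (-a) (by convert h5 using 1; push_cast; ring) (by rw [← sub_eq_add_neg]; exact h3)

theorem rep_exists {p : ℕ} (hp : p.Prime) (h8 : p % 8 = 1 ∨ p % 8 = 7) :
    ∃ a b : ℤ, 0 < a ∧ a ^ 2 - 2 * b ^ 2 = p := by
  have hF : Fact p.Prime := ⟨hp⟩
  have hp2 : p ≠ 2 := by rintro rfl; omega
  obtain ⟨s, hs⟩ := (ZMod.exists_sq_eq_two_iff hp2).2 h8
  set k := Nat.sqrt p with hk
  have hcard : Fintype.card (ZMod p) < Fintype.card (Fin (k + 1) × Fin (k + 1)) := by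
    rw [ZMod.card, Fintype.card_prod, Fintype.card_fin]
    exact Nat.lt_succ_sqrt p
  obtain ⟨⟨x1, y1⟩, ⟨x2, y2⟩, hne, heq⟩ := Fintype.exists_ne_map_eq_of_card_lt
    (fun z : Fin (k + 1) × Fin (k + 1) => ((z.1 : ℕ) : ZMod p) - s * ((z.2 : ℕ) : ZMod p)) hcard
  have hkp : k * k < p := by
    refine lt_of_le_of_ne (Nat.sqrt_le p) (fun h => prime_nsq hp ⟨k, h.symm⟩)
  have hkp' : (k : ℤ) * k < p := by exact_mod_cast hkp
  set x : ℤ := (x1 : ℕ) - (x2 : ℕ) with hx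
  set y : ℤ := (y1 : ℕ) - (y2 : ℕ) with hy
  have hbx : |x| ≤ k := by
    rw [abs_le]; have := x1.2; have := x2.2; constructor <;> omega
  have hby : |y| ≤ k := by
    rw [abs_le]; have := y1.2; have := y2.2; constructor <;> omega
  have hx2 : x ^ 2 < p := by
    rw [← sq_abs]; nlinarith [abs_nonneg x]
  have hy2 : y ^ 2 < p := by
    rw [← sq_abs]; nlinarith [abs_nonneg y]
  have hxy : x ≠ 0 ∨ y ≠ 0 := by
    by_contra h
    push Not at h
    apply hne
    obtain ⟨h1, h2⟩ := h
    refine Prod.ext (Fin.ext ?_) (Fin.ext ?_) <;> simp only <;> omega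
  have hdvd : (p : ℤ) ∣ x ^ 2 - 2 * y ^ 2 := by
    rw [← ZMod.intCast_zmod_eq_zero_iff_dvd]
    simp only at heq
    have h1 : ((x : ℤ) : ZMod p) = s * ((y : ℤ) : ZMod p) := by
      rw [hx, hy]; push_cast; linear_combination heq
    push_cast
    rw [h1]
    linear_combination (- (y : ZMod p) ^ 2) * hs
  have hnz : x ^ 2 - 2 * y ^ 2 ≠ 0 := by
    intro h
    by_cases hy0 : y = 0
    · rcases hxy with h1 | h1
      · apply h1; rw [hy0] at h; exact pow_eq_zero_iff (two_ne_zero) |>.1 (by linarith)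
      · exact h1 hy0
    · have h1 : ((x : ℚ) / y) ^ 2 = 2 := by
        have hyq : (y : ℚ) ≠ 0 := by exact_mod_cast hy0
        rw [div_pow, div_eq_iff (pow_ne_zero 2 hyq)]
        have : (x : ℚ) ^ 2 - 2 * y ^ 2 = 0 := by exact_mod_cast h
        linarith
      have h2 : IsSquare (2 : ℚ) := ⟨(x : ℚ) / y, by rw [← sq, h1]⟩
      have h3 : IsSquare (2 : ℕ) := by
        have := Rat.isSquare_natCast_iff (n := 2)
        exact this.1 (by exact_mod_cast h2)
      exact prime_nsq Nat.prime_two h3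
  obtain ⟨c, hc⟩ := hdvd
  have hp0 : (0 : ℤ) < p := by exact_mod_cast hp.pos
  have hc1 : c < 1 := by
    by_contra h; push Not at h
    nlinarith [sq_nonneg y]
  have hc2 : -2 < c := by
    by_contra h; push Not at h
    nlinarith [sq_nonneg x]
  have hc0 : c ≠ 0 := by rintro rfl; rw [mul_zero] at hc; exact hnz hc
  have hcm : c = -1 := by omega
  rw [hcm] at hc
  have hrep : (x + 2 * y) ^ 2 - 2 * (x + y) ^ 2 = p := by linear_combination - hc
  have hne0 : x + 2 * y ≠ 0 := by
    intro h; rw [h] at hrep; nlinarith [sq_nonneg (x + y)]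
  exact ⟨|x + 2 * y|, x + y, abs_pos.2 hne0, by rw [sq_abs]; exact hrep⟩

theorem rep_coprime {d : ℕ} (hodd : Odd d) (hsf : Squarefree d) {A B : ℤ}
    (h : A ^ 2 - 2 * B ^ 2 = d) : IsCoprime (2 * A) (d : ℤ) := by
  have h2 : ∀ l : ℕ, l.Prime → (l : ℤ) ∣ A → ¬ (l : ℤ) ∣ d := by
    intro l hl hA hd
    have hl' := Nat.prime_iff_prime_int.1 hl
    have h1 : (l : ℤ) ∣ 2 * B ^ 2 := by
      have : 2 * B ^ 2 = A ^ 2 - d := by linear_combination - h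
      rw [this]; exact dvd_sub (dvd_pow hA two_ne_zero) hd
    have hB : (l : ℤ) ∣ B := by
      rcases hl'.dvd_or_dvd h1 with h3 | h3
      · exfalso
        have h4 : l ∣ 2 := by exact_mod_cast h3
        have h5 := (Nat.prime_dvd_prime_iff_eq hl Nat.prime_two).1 h4
        subst h5
        have : 2 ∣ d := by exact_mod_cast hd
        rw [Nat.odd_iff] at hodd; omega
      · exact hl'.dvd_of_dvd_pow h3
    have h3 : (l : ℤ) * l ∣ d := by
      rw [← h, ← sq]
      exact dvd_sub (pow_dvd_pow_of_dvd hA 2) (Dvd.dvd.mul_left (pow_dvd_pow_of_dvd hB 2) 2)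
    have h4 : l * l ∣ d := by exact_mod_cast h3
    exact hl.one_lt.ne' (Nat.isUnit_iff.1 (hsf l h4))
  apply IsCoprime.mul_left
  · obtain ⟨k, rfl⟩ := hodd
    exact ⟨-k, 1, by push_cast; ring⟩
  · rw [Int.isCoprime_iff_gcd_eq_one]
    by_contra hg
    obtain ⟨l, hl, hlg⟩ := Nat.exists_prime_and_dvd hg
    have hlg' : (l : ℤ) ∣ (Int.gcd A d : ℤ) := by exact_mod_cast hlg
    exact h2 l hl (hlg'.trans (Int.gcd_dvd_left _ _)) (hlg'.trans (Int.gcd_dvd_right _ _))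

theorem leg_nat {p : ℕ} [Fact p.Prime] (hp : p % 4 = 1) {c : ℕ} (hc : Odd c) :
    legendreSym p c = jacobiSym p c := by
  rw [jacobiSym.legendreSym.to_jacobiSym]
  exact (jacobiSym.quadratic_reciprocity_one_mod_four hp hc).symm

theorem leg_b {p : ℕ} [hp : Fact p.Prime] (h8 : p % 8 = 1) {a b : ℤ} (h : a ^ 2 - 2 * b ^ 2 = p)
    (hab : IsCoprime a b) : legendreSym p b = 1 := by
  have hp2 : p ≠ 2 := by rintro rfl; omega
  have hm1 : legendreSym p (-1) = 1 := by
    rw [legendreSym.at_neg_one hp2, ZMod.χ₄_nat_one_mod_four (by omega)]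
  have h2 : legendreSym p 2 = 1 := by
    rw [legendreSym.at_two hp2, ZMod.χ₈_nat_eq_if_mod_eight, if_neg (by omega), if_pos (by omega)]
  have hb0 : b ≠ 0 := by
    rintro rfl
    apply prime_nsq hp.out
    have : IsSquare (p : ℤ) := ⟨a, by rw [← h]; ring⟩
    exact_mod_cast Int.isSquare_natCast_iff.1 this
  have hnat : legendreSym p (b.natAbs : ℤ) = 1 := by
    obtain ⟨k, m, hm, hbm⟩ := Nat.exists_eq_two_pow_mul_odd (n := b.natAbs) (by simpa using hb0)
    have hmb : (m : ℤ) ∣ b := by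
      exact (Int.natCast_dvd_natCast.2 (show m ∣ b.natAbs from ⟨2 ^ k, by rw [hbm]; ring⟩)).trans
        (Int.natAbs_dvd.2 dvd_rfl)
    rw [hbm]
    push_cast
    rw [legendreSym.mul, leg_nat (by omega) hm]
    have e1 : legendreSym p ((2 : ℤ) ^ k) = 1 := by
      have : legendreSym p ((2 : ℤ) ^ k) = (legendreSym p 2) ^ k := map_pow (legendreSym.hom p) 2 k
      rw [this, h2, one_pow]
    have e2 : jacobiSym p m = 1 := by
      have e3 : (p : ℤ) % m = (a ^ 2) % m := by
        apply Int.ModEq.symm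
        rw [Int.modEq_iff_dvd]
        rw [← h]
        have : a ^ 2 - 2 * b ^ 2 - a ^ 2 = b * (-2 * b) := by ring
        rw [this]; exact Dvd.dvd.mul_right hmb _
      rw [jacobiSym.mod_left' e3]
      apply jacobiSym.sq_one'
      rw [← Int.isCoprime_iff_gcd_eq_one]
      exact hab.of_isCoprime_of_dvd_right hmb
    rw [e1, e2, one_mul]
  rcases Int.natAbs_eq b with hb | hb
  · rw [hb]; exact hnat
  · rw [hb, neg_eq_neg_one_mul, legendreSym.mul, hm1, hnat, one_mul]

theorem leg_c {p : ℕ} [hp : Fact p.Prime] (h8 : p % 8 = 1) {a b : ℤ} (h : a ^ 2 - 2 * b ^ 2 = p)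
    (hab : IsCoprime a b) (hpos : 0 < a + b) (h4 : (a + b) % 4 = 3) :
    legendreSym p (a + b) = -1 := by
  obtain ⟨c, hc⟩ := Int.eq_ofNat_of_zero_le hpos.le
  rw [hc] at h4 ⊢
  have hodd : Odd c := by rw [Nat.odd_iff]; omega
  rw [leg_nat (by omega) hodd]
  have e3 : (p : ℤ) % c = (-1 * b ^ 2) % c := by
    apply Int.ModEq.symm
    rw [Int.modEq_iff_dvd, ← h, ← hc]
    exact ⟨a - b, by ring⟩
  rw [jacobiSym.mod_left' e3, jacobiSym.mul_left, jacobiSym.at_neg_one hodd,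
    ZMod.χ₄_nat_three_mod_four (by omega), jacobiSym.sq_one', mul_one]
  rw [← Int.isCoprime_iff_gcd_eq_one, ← hc]
  exact IsCoprime.add_mul_right_left (z := 1) hab |> fun h => by simpa using h.symm

/-- parity is determined by `d` alone -/
def Det (d : ℕ) : Prop :=
  (∀ n, 1 ≤ n → Odd (Nat.card (ClassGroup (𝓞 (towL n d))))) ∨
  (∀ n, 1 ≤ n → ¬ Odd (Nat.card (ClassGroup (𝓞 (towL n d)))))

theorem det_one {p : ℕ} (hp : p.Prime) (h8 : p % 8 = 1) : Det p := by
  obtain ⟨a, b, ha, h⟩ := rep_exists hp (Or.inl h8)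
  have hodd : Odd p := by rw [Nat.odd_iff]; omega
  have hco := rep_coprime hodd hp.prime.squarefree h
  have hp8 : (p : ℤ) % 8 = 1 := by omega
  have haodd : a % 2 = 1 := by
    rcases Int.emod_two_eq_zero_or_one a with h0 | h0
    · exfalso
      obtain ⟨k, rfl⟩ : (2 : ℤ) ∣ a := Int.dvd_of_emod_eq_zero h0
      have : (p : ℤ) = 2 * (2 * k ^ 2 - b ^ 2) := by rw [← h]; ring
      omega
    · exact h0
  have hbeven : b % 2 = 0 := by
    rcases Int.emod_two_eq_zero_or_one b with h0 | h0
    · exact h0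
    · exfalso
      obtain ⟨k, hk⟩ : ∃ k, a = 2 * k + 1 := ⟨a / 2, by omega⟩
      obtain ⟨l, hl⟩ : ∃ l, b = 2 * l + 1 := ⟨b / 2, by omega⟩
      have : (p : ℤ) = 4 * (k ^ 2 + k - 2 * l ^ 2 - 2 * l) - 1 := by rw [← h, hk, hl]; ring
      omega
  have hab : IsCoprime a b := by
    have h1 : IsCoprime a (p : ℤ) := hco.of_mul_left_right
    rw [← h] at h1
    have h2 : IsCoprime a (-2 * b ^ 2) := by
      have := IsCoprime.add_mul_left_right h1 (-a)
      rwa [show a ^ 2 - 2 * b ^ 2 + a * -a = -2 * b ^ 2 by ring] at this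
    exact (IsCoprime.of_mul_right_right h2).of_isCoprime_of_dvd_right (dvd_pow_self b two_ne_zero)
  rcases (show (a + b) % 4 = 1 ∨ (a + b) % 4 = 3 by omega) with h4 | h4
  · right
    intro n hn
    rcases (show b % 4 = 0 ∨ b % 4 = 2 by omega) with hb | hb
    · exact even2 hn hodd (prime_nsq hp) ha h hco 1 0 (a / 4) (b / 4) (by omega) (by omega)
    · exact even2 hn hodd (prime_nsq hp) ha h hco 1 1 (a / 4) (b / 4) (by omega) (by omega)
  · left
    intro n hn
    have hlt : b ^ 2 < a ^ 2 := by
      have : (0 : ℤ) < p := by exact_mod_cast hp.pos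
      nlinarith [sq_nonneg b]
    obtain ⟨hl, hr⟩ := abs_lt.1 (abs_lt_of_sq_lt_sq hlt ha.le)
    have h' : a ^ 2 - 2 * (-b) ^ 2 = p := by rw [← h]; ring
    apply oddB3 hn hp h8 h
    · intro _; exact leg_b h8 h hab
    · intro _; exact leg_c h8 h hab (by linarith) h4
    · intro _
      have hp2 : p ≠ 2 := by rintro rfl; omega
      have hm1 : legendreSym p (-1) = 1 := by
        rw [legendreSym.at_neg_one hp2, ZMod.χ₄_nat_one_mod_four (by omega)]
      have := leg_c h8 h' hab.neg_right (by linarith) (by omega)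
      rw [show b - a = -1 * (a + -b) by ring, legendreSym.mul, hm1, this, one_mul]

theorem det_prime {p : ℕ} (hp : p.Prime) (hodd : Odd p) : Det p := by
  rw [Nat.odd_iff] at hodd
  rcases (show p % 8 = 1 ∨ p % 8 = 5 ∨ p % 4 = 3 by omega) with h | h | h
  · exact det_one hp h
  · exact Or.inl (fun n hn => oddB1 hn hp h)
  · exact Or.inl (fun n hn => oddA1 hn hp h)

theorem sqf_nsq {d : ℕ} (h : Squarefree d) (h1 : 1 < d) : ¬ IsSquare d := by
  rintro ⟨r, rfl⟩
  have := Nat.isUnit_iff.1 (h r dvd_rfl)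
  subst this; omega

theorem det_mul {m k : ℕ} (hsf : Squarefree (m * k)) (hm : m % 4 = 1) (hk : Odd k) (hm1 : 1 < m)
    (hk1 : 1 < k) : Det (m * k) := by
  right
  intro n hn
  exact even1 hn hm hk (Nat.coprime_of_squarefree_mul hsf) (sqf_nsq hsf.of_mul_left hm1)
    (sqf_nsq hsf.of_mul_right hk1) (sqf_nsq hsf (by nlinarith))

theorem rep7 {p : ℕ} (hp : p.Prime) (h8 : p % 8 = 7) :
    ∃ a b : ℤ, 0 < a ∧ a ^ 2 - 2 * b ^ 2 = p ∧ a % 2 = 1 ∧ b % 2 = 1 := by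
  obtain ⟨a, b, ha, h⟩ := rep_exists hp (Or.inr h8)
  have hp8 : (p : ℤ) % 8 = 7 := by omega
  have haodd : a % 2 = 1 := by
    rcases Int.emod_two_eq_zero_or_one a with h0 | h0
    · exfalso
      obtain ⟨k, rfl⟩ : (2 : ℤ) ∣ a := Int.dvd_of_emod_eq_zero h0
      have : (p : ℤ) = 2 * (2 * k ^ 2 - b ^ 2) := by rw [← h]; ring
      omega
    · exact h0
  refine ⟨a, b, ha, h, haodd, ?_⟩
  rcases Int.emod_two_eq_zero_or_one b with h0 | h0
  · exfalso
    obtain ⟨k, hk⟩ : ∃ k, a = 2 * k + 1 := ⟨a / 2, by omega⟩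
    obtain ⟨l, hl⟩ : ∃ l, b = 2 * l := ⟨b / 2, by omega⟩
    have : (p : ℤ) = 4 * (k ^ 2 + k - 2 * l ^ 2) + 1 := by rw [← h, hk, hl]; ring
    omega
  · exact h0

theorem det77 {p q : ℕ} (hp : p.Prime) (hq : q.Prime) (hp8 : p % 8 = 7) (hq8 : q % 8 = 7)
    (hsf : Squarefree (p * q)) : Det (p * q) := by
  obtain ⟨a, b, ha, h, hao, hbo⟩ := rep7 hp hp8
  obtain ⟨c, e, hc, h', hco, heo⟩ := rep7 hq hq8
  right
  intro n hn
  have hodd : Odd (p * q) := by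
    apply Odd.mul <;> rw [Nat.odd_iff] <;> omega
  have hns : ¬ IsSquare (p * q) := sqf_nsq hsf (by nlinarith [hp.two_le, hq.two_le])
  have hlt : (2 * (b * e)) ^ 2 < (a * c) ^ 2 := by
    have h1 : (0 : ℤ) < p := by exact_mod_cast hp.pos
    have h2 : (0 : ℤ) < q := by exact_mod_cast hq.pos
    have : (a * c) ^ 2 = (2 * (b * e)) ^ 2 + (p * q + 2 * b ^ 2 * q + 2 * e ^ 2 * p) := by
      rw [← h, ← h']; ring
    rw [this]
    have : 0 < (p : ℤ) * q := mul_pos h1 h2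
    have : 0 ≤ 2 * b ^ 2 * (q : ℤ) := by positivity
    have : 0 ≤ 2 * e ^ 2 * (p : ℤ) := by positivity
    linarith
  obtain ⟨hl, hr⟩ := abs_lt.1 (abs_lt_of_sq_lt_sq hlt (by positivity))
  obtain ⟨a', rfl⟩ : ∃ k, a = 2 * k + 1 := ⟨a / 2, by omega⟩
  obtain ⟨b', rfl⟩ : ∃ k, b = 2 * k + 1 := ⟨b / 2, by omega⟩
  obtain ⟨c', rfl⟩ : ∃ k, c = 2 * k + 1 := ⟨c / 2, by omega⟩
  obtain ⟨e', rfl⟩ : ∃ k, e = 2 * k + 1 := ⟨e / 2, by omega⟩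
  have main : ∀ A B : ℤ, 0 < A → A ^ 2 - 2 * B ^ 2 = (p * q : ℕ) →
      ((A % 4 = 1 ∧ B % 4 = 0) ∨ (A % 4 = 3 ∧ B % 4 = 2)) →
      ¬ Odd (Nat.card (ClassGroup (𝓞 (towL n (p * q))))) := by
    intro A B hA hAB hcase
    have hco := rep_coprime hodd hsf hAB
    rcases hcase with ⟨h1, h2⟩ | ⟨h1, h2⟩
    · exact even2 hn hodd hns hA hAB hco 1 0 (A / 4) (B / 4) (by omega) (by omega)
    · exact even2 hn hodd hns hA hAB hco 1 1 (A / 4) (B / 4) (by omega) (by omega)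
  have eq1 : ((2 * a' + 1) * (2 * c' + 1) + 2 * ((2 * b' + 1) * (2 * e' + 1))) ^ 2 -
      2 * ((2 * a' + 1) * (2 * e' + 1) + (2 * b' + 1) * (2 * c' + 1)) ^ 2 = (p * q : ℕ) := by
    push_cast; rw [← h, ← h']; ring
  have eq2 : ((2 * a' + 1) * (2 * c' + 1) - 2 * ((2 * b' + 1) * (2 * e' + 1))) ^ 2 -
      2 * (-((2 * a' + 1) * (2 * e' + 1)) + (2 * b' + 1) * (2 * c' + 1)) ^ 2 = (p * q : ℕ) := by
    push_cast; rw [← h, ← h']; ring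
  by_cases hcase : ((((2 * a' + 1) * (2 * c' + 1) + 2 * ((2 * b' + 1) * (2 * e' + 1))) % 4 = 1 ∧
      ((2 * a' + 1) * (2 * e' + 1) + (2 * b' + 1) * (2 * c' + 1)) % 4 = 0) ∨
      (((2 * a' + 1) * (2 * c' + 1) + 2 * ((2 * b' + 1) * (2 * e' + 1))) % 4 = 3 ∧
      ((2 * a' + 1) * (2 * e' + 1) + (2 * b' + 1) * (2 * c' + 1)) % 4 = 2))
  · exact main _ _ (by linarith) eq1 hcase
  · refine main _ _ (by linarith) eq2 ?_
    ring_nf at hcase ⊢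
    omega

theorem det_all {d : ℕ} (hd : 1 < d) (hodd : Odd d) (hsf : Squarefree d) : Det d := by
  by_cases hpd : d.Prime
  · exact det_prime hpd hodd
  by_cases h1 : ∃ p, p.Prime ∧ p ∣ d ∧ p % 4 = 1
  · obtain ⟨p, hp, ⟨k, rfl⟩, h4⟩ := h1
    have hk0 : k ≠ 0 := by rintro rfl; simp at hd
    have hk1 : k ≠ 1 := by rintro rfl; rw [mul_one] at hpd; exact hpd hp
    exact det_mul hsf h4 (Nat.odd_mul.1 hodd).2 hp.one_lt (by omega)
  · have h3 : ∀ p, p.Prime → p ∣ d → p % 4 = 3 := by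
      intro p hp hpd
      have : Odd p := Odd.of_dvd_nat hodd hpd
      rw [Nat.odd_iff] at this
      have : p % 4 ≠ 1 := fun h => h1 ⟨p, hp, hpd, h⟩
      omega
    obtain ⟨p, hp, k, rfl⟩ := Nat.exists_prime_and_dvd hd.ne'
    have hk1 : k ≠ 1 := by rintro rfl; rw [mul_one] at hpd; exact hpd hp
    obtain ⟨q, hq, l, rfl⟩ := Nat.exists_prime_and_dvd hk1
    have hp4 := h3 p hp (dvd_mul_right _ _)
    have hq4 := h3 q hq ⟨p * l, by ring⟩
    by_cases hl1 : l = 1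
    · subst hl1
      rw [mul_one] at hsf ⊢
      have hpq : p ≠ q := by
        rintro rfl
        exact hp.one_lt.ne' (Nat.isUnit_iff.1 (hsf p dvd_rfl))
      rcases (show p % 8 = 3 ∨ q % 8 = 3 ∨ (p % 8 = 7 ∧ q % 8 = 7) by omega) with h | h | ⟨h, h'⟩
      · rw [mul_comm]
        exact Or.inl (fun n hn => oddA2 hn hq hp hq4 h hpq.symm)
      · exact Or.inl (fun n hn => oddA2 hn hp hq hp4 h hpq)
      · exact det77 hp hq h h' hsf
    · rw [← mul_assoc] at hsf hodd hd ⊢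
      have hl0 : l ≠ 0 := by rintro rfl; simp at hd
      refine det_mul hsf ?_ (Nat.odd_mul.1 hodd).2 ?_ (by omega)
      · rw [Nat.mul_mod, hp4, hq4]
      · nlinarith [hp.two_le, hq.two_le]

theorem det_iff {d : ℕ} (h : Det d) {n : ℕ} (hn : 1 ≤ n) :
    Odd (Nat.card (ClassGroup (𝓞 (towL n d)))) ↔ Odd (Nat.card (ClassGroup (𝓞 (towL 1 d)))) := by
  rcases h with h | h
  · exact ⟨fun _ => h 1 le_rfl, fun _ => h n hn⟩
  · exact ⟨fun h1 => absurd h1 (h n hn), fun h1 => absurd h1 (h 1 le_rfl)⟩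

/-- for odd squarefree `d > 1` and `n ≥ 1`, the class number of
`L_{n,d}⁺` is odd iff the class number of `ℚ(√2, √d)` is odd. -/
theorem classNumber_Lplus_odd_iff_biquadratic
    (d : ℕ) (hd1 : 1 < d) (hodd : Odd d) (hsf : Squarefree d)
    (n : ℕ) (hn : 1 ≤ n) :
    Odd (Nat.card (ClassGroup (𝓞 (LplusField n (d : ℤ))))) ↔
      Odd (Nat.card (ClassGroup (𝓞 (IntermediateField.adjoin ℚ
        ({z : ℂ | z ^ 2 = 2} ∪ {z : ℂ | z ^ 2 = ((d : ℤ) : ℂ)}))))) := by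
  have e1 : LplusField n (d : ℤ) = towL n d := by
    rw [towL_eq]
    unfold LplusField towx
    rw [show 2 * Real.pi / 2 ^ (n + 2) = Real.pi / 2 ^ (n + 1) by
      rw [pow_succ 2 (n + 1)]; field_simp]
  rw [e1, ← towL_eq_two]
  exact det_iff (det_all hd1 hodd hsf) hn
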